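/- Let n ≥ 4 and let (u, p) be a smooth solution of the steady Navier-Stokes equations on Ω = ℝⁿ₊ \ {0}, where ℝⁿ₊ = {x ∈ ℝⁿ : xₙ > 0}. Suppose u extends continuously (together with its first derivatives) to ∂ℝⁿ₊ \ {0} and satisfies the Navier slip boundary condition there, namely uₙ = 0 and ∂ₙ uᵢ = 0 for i = 1, …, n−1 on {x : xₙ = 0, x ≠ 0}. If there is a constant C > 0 such that |u(x)| ≤ C/|x| for all x ∈ Ω, then u ≡ 0 on Ω. -/

import Mathlib

namespace SteadyNS

open MeasureTheory Set Filter Topology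
open scoped ContDiff

variable {n : ℕ}

/-- Euclidean space of dimension `n`. -/
abbrev E (n : ℕ) := EuclideanSpace ℝ (Fin n)


/-- The `i`-th partial derivative. -/
noncomputable def pd (i : Fin n) (f : E n → ℝ) (x : E n) : ℝ :=
  fderiv ℝ f x (EuclideanSpace.single i 1)

section Calculus

variable {f g : E n → ℝ} {x : E n} {i : Fin n}

lemma pd_add (hf : DifferentiableAt ℝ f x) (hg : DifferentiableAt ℝ g x) :
    pd i (fun y => f y + g y) x = pd i f x + pd i g x := by
  simp [pd, fderiv_fun_add hf hg]

lemma pd_sub (hf : DifferentiableAt ℝ f x) (hg : DifferentiableAt ℝ g x) :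
    pd i (fun y => f y - g y) x = pd i f x - pd i g x := by
  simp [pd, fderiv_fun_sub hf hg]

lemma pd_neg : pd i (fun y => - f y) x = - pd i f x := by
  simp [pd, fderiv_fun_neg]

lemma pd_mul (hf : DifferentiableAt ℝ f x) (hg : DifferentiableAt ℝ g x) :
    pd i (fun y => f y * g y) x = pd i f x * g x + f x * pd i g x := by
  simp [pd, fderiv_fun_mul hf hg]; ring

lemma pd_const_mul (c : ℝ) (hf : DifferentiableAt ℝ f x) :
    pd i (fun y => c * f y) x = c * pd i f x := by
  simp [pd, fderiv_const_mul hf]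

lemma pd_const (c : ℝ) : pd i (fun _ : E n => c) x = 0 := by
  simp [pd]

lemma pd_sum {ι : Type*} {s : Finset ι} {F : ι → E n → ℝ}
    (hf : ∀ k ∈ s, DifferentiableAt ℝ (F k) x) :
    pd i (fun y => ∑ k ∈ s, F k y) x = ∑ k ∈ s, pd i (F k) x := by
  simp [pd, fderiv_fun_sum hf]

lemma pd_comp {h : ℝ → ℝ} {h' : ℝ} (hh : HasDerivAt h h' (f x)) (hf : DifferentiableAt ℝ f x) :
    pd i (fun y => h (f y)) x = h' * pd i f x := by
  have := (hh.comp_hasFDerivAt x hf.hasFDerivAt).fderiv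
  simp only [pd]
  rw [show (fun y => h (f y)) = h ∘ f from rfl, this]; simp

lemma pd_congr {f g : E n → ℝ} (h : f =ᶠ[𝓝 x] g) : pd i f x = pd i g x := by
  simp [pd, h.fderiv_eq]

lemma pd_congr_open {Ω : Set (E n)} (hΩ : IsOpen Ω) (hx : x ∈ Ω) (h : ∀ y ∈ Ω, f y = g y) :
    pd i f x = pd i g x :=
  pd_congr (Filter.eventually_of_mem (hΩ.mem_nhds hx) h)

lemma hasFDerivAt_coord (k : Fin n) (x : E n) :
    HasFDerivAt (fun y : E n => y k) (EuclideanSpace.proj k : E n →L[ℝ] ℝ) x :=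
  (EuclideanSpace.proj k : E n →L[ℝ] ℝ).hasFDerivAt

lemma differentiableAt_coord (k : Fin n) (x : E n) : DifferentiableAt ℝ (fun y : E n => y k) x :=
  (hasFDerivAt_coord k x).differentiableAt

lemma contDiff_coord (k : Fin n) {m : WithTop ℕ∞} : ContDiff ℝ m (fun y : E n => y k) :=
  (EuclideanSpace.proj k : E n →L[ℝ] ℝ).contDiff

lemma pd_coord (k : Fin n) : pd i (fun y : E n => y k) x = if i = k then 1 else 0 := by
  simp only [pd, (hasFDerivAt_coord k x).fderiv]
  simp [eq_comm]

/-- The squared norm. -/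
noncomputable def nsq (x : E n) : ℝ := ‖x‖ ^ 2

lemma nsq_eq (x : E n) : nsq x = ∑ i, x i ^ 2 := EuclideanSpace.real_norm_sq_eq x

lemma nsq_nonneg (x : E n) : 0 ≤ nsq x := sq_nonneg _

lemma nsq_pos {x : E n} (hx : x ≠ 0) : 0 < nsq x := by
  unfold nsq; have := norm_pos_iff.2 hx; positivity

lemma contDiff_nsq {m : WithTop ℕ∞} : ContDiff ℝ m (nsq : E n → ℝ) := contDiff_norm_sq ℝ

lemma differentiableAt_nsq (x : E n) : DifferentiableAt ℝ nsq x :=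
  (contDiff_nsq (m := 1)).differentiable one_ne_zero x

lemma pd_nsq : pd i nsq x = 2 * x i := by
  have h : (nsq : E n → ℝ) = fun y => ∑ k, y k * y k := by
    ext y; rw [nsq_eq]; simp [sq]
  have hd : ∀ k ∈ Finset.univ, DifferentiableAt ℝ (fun y : E n => y k * y k) x :=
    fun k _ => (differentiableAt_coord k x).mul (differentiableAt_coord k x)
  rw [h, pd_sum hd]
  simp only [pd_mul (differentiableAt_coord _ x) (differentiableAt_coord _ x), pd_coord]
  simp [Finset.sum_add_distrib]; ring

lemma pd_radial {h : ℝ → ℝ} {h' : ℝ} (hh : HasDerivAt h h' (nsq x)) :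
    pd i (fun y => h (nsq y)) x = h' * (2 * x i) := by
  rw [pd_comp hh (differentiableAt_nsq x), pd_nsq]

lemma abs_coord_le (x : E n) (i : Fin n) : |x i| ≤ ‖x‖ := by
  simpa using PiLp.norm_apply_le x i

end Calculus

/-- Continuous functions with compact support in `Ω`. -/
structure CC (Ω : Set (E n)) (f : E n → ℝ) : Prop where
  cont : Continuous f
  compact : HasCompactSupport f
  sub : tsupport f ⊆ Ω

/-- Compactly supported test functions of class `C¹` in `Ω`. -/
structure Test (Ω : Set (E n)) (f : E n → ℝ) : Prop where
  smooth : ContDiff ℝ 1 f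
  compact : HasCompactSupport f
  sub : tsupport f ⊆ Ω

section TestFunctions

variable {Ω : Set (E n)} {f g a : E n → ℝ} {x : E n} {i : Fin n}

lemma CC.integrable (hf : CC Ω f) : Integrable f := hf.cont.integrable_of_hasCompactSupport hf.compact

lemma CC.integrableOn (hf : CC Ω f) : IntegrableOn f Ω := hf.integrable.integrableOn

lemma CC.of_tsupport (hf : ContinuousOn f Ω) (hΩ : IsOpen Ω) (hg : CC Ω g)
    (h : tsupport f ⊆ tsupport g) : CC Ω f where
  cont := by
    rw [continuous_iff_continuousAt]
    intro x
    by_cases hx : x ∈ Ω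
    · exact hf.continuousAt (hΩ.mem_nhds hx)
    · have : f =ᶠ[𝓝 x] 0 := notMem_tsupport_iff_eventuallyEq.1 (fun h' => hx (hg.sub (h h')))
      exact continuousAt_const.congr this.symm
  compact := hg.compact.of_isClosed_subset (isClosed_tsupport _) h
  sub := h.trans hg.sub

lemma tsupport_mul_right (a f : E n → ℝ) : tsupport (fun x => a x * f x) ⊆ tsupport f :=
  closure_mono (fun x hx => by simp only [Function.mem_support] at hx ⊢; exact right_ne_zero_of_mul hx)

lemma CC.mul_left (hf : CC Ω f) (hΩ : IsOpen Ω) (ha : ContinuousOn a Ω) :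
    CC Ω (fun x => a x * f x) :=
  CC.of_tsupport (ha.mul hf.cont.continuousOn) hΩ hf (tsupport_mul_right a f)

lemma CC.mul_right (hf : CC Ω f) (hΩ : IsOpen Ω) (ha : ContinuousOn a Ω) :
    CC Ω (fun x => f x * a x) := by
  simpa only [mul_comm] using hf.mul_left hΩ ha

lemma tsupport_add' (f g : E n → ℝ) : tsupport (fun x => f x + g x) ⊆ tsupport f ∪ tsupport g := by
  rw [tsupport, tsupport, tsupport, ← closure_union]
  apply closure_mono
  intro x hx
  by_contra h
  simp only [mem_union, Function.mem_support, not_or, not_not] at h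
  simp [h.1, h.2] at hx

lemma CC.zero : CC Ω (fun _ => 0) :=
  ⟨continuous_const, HasCompactSupport.zero, by
    have : tsupport (fun _ : E n => (0:ℝ)) = ∅ := tsupport_eq_empty_iff.2 rfl
    simp [this]⟩

lemma CC.add (hf : CC Ω f) (hg : CC Ω g) : CC Ω (fun x => f x + g x) :=
  ⟨hf.cont.add hg.cont, hf.compact.add hg.compact,
    (tsupport_add' f g).trans (union_subset hf.sub hg.sub)⟩

lemma CC.const_mul (hf : CC Ω f) (c : ℝ) : CC Ω (fun x => c * f x) :=
  ⟨continuous_const.mul hf.cont, hf.compact.of_isClosed_subset (isClosed_tsupport _)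
    (tsupport_mul_right _ f), (tsupport_mul_right _ f).trans hf.sub⟩

lemma CC.neg (hf : CC Ω f) : CC Ω (fun x => - f x) := by
  simpa using hf.const_mul (-1)

lemma CC.sub' (hf : CC Ω f) (hg : CC Ω g) : CC Ω (fun x => f x - g x) := by
  simpa [sub_eq_add_neg] using hf.add hg.neg

lemma CC.sum {ι : Type*} {s : Finset ι} {F : ι → E n → ℝ} (h : ∀ k ∈ s, CC Ω (F k)) :
    CC Ω (fun x => ∑ k ∈ s, F k x) := by
  classical
  induction s using Finset.induction_on with
  | empty => simpa using CC.zero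
  | insert k s hk ih =>
    simp only [Finset.sum_insert hk]
    exact (h k (by simp)).add (ih fun l hl => h l (by simp [hl]))

lemma CC.eq_zero (hf : CC Ω f) (hx : x ∉ Ω) : f x = 0 :=
  image_eq_zero_of_notMem_tsupport fun h => hx (hf.sub h)

lemma Test.cc (hf : Test Ω f) : CC Ω f := ⟨hf.smooth.continuous, hf.compact, hf.sub⟩

lemma Test.diff (hf : Test Ω f) (x : E n) : DifferentiableAt ℝ f x :=
  hf.smooth.differentiable one_ne_zero x

lemma tsupport_pd (f : E n → ℝ) : tsupport (pd i f) ⊆ tsupport f :=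
  tsupport_fderiv_apply_subset ℝ _

lemma contDiff_pd {m : WithTop ℕ∞} {k : WithTop ℕ∞} (hf : ContDiff ℝ k f) (h : m + 1 ≤ k) :
    ContDiff ℝ m (pd i f) :=
  (hf.fderiv_right h).clm_apply contDiff_const

lemma contDiffOn_pd {m k : WithTop ℕ∞} (hΩ : IsOpen Ω) (hf : ContDiffOn ℝ k f Ω) (h : m + 1 ≤ k) :
    ContDiffOn ℝ m (pd i f) Ω :=
  (hf.fderiv_of_isOpen hΩ h).clm_apply contDiffOn_const

lemma continuousOn_pd (hΩ : IsOpen Ω) (hf : ContDiffOn ℝ 1 f Ω) : ContinuousOn (pd i f) Ω :=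
  (contDiffOn_pd (m := 0) hΩ hf (by simp)).continuousOn

lemma diffAt (hΩ : IsOpen Ω) (hf : ContDiffOn ℝ 1 f Ω) (hx : x ∈ Ω) : DifferentiableAt ℝ f x :=
  (hf.contDiffAt (hΩ.mem_nhds hx)).differentiableAt one_ne_zero

lemma Test.pd_cc (hf : Test Ω f) (i : Fin n) : CC Ω (pd i f) where
  cont := (contDiff_pd (m := 0) hf.smooth (by simp)).continuous
  compact := hf.compact.of_isClosed_subset (isClosed_tsupport _) (tsupport_pd f)
  sub := (tsupport_pd f).trans hf.sub

lemma Test.of_tsupport (hf : ContDiffOn ℝ 1 f Ω) (hΩ : IsOpen Ω) (hg : CC Ω g)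
    (h : tsupport f ⊆ tsupport g) : Test Ω f where
  smooth := by
    rw [contDiff_iff_contDiffAt]
    intro x
    by_cases hx : x ∈ Ω
    · exact hf.contDiffAt (hΩ.mem_nhds hx)
    · have : f =ᶠ[𝓝 x] 0 := notMem_tsupport_iff_eventuallyEq.1 (fun h' => hx (hg.sub (h h')))
      exact contDiffAt_const.congr_of_eventuallyEq this
  compact := hg.compact.of_isClosed_subset (isClosed_tsupport _) h
  sub := h.trans hg.sub

lemma Test.mul_left (hf : Test Ω f) (hΩ : IsOpen Ω) (ha : ContDiffOn ℝ 1 a Ω) :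
    Test Ω (fun x => a x * f x) :=
  Test.of_tsupport (ha.mul hf.smooth.contDiffOn) hΩ hf.cc (tsupport_mul_right a f)

lemma Test.const_mul (hf : Test Ω f) (c : ℝ) : Test Ω (fun x => c * f x) :=
  ⟨contDiff_const.mul hf.smooth, (hf.cc.const_mul c).compact, (hf.cc.const_mul c).sub⟩

lemma integral_pd_eq_zero (hf : ContDiff ℝ 1 f) (hc : HasCompactSupport f) (i : Fin n) :
    ∫ x, pd i f x = 0 := by
  have ht : Test univ f := ⟨hf, hc, subset_univ _⟩
  have := integral_mul_fderiv_eq_neg_fderiv_mul_of_integrable (μ := (volume : Measure (E n)))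
    (f := fun _ => (1:ℝ)) (g := f) (v := EuclideanSpace.single i 1) (by simp)
    (by simpa using! (ht.pd_cc i).integrable) (by simpa using ht.cc.integrable)
    (fun x _ => by fun_prop) (fun x _ => ht.diff x)
  simpa [pd] using this

lemma CC.setIntegral (hf : CC Ω f) : ∫ x in Ω, f x = ∫ x, f x :=
  setIntegral_eq_integral_of_forall_compl_eq_zero fun _ hx => hf.eq_zero hx

/-- Integral of the divergence of a compactly supported field. -/
lemma integral_div_zero (hΩ : IsOpen Ω) {V : Fin n → E n → ℝ} (hV : ∀ i, Test Ω (V i))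
    (hg : ∀ x ∈ Ω, g x = ∑ i, pd i (V i) x) : ∫ x in Ω, g x = 0 := by
  rw [setIntegral_congr_fun hΩ.measurableSet hg, integral_finsetSum]
  · refine Finset.sum_eq_zero fun i _ => ?_
    rw [((hV i).pd_cc i).setIntegral, integral_pd_eq_zero (hV i).smooth (hV i).compact]
  · exact fun i _ => ((hV i).pd_cc i).integrableOn

/-- Integration by parts against a test function. -/
lemma integral_mul_pd (hΩ : IsOpen Ω) (ha : ContDiffOn ℝ 1 a Ω) (hf : Test Ω f) (i : Fin n) :
    ∫ x in Ω, a x * pd i f x = - ∫ x in Ω, pd i a x * f x := by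
  have h1 : ∫ x in Ω, (pd i a x * f x + a x * pd i f x) = 0 := by
    rw [setIntegral_congr_fun (g := pd i (fun y => a y * f y)) hΩ.measurableSet
      (fun x hx => (pd_mul (diffAt hΩ ha hx) (hf.diff x)).symm),
      ((hf.mul_left hΩ ha).pd_cc i).setIntegral, integral_pd_eq_zero]
    · exact (hf.mul_left hΩ ha).smooth
    · exact (hf.mul_left hΩ ha).compact
  rw [integral_add (hf.cc.mul_left hΩ (continuousOn_pd hΩ ha)).integrableOn
    ((hf.pd_cc i).mul_left hΩ ha.continuousOn).integrableOn] at h1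
  linarith

end TestFunctions

/-- The Laplacian. -/
noncomputable def lap (f : E n → ℝ) (x : E n) : ℝ := ∑ i, pd i (pd i f) x

lemma lap_continuous {f : E n → ℝ} (hf : ContDiff ℝ 2 f) : Continuous (lap f) :=
  continuous_finsetSum _ fun i _ =>
    (contDiff_pd (m := 0) (contDiff_pd (m := 1) hf (by norm_num)) (by norm_num)).continuous

/-- Weak form of `Δ f = g` in `Ω`. -/
def VWeak (Ω : Set (E n)) (f g : E n → ℝ) : Prop :=
  ∀ ψ : E n → ℝ, ContDiff ℝ 2 ψ → HasCompactSupport ψ → tsupport ψ ⊆ Ω →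
    ∫ x in Ω, f x * lap ψ x = ∫ x in Ω, g x * ψ x

/-- Two kernels `κ`, `l` supported in the unit ball with `m κ + z · ∇κ = - Δ l`. -/
structure ScalePair (m : ℕ) (κ l : E n → ℝ) : Prop where
  smooth : ContDiff ℝ ∞ κ
  smooth' : ContDiff ℝ ∞ l
  supp : ∀ z, 1 ≤ ‖z‖ → κ z = 0
  supp' : ∀ z, 1 ≤ ‖z‖ → l z = 0
  eq : ∀ z, m * κ z + fderiv ℝ κ z z = - lap l z

/-- The convolution of `f` with `s⁻ᵐ κ(·/s)`. -/
noncomputable def Av (m : ℕ) (κ f : E n → ℝ) (x : E n) (s : ℝ) : ℝ :=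
  ∫ y, f y * (s⁻¹ ^ m * κ (s⁻¹ • (x - y)))

lemma smul_sub_norm {x y : E n} {s : ℝ} (hs : 0 < s) (hy : s ≤ dist y x) :
    1 ≤ ‖s⁻¹ • (x - y)‖ := by
  rw [norm_smul, Real.norm_of_nonneg (inv_pos.2 hs).le, ← dist_eq_norm, dist_comm,
    inv_mul_eq_div, one_le_div hs]
  exact hy

lemma pd_scale {h : E n → ℝ} (hh : Differentiable ℝ h) (x y : E n) (t : ℝ) (i : Fin n) :
    pd i (fun y => h (t • (x - y))) y = - t * pd i h (t • (x - y)) := by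
  have h1 : HasFDerivAt (fun y : E n => t • (x - y)) (t • (-ContinuousLinearMap.id ℝ (E n))) y :=
    ((hasFDerivAt_id y).const_sub x).const_smul t
  have := ((hh (t • (x - y))).hasFDerivAt.comp y h1).fderiv
  simp only [pd]
  rw [show (fun y => h (t • (x - y))) = h ∘ fun y => t • (x - y) from rfl, this]
  simp

lemma lap_scale {h : E n → ℝ} (hh : ContDiff ℝ 2 h) (x y : E n) (t : ℝ) :
    lap (fun y => h (t • (x - y))) y = t ^ 2 * lap h (t • (x - y)) := by
  simp only [lap, Finset.mul_sum]
  refine Finset.sum_congr rfl fun i _ => ?_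
  have h1 : ContDiff ℝ 1 (pd i h) := contDiff_pd hh (by norm_num)
  have h2 : pd i (fun y => h (t • (x - y))) = fun y => - t * pd i h (t • (x - y)) :=
    funext fun y => pd_scale (hh.differentiable two_ne_zero) x y t i
  rw [h2, pd_const_mul, pd_scale (h1.differentiable one_ne_zero)]
  · ring
  · have := h1.differentiable one_ne_zero
    fun_prop

lemma tsupport_scale {h : E n → ℝ} (hs : ∀ z, 1 ≤ ‖z‖ → h z = 0) (x : E n) {s : ℝ} (h0 : 0 < s) :
    tsupport (fun y => h (s⁻¹ • (x - y))) ⊆ Metric.closedBall x s := by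
  refine closure_minimal (fun y hy => ?_) Metric.isClosed_closedBall
  by_contra hc
  rw [Metric.mem_closedBall, not_le] at hc
  exact hy (hs _ (smul_sub_norm h0 hc.le))

lemma compact_of_supp {h : E n → ℝ} (hs : ∀ z, 1 ≤ ‖z‖ → h z = 0) : HasCompactSupport h := by
  refine HasCompactSupport.intro (isCompact_closedBall (0 : E n) 1) fun z hz => hs z ?_
  simp only [Metric.mem_closedBall, dist_zero_right, not_le] at hz
  exact hz.le

lemma contDiff_scale {h : E n → ℝ} {m : WithTop ℕ∞} (hh : ContDiff ℝ m h) (x : E n) (t : ℝ) :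
    ContDiff ℝ m (fun y => h (t • (x - y))) :=
  hh.comp ((contDiff_const.sub contDiff_id).const_smul t)

lemma compact_scale {h : E n → ℝ} (hs : ∀ z, 1 ≤ ‖z‖ → h z = 0) (x : E n) {s : ℝ} (h0 : 0 < s) :
    HasCompactSupport (fun y => h (s⁻¹ • (x - y))) :=
  (isCompact_closedBall x s).of_isClosed_subset (isClosed_tsupport _) (tsupport_scale hs x h0)

lemma hasDerivAt_scale {κ : E n → ℝ} (hκ : Differentiable ℝ κ) (m : ℕ) (w : E n) {s : ℝ}
    (hs : s ≠ 0) :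
    HasDerivAt (fun s : ℝ => s⁻¹ ^ m * κ (s⁻¹ • w))
      (- s⁻¹ ^ (m + 1) * (m * κ (s⁻¹ • w) + fderiv ℝ κ (s⁻¹ • w) (s⁻¹ • w))) s := by
  have h1 : HasDerivAt (fun s : ℝ => s⁻¹) (-(s ^ 2)⁻¹) s := hasDerivAt_inv hs
  have h2 : HasDerivAt (fun s : ℝ => s⁻¹ • w) ((-(s ^ 2)⁻¹) • w) s := h1.smul_const w
  have h3 := (hκ (s⁻¹ • w)).hasFDerivAt.comp_hasDerivAt s h2
  refine ((h1.fun_pow m).mul h3).congr_deriv ?_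
  simp only [map_smul, smul_eq_mul, Function.comp]
  rcases m with _ | m
  · simp; field_simp
  · simp; field_simp; ring

theorem ScalePair.hasDerivAt {m : ℕ} {κ l f g : E n → ℝ} (h : ScalePair m κ l) {Ω : Set (E n)}
    (hw : VWeak Ω f g) {x : E n} {ρ : ℝ} (hΩ : Metric.closedBall x ρ ⊆ Ω)
    (hf : IntegrableOn f (Metric.closedBall x ρ)) {s : ℝ} (hs : 0 < s) (hsρ : s < ρ) :
    HasDerivAt (Av m κ f x) (s * (s⁻¹ ^ m * ∫ y in Ω, g y * l (s⁻¹ • (x - y)))) s := by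
  have hl2 : ContDiff ℝ 2 l := contDiff_infty.1 h.smooth' 2
  have hlc : Continuous (lap l) := lap_continuous hl2
  have hlz : ∀ z, 1 < ‖z‖ → lap l z = 0 := by
    intro z hz
    have : l =ᶠ[𝓝 z] fun _ => 0 := by
      filter_upwards [(isOpen_lt continuous_const continuous_norm).mem_nhds hz] with y hy
      exact h.supp' y (le_of_lt hy)
    refine Finset.sum_eq_zero fun i _ => ?_
    have h2 : pd i l =ᶠ[𝓝 z] fun _ => 0 := by
      filter_upwards [this.eventually_nhds] with y hy
      rw [pd_congr hy, pd_const]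
    rw [pd_congr h2, pd_const]
  obtain ⟨M, hM⟩ : ∃ M, ∀ z, ‖lap l z‖ ≤ M := by
    refine hlc.bounded_above_of_compact_support
      (HasCompactSupport.intro (isCompact_closedBall (0 : E n) 1) fun z hz => hlz z ?_)
    simpa using hz
  have hM0 : 0 ≤ M := (norm_nonneg _).trans (hM 0)
  have hκd : Differentiable ℝ κ := h.smooth.differentiable (by simp)
  set B := Metric.closedBall x ρ with hB
  set F : ℝ → E n → ℝ := fun s y => f y * (s⁻¹ ^ m * κ (s⁻¹ • (x - y))) with hF
  set F' : ℝ → E n → ℝ := fun s y => f y * (s⁻¹ ^ (m + 1) * lap l (s⁻¹ • (x - y))) with hF'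
  have hcong : ∀ᶠ t in 𝓝 s, Av m κ f x t = ∫ y in B, F t y := by
    filter_upwards [Ioo_mem_nhds hs hsρ] with t ht
    rw [Av, setIntegral_eq_integral_of_forall_compl_eq_zero]
    intro y hy
    rw [hB, Metric.mem_closedBall, not_le] at hy
    rw [hF]; simp only
    rw [h.supp _ (smul_sub_norm ht.1 (ht.2.le.trans hy.le))]; simp
  have hker : ∀ t : ℝ, Continuous (fun y => t⁻¹ ^ m * κ (t⁻¹ • (x - y))) := fun t => by
    have := h.smooth.continuous
    fun_prop
  have hker' : ∀ t : ℝ, Continuous (fun y => t⁻¹ ^ (m + 1) * lap l (t⁻¹ • (x - y))) := fun t => by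
    fun_prop
  have key := hasDerivAt_integral_of_dominated_loc_of_deriv_le (μ := volume.restrict B)
    (s := Ioo (s / 2) ρ) (F := F) (F' := F') (x₀ := s) (bound := fun y => ‖f y‖ * ((2 / s) ^ (m + 1) * M))
    (Ioo_mem_nhds (by linarith) hsρ) (Eventually.of_forall fun t =>
      hf.aestronglyMeasurable.mul (hker t).aestronglyMeasurable)
    (hf.mul_continuousOn (hker s).continuousOn (isCompact_closedBall x ρ))
    (hf.aestronglyMeasurable.mul (hker' s).aestronglyMeasurable)
    (Eventually.of_forall fun y t ht => by
      simp only [hF', norm_mul]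
      have ht0 : 0 < t := lt_trans (by positivity) ht.1
      gcongr
      · rw [norm_pow]; gcongr
        rw [Real.norm_of_nonneg (by positivity), inv_eq_one_div, div_le_div_iff₀ ht0 hs]
        linarith [ht.1]
      · exact hM _)
    (hf.norm.mul_const _)
    (Eventually.of_forall fun y t ht => by
      have ht0 : 0 < t := lt_trans (by positivity) ht.1
      have := (hasDerivAt_scale hκd m (x - y) ht0.ne').const_mul (f y)
      rw [h.eq] at this
      simpa [hF, hF'] using this)
  refine (key.2.congr_of_eventuallyEq hcong).congr_deriv ?_
  have e1 : ∫ y in B, F' s y = ∫ y in Ω, F' s y := by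
    rw [setIntegral_eq_integral_of_forall_compl_eq_zero,
      setIntegral_eq_integral_of_forall_compl_eq_zero]
    all_goals
      intro y hy
      have hy : y ∉ B := fun hc => hy (by first | exact hc | exact hΩ hc)
      rw [hB, Metric.mem_closedBall, not_le] at hy
      simp only [hF']
      rw [hlz]
      · simp
      · rw [norm_smul, Real.norm_of_nonneg (inv_pos.2 hs).le, ← dist_eq_norm, dist_comm,
          inv_mul_eq_div, one_lt_div hs]
        exact hsρ.trans hy
  have e2 := hw (fun y => l (s⁻¹ • (x - y))) (contDiff_scale hl2 x _)
    (compact_scale h.supp' x hs)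
    ((tsupport_scale h.supp' x hs).trans ((Metric.closedBall_subset_closedBall hsρ.le).trans hΩ))
  rw [e1, ← e2, ← integral_const_mul, ← integral_const_mul]
  congr 1; ext y
  rw [lap_scale hl2]
  simp only [hF', pow_succ]
  field_simp

lemma ScalePair.diff_le_aux {m : ℕ} {κ l g : E n → ℝ} (h : ScalePair m κ l) {Ω : Set (E n)}
    {x : E n} {ρ : ℝ} (hΩ : Metric.closedBall x ρ ⊆ Ω) {G L : ℝ} (hG : ∀ y ∈ Metric.closedBall x ρ, |g y| ≤ G)
    (hL : ∀ z, |l z| ≤ L) {s : ℝ} (hs : 0 < s) (hsρ : s < ρ) :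
    |∫ y in Ω, g y * l (s⁻¹ • (x - y))| ≤
      G * L * (volume.real (Metric.closedBall (0 : E n) 1)) * s ^ n := by
  have hL0 : 0 ≤ L := (abs_nonneg _).trans (hL 0)
  have hsub : Metric.closedBall x s ⊆ Metric.closedBall x ρ := Metric.closedBall_subset_closedBall hsρ.le
  have e1 : ∫ y in Ω, g y * l (s⁻¹ • (x - y)) =
      ∫ y in Metric.closedBall x s, g y * l (s⁻¹ • (x - y)) := by
    rw [setIntegral_eq_integral_of_forall_compl_eq_zero,
      setIntegral_eq_integral_of_forall_compl_eq_zero]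
    all_goals
      intro y hy
      have hy : y ∉ Metric.closedBall x s := fun hc => hy (by first | exact hc | exact hΩ (hsub hc))
      rw [Metric.mem_closedBall, not_le] at hy
      rw [h.supp' _ (smul_sub_norm hs hy.le)]; simp
  rw [e1]
  have := norm_setIntegral_le_of_norm_le_const (μ := volume) (s := Metric.closedBall x s)
    (f := fun y => g y * l (s⁻¹ • (x - y))) (C := G * L) measure_closedBall_lt_top
    (fun y hy => by
      rw [norm_mul]
      exact mul_le_mul (hG y (hsub hy)) (hL _) (norm_nonneg _)
        ((abs_nonneg _).trans (hG y (hsub hy))))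
  rw [Real.norm_eq_abs] at this
  refine this.trans_eq ?_
  rw [Measure.addHaar_real_closedBall _ _ hs.le]
  rw [finrank_euclideanSpace_fin]
  have : volume.real (Metric.closedBall (0 : E n) 1) = volume.real (Metric.ball (0 : E n) 1) := by
    have := Measure.addHaar_real_closedBall (μ := (volume : Measure (E n))) 0 (zero_le_one)
    simpa using this
  rw [this]; ring

/-- Quantitative comparison of the mollifications at two scales. -/
theorem ScalePair.diff_le {e : ℕ} (he : e ≤ 1) {κ l : E n → ℝ} (h : ScalePair (n + e) κ l) :
    ∃ c, 0 ≤ c ∧ ∀ {Ω : Set (E n)} {f g : E n → ℝ}, VWeak Ω f g → ∀ {x : E n} {ρ : ℝ},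
      Metric.closedBall x ρ ⊆ Ω → IntegrableOn f (Metric.closedBall x ρ) → ∀ {G : ℝ},
      (∀ y ∈ Metric.closedBall x ρ, |g y| ≤ G) → ∀ {s t : ℝ}, 0 < s → s ≤ t → t < ρ →
      |Av (n + e) κ f x t - Av (n + e) κ f x s| ≤ c * G * t ^ (1 - e) * (t - s) := by
  obtain ⟨L, hL⟩ : ∃ L, ∀ z, ‖l z‖ ≤ L :=
    h.smooth'.continuous.bounded_above_of_compact_support (compact_of_supp h.supp')
  have hL0 : 0 ≤ L := (norm_nonneg _).trans (hL 0)
  refine ⟨L * (volume.real (Metric.closedBall (0 : E n) 1)), by positivity, ?_⟩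
  intro Ω f g hw x ρ hΩ hf G hG s t hs hst htρ
  have hG0 : 0 ≤ G := (abs_nonneg _).trans (hG x (Metric.mem_closedBall_self (by linarith)))
  have := Convex.norm_image_sub_le_of_norm_hasDerivWithin_le (s := Icc s t) (f := Av (n + e) κ f x)
    (C := L * (volume.real (Metric.closedBall (0 : E n) 1)) * G * t ^ (1 - e))
    (fun r hr => (h.hasDerivAt hw hΩ hf (hs.trans_le hr.1) (hr.2.trans_lt htρ)).hasDerivWithinAt)
    (fun r hr => by
      have hr0 : 0 < r := hs.trans_le hr.1
      have := h.diff_le_aux hΩ hG hL hr0 (hr.2.trans_lt htρ)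
      rw [norm_mul, norm_mul, Real.norm_of_nonneg hr0.le, Real.norm_of_nonneg (by positivity),
        Real.norm_eq_abs]
      calc _ ≤ r * (r⁻¹ ^ (n + e) * (G * L * (volume.real (Metric.closedBall (0 : E n) 1)) * r ^ n)) := by
            gcongr
        _ = L * (volume.real (Metric.closedBall (0 : E n) 1)) * G * r ^ (1 - e) := by
            interval_cases e
            · simp; field_simp
            · simp [pow_succ]; field_simp
        _ ≤ _ := by gcongr; exact hr.2)
    (convex_Icc s t) (left_mem_Icc.2 hst) (right_mem_Icc.2 hst)
  rw [Real.norm_eq_abs, Real.norm_of_nonneg (sub_nonneg.2 hst)] at this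
  exact this

lemma pd_comm {Ω : Set (E n)} (hΩ : IsOpen Ω) {f : E n → ℝ} (hf : ContDiffOn ℝ 2 f Ω) {x : E n}
    (hx : x ∈ Ω) (i j : Fin n) : pd i (pd j f) x = pd j (pd i f) x := by
  have hd : DifferentiableAt ℝ (fderiv ℝ f) x :=
    ((hf.fderiv_of_isOpen (m := 1) hΩ (by norm_num)).contDiffAt (hΩ.mem_nhds hx)).differentiableAt
      one_ne_zero
  have h1 : ∀ i j : Fin n, pd i (pd j f) x =
      fderiv ℝ (fderiv ℝ f) x (EuclideanSpace.single i 1) (EuclideanSpace.single j 1) := by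
    intro i j
    have := (hd.hasFDerivAt.clm_apply
      (hasFDerivAt_const (EuclideanSpace.single j (1:ℝ)) x)).fderiv
    have e : pd j f = fun y => fderiv ℝ f y (EuclideanSpace.single j 1) := rfl
    rw [e, pd, this]; simp
  have hs : IsSymmSndFDerivAt ℝ f x :=
    (hf.contDiffAt (hΩ.mem_nhds hx)).isSymmSndFDerivAt (by simp)
  rw [h1, h1, hs.eq]

lemma fderiv_self_eq (f : E n → ℝ) (x : E n) : fderiv ℝ f x x = ∑ i, x i * pd i f x := by
  have h := congrArg (fderiv ℝ f x) ((EuclideanSpace.basisFun (Fin n) ℝ).sum_repr x)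
  rw [← h]
  simp [pd]

lemma differentiable_of_smooth {f : E n → ℝ} (h : ContDiff ℝ ∞ f) : Differentiable ℝ f :=
  h.differentiable (by simp)

lemma smooth_pd {f : E n → ℝ} (h : ContDiff ℝ ∞ f) (i : Fin n) : ContDiff ℝ ∞ (pd i f) :=
  contDiff_pd h (by simp)

lemma pd_supp {f : E n → ℝ} (h : Continuous (pd i f)) (hf : ∀ z, 1 ≤ ‖z‖ → f z = 0) (z : E n)
    (hz : 1 ≤ ‖z‖) : pd i f z = 0 := by
  have h1 : ∀ z, 1 < ‖z‖ → pd i f z = 0 := by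
    intro z hz
    have : f =ᶠ[𝓝 z] fun _ => 0 := by
      filter_upwards [(isOpen_lt continuous_const continuous_norm).mem_nhds hz] with y hy
      exact hf y (le_of_lt hy)
    rw [pd_congr this, pd_const]
  have h2 : Tendsto (fun t : ℝ => pd i f (t • z)) (𝓝[>] 1) (𝓝 (pd i f z)) := by
    have : Continuous (fun t : ℝ => pd i f (t • z)) := h.comp (continuous_id.smul continuous_const)
    have := (this.tendsto 1).mono_left (nhdsWithin_le_nhds (s := Ioi 1))
    simpa using this
  refine tendsto_nhds_unique h2 (tendsto_const_nhds.congr' ?_)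
  filter_upwards [self_mem_nhdsWithin] with t ht
  rw [h1]
  rw [norm_smul, Real.norm_of_nonneg (by linarith [mem_Ioi.1 ht])]
  have : 1 < t := ht
  nlinarith

/-- Mollification kernels: `η` and an auxiliary kernel `β` with `∇β = - z η`. -/
structure Moll (η β : E n → ℝ) : Prop where
  pair : ScalePair n η β
  pair' : ∀ k, ScalePair (n + 1) (pd k η) (pd k β)
  int : ∫ z, η z = 1

lemma scalePair_of_grad {η β : E n → ℝ} (hη : ContDiff ℝ ∞ η) (hβ : ContDiff ℝ ∞ β)
    (h1 : ∀ z, 1 ≤ ‖z‖ → η z = 0) (h2 : ∀ z, 1 ≤ ‖z‖ → β z = 0)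
    (h : ∀ i z, pd i β z = - (z i * η z)) : ScalePair n η β := by
  refine ⟨hη, hβ, h1, h2, fun z => ?_⟩
  have hη' := differentiable_of_smooth hη
  have : ∀ i, pd i (pd i β) z = - (η z + z i * pd i η z) := by
    intro i
    rw [show pd i β = fun z => - (z i * η z) from funext (h i), pd_neg,
      pd_mul (differentiableAt_coord i z) (hη' z), pd_coord]
    simp
  simp only [lap, this, fderiv_self_eq]
  simp [Finset.sum_add_distrib]

lemma ScalePair.pd {η β : E n → ℝ} (h : ScalePair n η β) (k : Fin n) :
    ScalePair (n + 1) (pd k η) (pd k β) := by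
  refine ⟨smooth_pd h.smooth k, smooth_pd h.smooth' k,
    pd_supp (smooth_pd h.smooth k).continuous h.supp,
    pd_supp (smooth_pd h.smooth' k).continuous h.supp', fun z => ?_⟩
  have hd := fun i => differentiable_of_smooth (smooth_pd h.smooth i)
  have hη := differentiable_of_smooth h.smooth
  have hd2 := fun i => differentiable_of_smooth (smooth_pd (smooth_pd h.smooth' i) i)
  have e1 : SteadyNS.pd k (lap β) z = lap (SteadyNS.pd k β) z := by
    unfold lap
    rw [pd_sum (fun i _ => hd2 i z)]
    refine Finset.sum_congr rfl fun i _ => ?_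
    rw [pd_comm isOpen_univ (contDiff_infty.1 (smooth_pd h.smooth' i) 2).contDiffOn (mem_univ z)]
    congr 1; ext y
    exact pd_comm isOpen_univ (contDiff_infty.1 h.smooth' 2).contDiffOn (mem_univ y) _ _
  have e2 : lap β = fun z => - (n * η z + ∑ i, z i * SteadyNS.pd i η z) := by
    ext y
    have := h.eq y
    rw [fderiv_self_eq] at this
    linarith
  have hs : ∀ i ∈ Finset.univ, DifferentiableAt ℝ (fun z : E n => z i * SteadyNS.pd i η z) z :=
    fun i _ => (differentiableAt_coord i z).mul (hd i z)
  rw [← e1, e2, pd_neg, pd_add ((hη z).const_mul _) (DifferentiableAt.fun_sum hs),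
    pd_const_mul _ (hη z), pd_sum hs, fderiv_self_eq]
  have : ∀ i, SteadyNS.pd k (fun z : E n => z i * SteadyNS.pd i η z) z =
      (if k = i then 1 else 0) * SteadyNS.pd i η z + z i * SteadyNS.pd i (SteadyNS.pd k η) z := by
    intro i
    rw [pd_mul (differentiableAt_coord i z) (hd i z), pd_coord,
      pd_comm isOpen_univ (contDiff_infty.1 h.smooth 2).contDiffOn (mem_univ z)]
  simp only [this, Finset.sum_add_distrib]
  simp
  ring

theorem exists_moll (hn : 1 ≤ n) : ∃ η β : E n → ℝ, Moll η β := by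
  set B : ℝ → ℝ := fun q => Real.smoothTransition (1 - q) with hB
  have hBs : ContDiff ℝ ∞ B := Real.smoothTransition.contDiff.comp (contDiff_const.sub contDiff_id)
  have hB's : ContDiff ℝ ∞ (deriv B) := (contDiff_infty_iff_deriv.1 hBs).2
  have hBd : Differentiable ℝ B := hBs.differentiable (by simp)
  have hBz : ∀ q, 1 ≤ q → B q = 0 := fun q hq =>
    Real.smoothTransition.zero_of_nonpos (by linarith)
  have hBanti : Antitone B := fun a b hab => Real.smoothTransition.monotone (by linarith)
  have hB'n : ∀ q, deriv B q ≤ 0 := fun q => hBanti.deriv_nonpos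
  have hq1 : ∀ z : E n, 1 ≤ ‖z‖ → 1 ≤ nsq z := fun z hz => by unfold nsq; nlinarith
  set η0 : E n → ℝ := fun z => -2 * deriv B (nsq z) with hη0
  set β0 : E n → ℝ := fun z => B (nsq z) with hβ0
  have hη0s : ContDiff ℝ ∞ η0 := contDiff_const.mul (hB's.comp contDiff_nsq)
  have hβ0s : ContDiff ℝ ∞ β0 := hBs.comp contDiff_nsq
  have hβz : ∀ z, 1 ≤ ‖z‖ → β0 z = 0 := fun z hz => hBz _ (hq1 z hz)
  have hgrad : ∀ i z, pd i β0 z = - (z i * η0 z) := fun i z => by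
    rw [hβ0, pd_radial (hBd _).hasDerivAt]; simp only [hη0]; ring
  have hηz : ∀ z, 1 ≤ ‖z‖ → η0 z = 0 := by
    intro z hz
    have hmin : IsLocalMin B (nsq z) := by
      refine Eventually.of_forall fun q => ?_
      rw [hBz _ (hq1 z hz)]; exact Real.smoothTransition.nonneg _
    simp [hη0, hmin.deriv_eq_zero]
  have hp := scalePair_of_grad hη0s hβ0s hηz hβz hgrad
  have hη0n : ∀ z, 0 ≤ η0 z := fun z => by
    simp only [hη0]; linarith [hB'n (nsq z)]
  have hβn : ∀ z, 0 ≤ β0 z := fun z => Real.smoothTransition.nonneg _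
  have hβt : Test univ β0 := ⟨contDiff_infty.1 hβ0s 1, compact_of_supp hβz, subset_univ _⟩
  have hηt : CC univ η0 := ⟨hη0s.continuous, compact_of_supp hηz, subset_univ _⟩
  have hpos : 0 < ∫ z, β0 z := by
    refine (integral_pos_iff_support_of_nonneg hβn hβt.cc.integrable).2 ?_
    refine (hβt.smooth.continuous.isOpen_support).measure_pos _ ⟨0, ?_⟩
    simp [hβ0, hB, nsq]
  have hqη : CC univ (fun z => nsq z * η0 z) :=
    hηt.mul_left isOpen_univ (contDiff_nsq (m := 0)).continuous.continuousOn
  have hdiv : ∫ z in univ, ((n : ℝ) * β0 z - nsq z * η0 z) = 0 := by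
    refine integral_div_zero isOpen_univ (V := fun i z => z i * β0 z)
      (fun i => hβt.mul_left isOpen_univ (contDiff_coord i).contDiffOn) fun z _ => ?_
    have : ∀ i, pd i (fun z : E n => z i * β0 z) z = β0 z - z i ^ 2 * η0 z := fun i => by
      rw [pd_mul (differentiableAt_coord i z) (hβt.diff z), pd_coord, hgrad]; simp; ring
    simp only [this, Finset.sum_sub_distrib, nsq_eq, Finset.sum_mul]
    simp
  rw [Measure.restrict_univ, integral_sub (hβt.cc.integrable.const_mul _) hqη.integrable,
    integral_const_mul] at hdiv
  have hle : ∫ z, nsq z * η0 z ≤ ∫ z, η0 z := by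
    refine integral_mono hqη.integrable hηt.integrable fun z => ?_
    simp only
    rcases le_or_gt 1 ‖z‖ with h | h
    · simp [hηz z h]
    · have : nsq z ≤ 1 := by unfold nsq; nlinarith [norm_nonneg z]
      nlinarith [hη0n z]
  have hI : 0 < ∫ z, η0 z := by
    have : (1:ℝ) ≤ n := by exact_mod_cast hn
    nlinarith
  set c := (∫ z, η0 z)⁻¹ with hc
  have hP : ScalePair n (fun z => c * η0 z) (fun z => c * β0 z) := by
    refine scalePair_of_grad (contDiff_const.mul hη0s) (contDiff_const.mul hβ0s)
      (fun z hz => by rw [hηz z hz, mul_zero]) (fun z hz => by rw [hβz z hz, mul_zero])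
      fun i z => ?_
    rw [pd_const_mul _ (hβt.diff z), hgrad]; ring
  refine ⟨_, _, hP, hP.pd, ?_⟩
  rw [integral_const_mul, hc, inv_mul_cancel₀ hI.ne']

section Consequences

variable {η β : E n → ℝ} {Ω : Set (E n)} {f g : E n → ℝ} {x : E n}

lemma test_scale {h : E n → ℝ} (hh : ContDiff ℝ ∞ h) (hs : ∀ z, 1 ≤ ‖z‖ → h z = 0)
    {s : ℝ} (h0 : 0 < s) (hsub : Metric.closedBall x s ⊆ Ω) (m : ℕ) :
    Test Ω (fun y => s⁻¹ ^ m * h (s⁻¹ • (x - y))) :=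
  Test.const_mul ⟨contDiff_infty.1 (contDiff_scale hh x _) 1, compact_scale hs x h0,
    (tsupport_scale hs x h0).trans hsub⟩ _

lemma Av_pd (hm : Moll η β) (hΩ : IsOpen Ω) (hf : ContDiffOn ℝ 1 f Ω) {s : ℝ} (h0 : 0 < s)
    (hsub : Metric.closedBall x s ⊆ Ω) (k : Fin n) :
    Av (n + 1) (pd k η) f x s = Av n η (pd k f) x s := by
  have ht := test_scale hm.pair.smooth hm.pair.supp h0 hsub n
  have h1 := integral_mul_pd hΩ hf ht k
  rw [((ht.pd_cc k).mul_left hΩ hf.continuousOn).setIntegral,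
    (ht.cc.mul_left hΩ (continuousOn_pd hΩ hf)).setIntegral] at h1
  rw [Av, Av, ← neg_eq_iff_eq_neg.2 h1, ← integral_neg]
  congr 1; ext y
  have hd := differentiable_of_smooth hm.pair.smooth
  rw [pd_const_mul, pd_scale hd]
  · ring
  · fun_prop

lemma Av_one (hm : Moll η β) {s : ℝ} (h0 : 0 < s) :
    ∫ y, s⁻¹ ^ n * η (s⁻¹ • (x - y)) = 1 := by
  rw [integral_const_mul, integral_sub_left_eq_self (fun y => η (s⁻¹ • y)),
    Measure.integral_comp_inv_smul_of_nonneg _ _ h0.le, hm.int, finrank_euclideanSpace_fin]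
  simp; field_simp

lemma Av_le {m : ℕ} {κ : E n → ℝ} (hκ : ContDiff ℝ ∞ κ) (hs : ∀ z, 1 ≤ ‖z‖ → κ z = 0) :
    ∃ c, 0 ≤ c ∧ ∀ {f : E n → ℝ} {x : E n} {s b : ℝ}, 0 < s → 
      (∀ y ∈ Metric.closedBall x s, |f y| ≤ b) → |Av m κ f x s| ≤ c * b * (s⁻¹ ^ m * s ^ n) := by
  refine ⟨∫ z, |κ z|, integral_nonneg fun _ => abs_nonneg _, fun {f x s b} h0 hb => ?_⟩
  have hi : Integrable (fun y => s⁻¹ ^ m * κ (s⁻¹ • (x - y))) :=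
    (test_scale (Ω := univ) hκ hs h0 (subset_univ _) m).cc.integrable
  have h1 : ∀ y, ‖f y * (s⁻¹ ^ m * κ (s⁻¹ • (x - y)))‖ ≤ b * |s⁻¹ ^ m * κ (s⁻¹ • (x - y))| := by
    intro y
    rw [norm_mul, Real.norm_eq_abs, Real.norm_eq_abs]
    by_cases hy : y ∈ Metric.closedBall x s
    · gcongr; exact hb y hy
    · rw [Metric.mem_closedBall, not_le] at hy
      rw [hs _ (smul_sub_norm h0 hy.le)]; simp
  have := norm_integral_le_of_norm_le (hi.abs.const_mul b) (Eventually.of_forall h1)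
  rw [Real.norm_eq_abs] at this
  refine this.trans_eq ?_
  rw [integral_const_mul]
  simp only [abs_mul, integral_const_mul]
  rw [integral_sub_left_eq_self (fun y => |κ (s⁻¹ • y)|),
    Measure.integral_comp_inv_smul_of_nonneg _ (fun y => |κ y|) h0.le, finrank_euclideanSpace_fin,
    abs_of_pos (by positivity)]
  simp; ring

lemma Av_sub_le (hm : Moll η β) : ∃ c, 0 ≤ c ∧ ∀ {Ω : Set (E n)} {h : E n → ℝ} {x : E n} {s b : ℝ},
    IsOpen Ω → ContinuousOn h Ω → 0 < s → Metric.closedBall x s ⊆ Ω →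
    (∀ y ∈ Metric.closedBall x s, |h y - h x| ≤ b) → |Av n η h x s - h x| ≤ c * b := by
  obtain ⟨c, hc, H⟩ := Av_le (m := n) hm.pair.smooth hm.pair.supp
  refine ⟨c, hc, fun {Ω h x s b} hΩ hh h0 hsub hb => ?_⟩
  have h1 := H h0 hb
  have hi := test_scale (x := x) hm.pair.smooth hm.pair.supp h0 hsub n
  have h2 : Av n η (fun y => h y - h x) x s = Av n η h x s - h x := by
    simp only [Av, sub_mul]
    rw [integral_sub (hi.cc.mul_left hΩ hh).integrable (hi.cc.integrable.const_mul _),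
      integral_const_mul, Av_one hm h0, mul_one]
  rw [← h2]
  refine h1.trans_eq ?_
  rw [← mul_pow, inv_mul_cancel₀ h0.ne']; simp

lemma Av_tendsto (hm : Moll η β) (hΩ : IsOpen Ω) (hf : ContinuousOn f Ω) (hx : x ∈ Ω) :
    Tendsto (Av n η f x) (𝓝[>] 0) (𝓝 (f x)) := by
  obtain ⟨c, hc, H⟩ := Av_sub_le hm
  rw [Metric.tendsto_nhds]
  intro ε hε
  have hca := Metric.continuousAt_iff.1 (hf.continuousAt (hΩ.mem_nhds hx)) (ε / (c + 1)) (by positivity)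
  obtain ⟨δ, hδ, h1⟩ := hca
  obtain ⟨r, hr, h2⟩ := Metric.isOpen_iff.1 hΩ x hx
  filter_upwards [Ioo_mem_nhdsGT (lt_min hδ hr)] with s hs
  have := H hΩ hf hs.1 (x := x) (b := ε / (c + 1))
    ((Metric.closedBall_subset_ball (hs.2.trans_le (min_le_right _ _))).trans h2)
    (fun y hy => (h1 ((Metric.mem_closedBall.1 hy).trans_lt (hs.2.trans_le (min_le_left _ _)))).le)
  rw [Real.dist_eq]
  refine this.trans_lt ?_
  rw [mul_div_assoc', div_lt_iff₀ (by positivity)]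
  nlinarith

/-- Interior gradient estimate in terms of the mollified gradient. -/
lemma pd_sub_Av_le (hm : Moll η β) (k : Fin n) : ∃ c, 0 ≤ c ∧
    ∀ {Ω : Set (E n)} {f g : E n → ℝ} {x : E n} {ρ t G : ℝ}, VWeak Ω f g →
      Metric.closedBall x ρ ⊆ Ω → IntegrableOn f (Metric.closedBall x ρ) →
      (∀ y ∈ Metric.closedBall x ρ, |g y| ≤ G) → 0 < t → t < ρ →
      ∀ {Ω' : Set (E n)}, IsOpen Ω' → ContDiffOn ℝ 1 f Ω' → x ∈ Ω' →
      |pd k f x - Av (n + 1) (pd k η) f x t| ≤ c * G * t := by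
  obtain ⟨c, hc, H⟩ := (hm.pair' k).diff_le le_rfl
  refine ⟨c, hc, fun {Ω f g x ρ t G} hw hsub hfi hG ht htρ Ω' hΩ hf hx => ?_⟩
  have h1 : Tendsto (fun s => Av (n + 1) (pd k η) f x s) (𝓝[>] 0) (𝓝 (pd k f x)) := by
    refine (Av_tendsto hm hΩ (continuousOn_pd hΩ hf) hx).congr' ?_
    obtain ⟨r, hr, h2⟩ := Metric.isOpen_iff.1 hΩ x hx
    filter_upwards [Ioo_mem_nhdsGT hr] with s hs
    exact (Av_pd hm hΩ hf hs.1 ((Metric.closedBall_subset_ball hs.2).trans h2) k).symm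
  rw [abs_sub_comm]
  refine le_of_tendsto ((tendsto_const_nhds.sub h1).abs) ?_
  have hG0 : 0 ≤ G := (abs_nonneg _).trans (hG x (Metric.mem_closedBall_self (by linarith)))
  filter_upwards [Ioo_mem_nhdsGT ht] with s hs
  refine (H hw hsub hfi hG hs.1 hs.2.le htρ).trans ?_
  simp only [Nat.sub_self, pow_zero, mul_one]
  have := hs.1
  gcongr; linarith

end Consequences

/-- The convective term. -/
noncomputable def conv (U : Fin n → E n → ℝ) (j : Fin n) (x : E n) : ℝ :=
  ∑ i, U i x * pd i (U j) x

/-- The vorticity. -/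
noncomputable def vort (U : Fin n → E n → ℝ) (i j : Fin n) (x : E n) : ℝ :=
  pd i (U j) x - pd j (U i) x

/-- The source term in the pressure equation. -/
noncomputable def src (U : Fin n → E n → ℝ) (x : E n) : ℝ :=
  ∑ i, ∑ j, pd i (U j) x * pd j (U i) x

/-- `C¹` weak solutions of the steady Navier-Stokes equations in `Ω`. -/
structure WeakSol (Ω : Set (E n)) (U : Fin n → E n → ℝ) (P : E n → ℝ) : Prop where
  regU : ∀ j, ContDiffOn ℝ 1 (U j) Ω
  regP : ContDiffOn ℝ 1 P Ω
  div : ∀ x ∈ Ω, ∑ i, pd i (U i) x = 0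
  mom : ∀ φ, Test Ω φ → ∀ j,
    ∫ x in Ω, ∑ i, pd i (U j) x * pd i φ x = - ∫ x in Ω, (conv U j x + pd j P x) * φ x
  mom' : ∀ φ, Test Ω φ → ∀ j,
    ∫ x in Ω, ∑ i, vort U i j x * pd i φ x = - ∫ x in Ω, (conv U j x + pd j P x) * φ x
  pres : ∀ φ, Test Ω φ → ∫ x in Ω, ∑ i, pd i P x * pd i φ x = ∫ x in Ω, src U x * φ x

lemma integral_mul_lap {Ω : Set (E n)} (hΩ : IsOpen Ω) {a ψ : E n → ℝ} (ha : ContDiffOn ℝ 1 a Ω)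
    (hψ : ContDiff ℝ 2 ψ) (hc : HasCompactSupport ψ) (hs : tsupport ψ ⊆ Ω) :
    ∫ x in Ω, a x * lap ψ x = - ∫ x in Ω, ∑ i, pd i a x * pd i ψ x := by
  have ht : ∀ i, Test Ω (pd i ψ) := fun i =>
    ⟨contDiff_pd hψ (by norm_num), hc.of_isClosed_subset (isClosed_tsupport _) (tsupport_pd ψ),
      (tsupport_pd ψ).trans hs⟩
  simp only [lap, Finset.mul_sum]
  rw [integral_finsetSum _ fun i _ => (((ht i).pd_cc i).mul_left hΩ ha.continuousOn).integrableOn,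
    integral_finsetSum _ fun i _ =>
      ((ht i).cc.mul_left hΩ (continuousOn_pd hΩ ha)).integrableOn, ← Finset.sum_neg_distrib]
  exact Finset.sum_congr rfl fun i _ => integral_mul_pd hΩ ha (ht i) i

section Reg
variable {Ω : Set (E n)} {U : Fin n → E n → ℝ}

lemma continuousOn_conv (hΩ : IsOpen Ω) (hU : ∀ j, ContDiffOn ℝ 1 (U j) Ω) (j : Fin n) :
    ContinuousOn (conv U j) Ω :=
  continuousOn_finsetSum _ fun i _ => (hU i).continuousOn.mul (continuousOn_pd hΩ (hU j))

lemma continuousOn_src (hΩ : IsOpen Ω) (hU : ∀ j, ContDiffOn ℝ 1 (U j) Ω) :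
    ContinuousOn (src U) Ω :=
  continuousOn_finsetSum _ fun i _ => continuousOn_finsetSum _ fun j _ =>
    (continuousOn_pd hΩ (hU j)).mul (continuousOn_pd hΩ (hU i))

lemma continuousOn_vort (hΩ : IsOpen Ω) (hU : ∀ j, ContDiffOn ℝ 1 (U j) Ω) (i j : Fin n) :
    ContinuousOn (vort U i j) Ω :=
  (continuousOn_pd hΩ (hU j)).sub (continuousOn_pd hΩ (hU i))

end Reg

section Interior

variable {Ω : Set (E n)} {U : Fin n → E n → ℝ} {P : E n → ℝ}

lemma WeakSol.vweakP (h : WeakSol Ω U P) (hΩ : IsOpen Ω) : VWeak Ω P (fun x => - src U x) := by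
  intro ψ h1 h2 h3
  rw [integral_mul_lap hΩ h.regP h1 h2 h3, h.pres ψ ⟨h1.of_le one_le_two, h2, h3⟩, ← integral_neg]
  simp

lemma WeakSol.vweakU (h : WeakSol Ω U P) (hΩ : IsOpen Ω) (j : Fin n) :
    VWeak Ω (U j) (fun x => conv U j x + pd j P x) := by
  intro ψ h1 h2 h3
  rw [integral_mul_lap hΩ (h.regU j) h1 h2 h3, h.mom ψ ⟨h1.of_le one_le_two, h2, h3⟩, neg_neg]

/-- Estimate of the mollified pressure gradient: in terms of bounds for `U`, or for `∇U`. -/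
lemma WeakSol.Av_P_le {η β : E n → ℝ} (hm : Moll η β) (j : Fin n) : ∃ c, 0 ≤ c ∧
    ∀ {Ω : Set (E n)} {U : Fin n → E n → ℝ} {P : E n → ℝ}, WeakSol Ω U P → IsOpen Ω →
    ∀ {x : E n} {ρ f : ℝ}, 0 < ρ → Metric.closedBall x ρ ⊆ Ω →
    (∀ y ∈ Metric.closedBall x ρ, |conv U j y| ≤ f) →
    (∀ b, (∀ y ∈ Metric.closedBall x ρ, |U j y| ≤ b) →
      |Av (n + 1) (pd j η) P x ρ| ≤ c * (b / ρ ^ 2 + f)) ∧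
    (∀ b, (∀ i, ∀ y ∈ Metric.closedBall x ρ, |pd i (U j) y| ≤ b) →
      |Av (n + 1) (pd j η) P x ρ| ≤ c * (b / ρ + f)) := by
  obtain ⟨c1, hc1, H1⟩ := Av_le (m := n) hm.pair.smooth hm.pair.supp
  have hls : ContDiff ℝ ∞ (lap η) := 
    ContDiff.sum fun i _ => smooth_pd (smooth_pd hm.pair.smooth i) i
  have hlz : ∀ z, 1 ≤ ‖z‖ → lap η z = 0 := fun z hz => Finset.sum_eq_zero fun i _ =>
    pd_supp (smooth_pd (smooth_pd hm.pair.smooth i) i).continuous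
      (pd_supp (smooth_pd hm.pair.smooth i).continuous hm.pair.supp) z hz
  obtain ⟨c2, hc2, H2⟩ := Av_le (m := n + 2) hls hlz
  have H3' := fun i => Av_le (m := n + 1) (hm.pair' i).smooth (hm.pair' i).supp
  choose c3 hc3 H3 using H3'
  refine ⟨c1 + c2 + ∑ i, c3 i, by
    have := Finset.sum_nonneg fun i (_ : i ∈ Finset.univ) => hc3 i
    positivity, ?_⟩
  intro Ω U P h hΩ x ρ f hρ hsub hf
  set S := ∑ i, c3 i with hS
  have hS0 : 0 ≤ S := Finset.sum_nonneg fun i (_ : i ∈ Finset.univ) => hc3 i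
  set φ : E n → ℝ := fun y => ρ⁻¹ ^ n * η (ρ⁻¹ • (x - y)) with hφ
  have ht : Test Ω φ := test_scale hm.pair.smooth hm.pair.supp hρ hsub n
  have hφ2 : ContDiff ℝ 2 φ :=
    contDiff_const.mul (contDiff_scale (contDiff_infty.1 hm.pair.smooth 2) x _)
  have hf0 : 0 ≤ f := (abs_nonneg _).trans (hf x (Metric.mem_closedBall_self hρ.le))
  have hcF := ht.cc.mul_left hΩ (continuousOn_conv hΩ h.regU j)
  have hcP := ht.cc.mul_left hΩ (continuousOn_pd hΩ h.regP (i := j))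
  have key : Av (n + 1) (pd j η) P x ρ =
      - (∫ y in Ω, ∑ i, pd i (U j) y * pd i φ y) - Av n η (conv U j) x ρ := by
    rw [Av_pd hm hΩ h.regP hρ hsub, h.mom φ ht j]
    simp only [add_mul]
    rw [integral_add hcF.integrableOn hcP.integrableOn, hcF.setIntegral, hcP.setIntegral]
    simp only [Av, hφ]; ring
  have hF := H1 hρ hf
  rw [← mul_pow, inv_mul_cancel₀ hρ.ne', one_pow, mul_one] at hF
  have hηd := differentiable_of_smooth hm.pair.smooth
  constructor
  · intro b hb
    have hb0 : 0 ≤ b := (abs_nonneg _).trans (hb x (Metric.mem_closedBall_self hρ.le))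
    have e1 : - (∫ y in Ω, ∑ i, pd i (U j) y * pd i φ y) = Av (n + 2) (lap η) (U j) x ρ := by
      rw [← integral_mul_lap hΩ (h.regU j) hφ2 ht.compact ht.sub]
      have e2 : ∀ y, lap φ y = ρ⁻¹ ^ (n + 2) * lap η (ρ⁻¹ • (x - y)) := by
        intro y
        have hs2 := contDiff_infty.1 hm.pair.smooth 2
        have : lap φ y = ρ⁻¹ ^ n * lap (fun y => η (ρ⁻¹ • (x - y))) y := by
          simp only [lap, Finset.mul_sum]
          refine Finset.sum_congr rfl fun i _ => ?_
          have hs1 : ContDiff ℝ 1 (pd i (fun y => η (ρ⁻¹ • (x - y)))) :=  contDiff_pd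
            (contDiff_scale hs2 x ρ⁻¹) (by norm_num)
          rw [← pd_const_mul _ (hs1.differentiable one_ne_zero y)]
          congr 1; ext y
          exact pd_const_mul _ ((contDiff_scale hs2 x ρ⁻¹).differentiable two_ne_zero y)
        rw [this, lap_scale hs2]; ring
      rw [setIntegral_eq_integral_of_forall_compl_eq_zero]
      · simp only [Av, e2]
      · intro y hy
        have hy : y ∉ Metric.closedBall x ρ := fun hc => hy (hsub hc)
        rw [Metric.mem_closedBall, not_le] at hy
        rw [e2, hlz _ (smul_sub_norm hρ hy.le)]; simp
    have h2 := H2 hρ hb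
    have e3 : ρ⁻¹ ^ (n + 2) * ρ ^ n = 1 / ρ ^ 2 := by simp only [inv_pow]; field_simp; ring
    rw [e3] at h2
    rw [key, e1]
    refine (abs_sub _ _).trans ?_
    have : 0 ≤ b / ρ ^ 2 := by positivity
    have e4 : c2 * b * (1 / ρ ^ 2) = c2 * (b / ρ ^ 2) := by ring
    nlinarith [mul_nonneg hc1 this, mul_nonneg hS0 this, mul_nonneg hc2 hf0, mul_nonneg hS0 hf0]
  · intro b hb
    have hb0 : 0 ≤ b := (abs_nonneg _).trans (hb j x (Metric.mem_closedBall_self hρ.le))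
    have e1 : - (∫ y in Ω, ∑ i, pd i (U j) y * pd i φ y) =
        ∑ i, Av (n + 1) (pd i η) (pd i (U j)) x ρ := by
      have hcc := fun i => (ht.pd_cc i).mul_left hΩ (continuousOn_pd hΩ (h.regU j) (i := i))
      rw [integral_finsetSum _ fun i _ => (hcc i).integrableOn, ← Finset.sum_neg_distrib]
      refine Finset.sum_congr rfl fun i _ => ?_
      rw [(hcc i).setIntegral, Av, ← integral_neg]
      congr 1; ext y
      rw [hφ, pd_const_mul, pd_scale hηd]
      · ring
      · fun_prop
    rw [key, e1]
    refine (abs_sub _ _).trans ?_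
    have h3 : |∑ i, Av (n + 1) (pd i η) (pd i (U j)) x ρ| ≤ S * (b / ρ) := by
      refine (Finset.abs_sum_le_sum_abs _ _).trans ?_
      rw [hS, Finset.sum_mul]
      refine Finset.sum_le_sum fun i _ => (H3 i hρ (hb i)).trans_eq ?_
      have e3 : ρ⁻¹ ^ (n + 1) * ρ ^ n = 1 / ρ := by simp only [inv_pow]; field_simp; ring
      rw [e3]; ring
    have : 0 ≤ b / ρ := by positivity
    nlinarith [mul_nonneg hc1 this, mul_nonneg hc2 this, mul_nonneg hc2 hf0, mul_nonneg hS0 hf0]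

lemma integrableOn_closedBall {f : E n → ℝ} {x : E n} {ρ : ℝ} (hf : ContinuousOn f Ω)
    (hsub : Metric.closedBall x ρ ⊆ Ω) : IntegrableOn f (Metric.closedBall x ρ) :=
  (hf.mono hsub).integrableOn_compact (isCompact_closedBall x ρ)

lemma WeakSol.pd_P_le {η β : E n → ℝ} (hm : Moll η β) (j : Fin n) : ∃ c, 0 ≤ c ∧
    ∀ {Ω : Set (E n)} {U : Fin n → E n → ℝ} {P : E n → ℝ}, WeakSol Ω U P → IsOpen Ω →
    ∀ {x : E n} {ρ f g : ℝ}, 0 < ρ → Metric.closedBall x (2 * ρ) ⊆ Ω →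
    (∀ y ∈ Metric.closedBall x (2 * ρ), |conv U j y| ≤ f) →
    (∀ y ∈ Metric.closedBall x (2 * ρ), |src U y| ≤ g) →
    (∀ b, (∀ y ∈ Metric.closedBall x (2 * ρ), |U j y| ≤ b) →
      |pd j P x| ≤ c * (b / ρ ^ 2 + f + g * ρ)) ∧
    (∀ b, (∀ i, ∀ y ∈ Metric.closedBall x (2 * ρ), |pd i (U j) y| ≤ b) →
      |pd j P x| ≤ c * (b / ρ + f + g * ρ)) := by
  obtain ⟨c1, hc1, H1⟩ := WeakSol.Av_P_le hm j
  obtain ⟨c2, hc2, H2⟩ := pd_sub_Av_le hm j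
  refine ⟨c1 + c2, by positivity, ?_⟩
  intro Ω U P h hΩ x ρ f g hρ hsub hf hg
  have hs1 : Metric.closedBall x ρ ⊆ Metric.closedBall x (2 * ρ) :=
    Metric.closedBall_subset_closedBall (by linarith)
  have hx : x ∈ Metric.closedBall x (2 * ρ) := Metric.mem_closedBall_self (by linarith)
  have h1 := H1 h hΩ hρ (hs1.trans hsub) (fun y hy => hf y (hs1 hy))
  have h2 := H2 (h.vweakP hΩ) hsub (integrableOn_closedBall h.regP.continuousOn hsub) (G := g)
    (by simpa using hg) hρ (by linarith) hΩ h.regP (hsub hx)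
  have hf0 : 0 ≤ f := (abs_nonneg _).trans (hf x hx)
  have hg0 : 0 ≤ g := (abs_nonneg _).trans (hg x hx)
  have h3 : |pd j P x| ≤ |pd j P x - Av (n + 1) (pd j η) P x ρ| + |Av (n + 1) (pd j η) P x ρ| := by
    simpa using abs_add_le (pd j P x - Av (n + 1) (pd j η) P x ρ) (Av (n + 1) (pd j η) P x ρ)
  have hgρ : 0 ≤ g * ρ := by positivity
  constructor
  · intro b hb
    have hb0 : 0 ≤ b := (abs_nonneg _).trans (hb x hx)
    have h4 := h1.1 b (fun y hy => hb y (hs1 hy))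
    have : 0 ≤ b / ρ ^ 2 := by positivity
    nlinarith [mul_nonneg hc1 hgρ, mul_nonneg hc2 this, mul_nonneg hc2 hf0]
  · intro b hb
    have hb0 : 0 ≤ b := (abs_nonneg _).trans (hb j x hx)
    have h4 := h1.2 b (fun i y hy => hb i y (hs1 hy))
    have : 0 ≤ b / ρ := by positivity
    nlinarith [mul_nonneg hc1 hgρ, mul_nonneg hc2 this, mul_nonneg hc2 hf0]

lemma WeakSol.pd_U_le {η β : E n → ℝ} (hm : Moll η β) (k : Fin n) : ∃ c, 0 ≤ c ∧
    ∀ {Ω : Set (E n)} {U : Fin n → E n → ℝ} {P : E n → ℝ}, WeakSol Ω U P → IsOpen Ω → ∀ j : Fin n,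
    ∀ {x : E n} {ρ b f : ℝ}, 0 < ρ → Metric.closedBall x (2 * ρ) ⊆ Ω →
    (∀ y ∈ Metric.closedBall x (2 * ρ), |conv U j y + pd j P y| ≤ f) →
    (∀ y ∈ Metric.closedBall x (2 * ρ), |U j y| ≤ b) → |pd k (U j) x| ≤ c * (b / ρ + f * ρ) := by
  obtain ⟨c1, hc1, H1⟩ := Av_le (m := n + 1) (hm.pair' k).smooth (hm.pair' k).supp
  obtain ⟨c2, hc2, H2⟩ := pd_sub_Av_le hm k
  refine ⟨c1 + c2, by positivity, ?_⟩
  intro Ω U P h hΩ j x ρ b f hρ hsub hf hb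
  have hs1 : Metric.closedBall x ρ ⊆ Metric.closedBall x (2 * ρ) :=
    Metric.closedBall_subset_closedBall (by linarith)
  have hx : x ∈ Metric.closedBall x (2 * ρ) := Metric.mem_closedBall_self (by linarith)
  have h1 := H1 hρ (fun y hy => hb y (hs1 hy))
  have h2 := H2 (h.vweakU hΩ j) hsub (integrableOn_closedBall (h.regU j).continuousOn hsub) hf
    hρ (by linarith) hΩ (h.regU j) (hsub hx)
  have e3 : ρ⁻¹ ^ (n + 1) * ρ ^ n = 1 / ρ := by simp only [inv_pow]; field_simp; ring
  rw [e3] at h1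
  have hf0 : 0 ≤ f := (abs_nonneg _).trans (hf x hx)
  have hb0 : 0 ≤ b := (abs_nonneg _).trans (hb x hx)
  have h3 : |pd k (U j) x| ≤ |pd k (U j) x - Av (n + 1) (pd k η) (U j) x ρ| +
      |Av (n + 1) (pd k η) (U j) x ρ| := by
    simpa using abs_add_le (pd k (U j) x - Av (n + 1) (pd k η) (U j) x ρ)
      (Av (n + 1) (pd k η) (U j) x ρ)
  have : 0 ≤ b / ρ := by positivity
  have : 0 ≤ f * ρ := by positivity
  have e4 : c1 * b * (1 / ρ) = c1 * (b / ρ) := by ring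
  nlinarith [mul_nonneg hc1 ‹0 ≤ f * ρ›, mul_nonneg hc2 ‹0 ≤ b / ρ›]

end Interior

/-- Weak solutions in the punctured space with the scale invariant decay. -/
structure Sol (C : ℝ) (U : Fin n → E n → ℝ) (P : E n → ℝ) : Prop extends WeakSol {0}ᶜ U P where
  pos : 0 < C
  bound : ∀ j x, x ≠ 0 → |U j x| ≤ C / ‖x‖

/-- The `ℓ¹` size of the gradient. -/
noncomputable def gradL1 (U : Fin n → E n → ℝ) (x : E n) : ℝ := ∑ i, ∑ j, |pd i (U j) x|

lemma gradL1_nonneg (U : Fin n → E n → ℝ) (x : E n) : 0 ≤ gradL1 U x :=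
  Finset.sum_nonneg fun _ _ => Finset.sum_nonneg fun _ _ => abs_nonneg _

lemma abs_pd_le_gradL1 (U : Fin n → E n → ℝ) (x : E n) (i j : Fin n) :
    |pd i (U j) x| ≤ gradL1 U x :=
  (Finset.single_le_sum (f := fun j => |pd i (U j) x|) (fun _ _ => abs_nonneg _)
    (Finset.mem_univ j)).trans (Finset.single_le_sum (f := fun i => ∑ j, |pd i (U j) x|)
    (fun _ _ => Finset.sum_nonneg fun _ _ => abs_nonneg _) (Finset.mem_univ i))

lemma abs_conv_le {U : Fin n → E n → ℝ} {x : E n} {b : ℝ} (hb : ∀ i, |U i x| ≤ b) (j : Fin n) :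
    |conv U j x| ≤ b * gradL1 U x := by
  refine (Finset.abs_sum_le_sum_abs _ _).trans ?_
  rw [gradL1, Finset.mul_sum]
  refine Finset.sum_le_sum fun i _ => ?_
  rw [abs_mul]
  have hb0 : 0 ≤ b := (abs_nonneg _).trans (hb i)
  exact mul_le_mul (hb i) (Finset.single_le_sum (f := fun j => |pd i (U j) x|)
    (fun _ _ => abs_nonneg _) (Finset.mem_univ j)) (abs_nonneg _) hb0

lemma abs_src_le (U : Fin n → E n → ℝ) (x : E n) : |src U x| ≤ gradL1 U x ^ 2 := by
  refine (Finset.abs_sum_le_sum_abs _ _).trans ?_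
  rw [sq]
  nth_rw 1 [gradL1]
  rw [Finset.sum_mul]
  refine Finset.sum_le_sum fun i _ => ?_
  refine (Finset.abs_sum_le_sum_abs _ _).trans ?_
  rw [Finset.sum_mul]
  refine Finset.sum_le_sum fun j _ => ?_
  rw [abs_mul]
  exact mul_le_mul_of_nonneg_left (abs_pd_le_gradL1 U x j i) (abs_nonneg _)

lemma bound_of_scales {A m : ℝ} (hA : 1 ≤ A)
    (h : ∀ κ, 0 < κ → κ ≤ 1 / 8 → m ≤ A * (1 / κ + κ * m + κ ^ 2 * m ^ 2)) :
    m ≤ 16 * A + 4 * A ^ 2 + 8 * A ^ 3 := by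
  by_contra hc
  push Not at hc
  have hm : 16 * A < m := by nlinarith [pow_pos (by linarith : 0 < A) 2, pow_pos (by linarith : 0 < A) 3]
  have hm0 : 0 < m := by linarith
  have h1 := h (2 * A / m) (by positivity) (by rw [div_le_div_iff₀ hm0 (by norm_num)]; linarith)
  have e : A * (1 / (2 * A / m) + 2 * A / m * m + (2 * A / m) ^ 2 * m ^ 2) =
      m / 2 + 2 * A ^ 2 + 4 * A ^ 3 := by field_simp; ring
  rw [e] at h1
  nlinarith

lemma grad_scale_eq {ν a p C κ m d : ℝ} (hκ : 0 < κ) (hd : 0 < d) :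
    d ^ 2 * (ν * (ν * (a * (C / d / (κ * d) + (C / d * (4 * m / d ^ 2) +
      p * (C / d / (κ * d) ^ 2 + C / d * (4 * m / d ^ 2) + (4 * m / d ^ 2) ^ 2 * (κ * d))) *
      (κ * d))))) = ν * (ν * a) *
      ((C / κ + 4 * C * (κ * m)) + p * (C / κ + 4 * C * (κ * m) + 16 * (κ ^ 2 * m ^ 2))) := by
  field_simp
  ring

lemma grad_scale_le {A D C x y z : ℝ} (hD : 0 ≤ D) (hC : 0 ≤ C) (hx : 0 ≤ x) (hy : 0 ≤ y)
    (hz : 0 ≤ z) (hA : A = 1 + D * (16 + 4 * C)) :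
    D * (C * x + 4 * C * y + 16 * z) ≤ A * (x + y + z) := by
  have h1 : 0 ≤ D * (16 * x + 16 * y + 4 * C * z + 3 * C * x) := by positivity
  rw [hA]
  linarith

lemma grad_sum_le {ν a p x z : ℝ} (hν : 0 ≤ ν) (ha : 0 ≤ a) (hz : 0 ≤ z) :
    ν * (ν * a) * (x + p * (x + z)) ≤ ν * (ν * (a * (1 + p))) * (x + z) := by
  have : 0 ≤ ν * (ν * a) * z := by positivity
  linarith

set_option maxHeartbeats 1000000 in
theorem Sol.exists_grad_bound (hn : 1 ≤ n) {C : ℝ} {U : Fin n → E n → ℝ} {P : E n → ℝ}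
    (h : Sol C U P) : ∃ K, 0 < K ∧ ∀ x, x ≠ 0 → gradL1 U x ≤ K / ‖x‖ ^ 2 := by
  obtain ⟨η, β, hm⟩ := exists_moll hn
  have HP' := fun j => WeakSol.pd_P_le hm j
  choose cP hcP HP using HP'
  have HU' := fun j => WeakSol.pd_U_le hm j
  choose cU hcU HU using HU'
  set p := ∑ j, cP j with hp
  have hp0 : 0 ≤ p := Finset.sum_nonneg fun i _ => hcP i
  have hpj : ∀ j, cP j ≤ p := fun j => Finset.single_le_sum (fun i _ => hcP i) (Finset.mem_univ j)
  set a := ∑ j, cU j with ha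
  have ha0 : 0 ≤ a := Finset.sum_nonneg fun i _ => hcU i
  have haj : ∀ j, cU j ≤ a := fun j => Finset.single_le_sum (fun i _ => hcU i) (Finset.mem_univ j)
  have hC := h.pos
  set D := (n:ℝ) * (n * (a * (1 + p))) with hD
  have hD0 : 0 ≤ D := by positivity
  set A := 1 + D * (16 + 4 * C) with hA
  have hA1 : 1 ≤ A := by have : 0 ≤ D * (16 + 4 * C) := by positivity
                         linarith
  refine ⟨4 * (16 * A + 4 * A ^ 2 + 8 * A ^ 3), by positivity, fun x0 hx0 => ?_⟩
  have hΩ : IsOpen ({0}ᶜ : Set (E n)) := isOpen_compl_singleton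
  set r := ‖x0‖ / 2 with hr
  have hr0 : 0 < r := by have := norm_pos_iff.2 hx0; positivity
  have hball : ∀ y ∈ Metric.closedBall x0 r, r ≤ ‖y‖ := by
    intro y hy
    have h1 : ‖x0‖ ≤ ‖y‖ + ‖y - x0‖ := by
      have := norm_sub_le y (y - x0)
      simpa using this
    rw [mem_closedBall_iff_norm] at hy
    linarith
  have hballΩ : Metric.closedBall x0 r ⊆ {0}ᶜ := fun y hy h0 => by
    have := hball y hy
    rw [mem_singleton_iff.1 h0, norm_zero] at this
    linarith
  have hcont : ContinuousOn (fun y => (r - ‖y - x0‖) ^ 2 * gradL1 U y) (Metric.closedBall x0 r) := by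
    refine ContinuousOn.mul (by fun_prop) (ContinuousOn.mono ?_ hballΩ)
    exact continuousOn_finsetSum _ fun i _ => continuousOn_finsetSum _ fun j _ =>
      (continuousOn_pd hΩ (h.regU j)).abs
  obtain ⟨xb, hxb, hmax⟩ := (isCompact_closedBall x0 r).exists_isMaxOn
    ⟨x0, Metric.mem_closedBall_self hr0.le⟩ hcont
  set d := r - ‖xb - x0‖ with hd
  set m := d ^ 2 * gradL1 U xb with hm'
  have hmax' : ∀ y ∈ Metric.closedBall x0 r, (r - ‖y - x0‖) ^ 2 * gradL1 U y ≤ m := fun y hy =>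
    hmax hy
  have hmx0 := hmax' x0 (Metric.mem_closedBall_self hr0.le)
  have hd0 : 0 ≤ d := by rw [mem_closedBall_iff_norm] at hxb; linarith
  have hdr : d ≤ r := by linarith [norm_nonneg (xb - x0)]
  suffices hmA : m ≤ 16 * A + 4 * A ^ 2 + 8 * A ^ 3 by
    rw [sub_self, norm_zero, sub_zero] at hmx0
    rw [le_div_iff₀ (by have := norm_pos_iff.2 hx0; positivity)]
    have : ‖x0‖ ^ 2 = 4 * r ^ 2 := by rw [hr]; ring
    rw [this]; nlinarith
  rcases hd0.eq_or_lt with hd0 | hd0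
  · have : m = 0 := by rw [hm', ← hd0]; ring
    rw [this]; positivity
  refine bound_of_scales hA1 fun κ hκ hκ8 => ?_
  have hm0 : 0 ≤ m := by have := gradL1_nonneg U xb; positivity
  set ρ := κ * d with hρ
  have hρ0 : 0 < ρ := by positivity
  have h4ρ : 4 * ρ ≤ d / 2 := by rw [hρ]; nlinarith
  set b := C / d with hb
  set N := 4 * m / d ^ 2 with hN
  have hN0 : 0 ≤ N := by positivity
  have hin : ∀ y, ‖y - xb‖ ≤ 4 * ρ → y ∈ Metric.closedBall x0 r ∧ gradL1 U y ≤ N ∧ ∀ i, |U i y| ≤ b := by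
    intro y hy
    have h1 : ‖y - x0‖ ≤ ‖y - xb‖ + ‖xb - x0‖ := norm_sub_le_norm_sub_add_norm_sub ..
    have hyb : y ∈ Metric.closedBall x0 r := by
      rw [mem_closedBall_iff_norm]; linarith
    refine ⟨hyb, ?_, fun i => ?_⟩
    · have h2 := hmax' y hyb
      have h3 : d / 2 ≤ r - ‖y - x0‖ := by linarith
      rw [hN, le_div_iff₀ (by positivity)]
      have h4 : (d / 2) ^ 2 * gradL1 U y ≤ (r - ‖y - x0‖) ^ 2 * gradL1 U y := by
        have := gradL1_nonneg U y
        gcongr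
      nlinarith
    · refine (h.bound i y (hballΩ hyb)).trans ?_
      rw [hb]
      have := hball y hyb
      gcongr
      linarith
  have htri : ∀ {z y : E n}, z ∈ Metric.closedBall xb (2 * ρ) → y ∈ Metric.closedBall z (2 * ρ) →
      ‖y - xb‖ ≤ 4 * ρ := by
    intro z y hz hy
    rw [mem_closedBall_iff_norm] at hz hy
    have : ‖y - xb‖ ≤ ‖y - z‖ + ‖z - xb‖ := norm_sub_le_norm_sub_add_norm_sub ..
    linarith
  have hself : xb ∈ Metric.closedBall xb (2 * ρ) := Metric.mem_closedBall_self (by positivity)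
  set q := p * (b / ρ ^ 2 + b * N + N ^ 2 * ρ) with hq
  have hPz : ∀ j, ∀ z ∈ Metric.closedBall xb (2 * ρ), |pd j P z| ≤ q := by
    intro j z hz
    have := (HP j h.toWeakSol hΩ hρ0 (x := z) (f := b * N) (g := N ^ 2)
      (fun y hy => hballΩ (hin y (htri hz hy)).1)
      (fun y hy => (abs_conv_le (hin y (htri hz hy)).2.2 j).trans (by
        gcongr; exact (hin y (htri hz hy)).2.1))
      (fun y hy => (abs_src_le U y).trans (by
        have := (hin y (htri hz hy)).2.1
        have := gradL1_nonneg U y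
        gcongr))).1 b (fun y hy => (hin y (htri hz hy)).2.2 j)
    refine this.trans ?_
    rw [hq]
    gcongr
    exact hpj j
  have hUx : ∀ k j, |pd k (U j) xb| ≤ a * (b / ρ + (b * N + q) * ρ) := by
    intro k j
    refine (HU k h.toWeakSol hΩ j hρ0 (x := xb) (f := b * N + q) (b := b)
      (fun y hy => hballΩ (hin y (htri hself hy)).1)
      (fun y hy => (abs_add_le _ _).trans (add_le_add ((abs_conv_le (hin y (htri hself hy)).2.2 j).trans (by
        gcongr; exact (hin y (htri hself hy)).2.1)) (hPz j y hy)))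
      (fun y hy => (hin y (htri hself hy)).2.2 j)).trans ?_
    gcongr
    exact haj k
  have hNx : gradL1 U xb ≤ (n:ℝ) * (n * (a * (b / ρ + (b * N + q) * ρ))) := by
    refine (Finset.sum_le_sum fun k _ => Finset.sum_le_sum fun j _ => hUx k j).trans_eq ?_
    simp
  have e1 : d ^ 2 * ((n:ℝ) * (n * (a * (b / ρ + (b * N + q) * ρ)))) ≤
      D * (C / κ + 4 * C * (κ * m) + 16 * (κ ^ 2 * m ^ 2)) := by
    rw [hq, hb, hN, hρ, grad_scale_eq hκ hd0, hD]
    exact grad_sum_le (Nat.cast_nonneg n) ha0 (by positivity)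
  have e3 : m ≤ D * (C / κ + 4 * C * (κ * m) + 16 * (κ ^ 2 * m ^ 2)) := by
    refine le_trans ?_ e1
    rw [hm']; gcongr
  refine e3.trans ?_
  have e4 : C / κ = C * (1 / κ) := by ring
  rw [e4]
  exact grad_scale_le hD0 hC.le (by positivity) (by positivity) (by positivity) hA

theorem Sol.exists_bounds (hn : 1 ≤ n) {C : ℝ} {U : Fin n → E n → ℝ} {P : E n → ℝ}
    (h : Sol C U P) : ∃ K, 0 < K ∧ ∀ x, x ≠ 0 → (∀ i j, |pd i (U j) x| ≤ K / ‖x‖ ^ 2) ∧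
      ∀ j, |pd j P x| ≤ K / ‖x‖ ^ 3 := by
  obtain ⟨K, hK, H⟩ := h.exists_grad_bound hn
  obtain ⟨η, β, hm⟩ := exists_moll hn
  have HP' := fun j => WeakSol.pd_P_le hm j
  choose cP hcP HP using HP'
  set p := ∑ j, cP j with hp
  have hp0 : 0 ≤ p := Finset.sum_nonneg fun i _ => hcP i
  have hpj : ∀ j, cP j ≤ p := fun j => Finset.single_le_sum (fun i _ => hcP i) (Finset.mem_univ j)
  have hC := h.pos
  refine ⟨K + p * (32 * C + 8 * C * K + 4 * K ^ 2), by positivity, fun x hx => ?_⟩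
  have hx0 := norm_pos_iff.2 hx
  set r := ‖x‖ with hr
  have hin : ∀ y ∈ Metric.closedBall x (2 * (r / 4)), r / 2 ≤ ‖y‖ := by
    intro y hy
    have h1 : ‖x‖ ≤ ‖y‖ + ‖y - x‖ := by
      have := norm_sub_le y (y - x)
      simpa using this
    rw [mem_closedBall_iff_norm] at hy
    linarith
  have hne : ∀ y ∈ Metric.closedBall x (2 * (r / 4)), y ≠ 0 := fun y hy h0 => by
    have := hin y hy
    rw [h0, norm_zero] at this
    linarith
  have hU : ∀ y ∈ Metric.closedBall x (2 * (r / 4)), ∀ i, |U i y| ≤ C / (r / 2) := fun y hy i => by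
    refine (h.bound i y (hne y hy)).trans ?_
    have := hin y hy
    gcongr
  have hG : ∀ y ∈ Metric.closedBall x (2 * (r / 4)), gradL1 U y ≤ K / (r / 2) ^ 2 := fun y hy => by
    refine (H y (hne y hy)).trans ?_
    have := hin y hy
    gcongr
  have hA : 0 ≤ p * (32 * C + 8 * C * K + 4 * K ^ 2) := by positivity
  constructor
  · intro i j
    refine (abs_pd_le_gradL1 U x i j).trans ((H x hx).trans ?_)
    gcongr; linarith
  · intro j
    have := (HP j h.toWeakSol isOpen_compl_singleton (x := x) (ρ := r / 4)
      (f := C / (r / 2) * (K / (r / 2) ^ 2)) (g := (K / (r / 2) ^ 2) ^ 2)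
      (by positivity) (fun y hy => hne y hy)
      (fun y hy => (abs_conv_le (hU y hy) j).trans (by gcongr; exact hG y hy))
      (fun y hy => (abs_src_le U y).trans (by
        have := hG y hy
        have := gradL1_nonneg U y
        gcongr))).1 _ (fun y hy => hU y hy j)
    refine this.trans ?_
    have e : C / (r / 2) / (r / 4) ^ 2 + C / (r / 2) * (K / (r / 2) ^ 2) +
      (K / (r / 2) ^ 2) ^ 2 * (r / 4) = (32 * C + 8 * C * K + 4 * K ^ 2) / r ^ 3 := by
      field_simp; ring
    rw [e, mul_div_assoc']
    gcongr
    have := hpj j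
    have : cP j * (32 * C + 8 * C * K + 4 * K ^ 2) ≤ p * (32 * C + 8 * C * K + 4 * K ^ 2) := by
      gcongr
    linarith

lemma fderiv_eq_sum (f : E n → ℝ) (x v : E n) : fderiv ℝ f x v = ∑ i, v i * pd i f x := by
  have h := congrArg (fderiv ℝ f x) ((EuclideanSpace.basisFun (Fin n) ℝ).sum_repr v)
  rw [← h]
  simp [pd]

lemma norm_fderiv_le {f : E n → ℝ} {x : E n} {M : ℝ} (hM : 0 ≤ M) (h : ∀ i, |pd i f x| ≤ M) :
    ‖fderiv ℝ f x‖ ≤ n * M := by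
  refine ContinuousLinearMap.opNorm_le_bound _ (by positivity) fun v => ?_
  rw [fderiv_eq_sum, Real.norm_eq_abs]
  refine (Finset.abs_sum_le_sum_abs _ _).trans ?_
  refine (Finset.sum_le_sum (g := fun _ => M * ‖v‖) fun i _ => ?_).trans_eq ?_
  · rw [abs_mul, mul_comm]
    exact mul_le_mul (h i) (abs_coord_le v i) (abs_nonneg _) hM
  · simp; ring

/-- A function in the punctured space with gradient `O(|x|⁻³)`. -/
structure CubicGrad (M : ℝ) (P : E n → ℝ) : Prop where
  diff : ∀ x, x ≠ 0 → DifferentiableAt ℝ P x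
  nonneg : 0 ≤ M
  le : ∀ x, x ≠ 0 → ‖fderiv ℝ P x‖ ≤ M / ‖x‖ ^ 3

lemma CubicGrad.neg {M : ℝ} {P : E n → ℝ} (h : CubicGrad M P) : CubicGrad M (fun x => - P x) where
  diff x hx := (h.diff x hx).neg
  nonneg := h.nonneg
  le x hx := by
    have := h.le x hx
    rwa [fderiv_fun_neg, norm_neg]

lemma CubicGrad.radial_le {M : ℝ} {P : E n → ℝ} (h : CubicGrad M P) {x : E n} (hx : x ≠ 0) {t : ℝ}
    (ht : 1 ≤ t) : P (t • x) - P x ≤ M / ‖x‖ ^ 2 := by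
  have hx0 := norm_pos_iff.2 hx
  have hd : ∀ s ∈ Ioi (0:ℝ), HasDerivAt (fun s : ℝ => P (s • x) + M / ‖x‖ ^ 2 / s)
      (fderiv ℝ P (s • x) x + -(M / ‖x‖ ^ 2 / s ^ 2)) s := by
    intro s hs
    have h1 : HasDerivAt (fun s : ℝ => s • x) x s := by
      simpa using (hasDerivAt_id s).smul_const x
    have h2 := (h.diff (s • x) (smul_ne_zero (ne_of_gt hs) hx)).hasFDerivAt.comp_hasDerivAt s h1
    have h3 := (hasDerivAt_inv (ne_of_gt hs)).const_mul (M / ‖x‖ ^ 2)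
    refine (h2.add (h3.congr_deriv ?_)).congr_of_eventuallyEq (Eventually.of_forall fun s => ?_)
    · rw [div_eq_mul_inv (M / ‖x‖ ^ 2)]; ring
    · simp [div_eq_mul_inv]
  have hanti : AntitoneOn (fun s : ℝ => P (s • x) + M / ‖x‖ ^ 2 / s) (Ici 1) := by
    refine antitoneOn_of_deriv_nonpos (convex_Ici 1) (fun s hs => ?_) (fun s hs => ?_) fun s hs => ?_
    · exact (hd s (mem_Ioi.2 (lt_of_lt_of_le one_pos (mem_Ici.1 hs)))).continuousAt.continuousWithinAt
    · rw [interior_Ici] at hs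
      exact (hd s (mem_Ioi.2 (one_pos.trans (mem_Ioi.1 hs)))).differentiableAt.differentiableWithinAt
    · rw [interior_Ici] at hs
      have hs1 : (1:ℝ) < s := hs
      have hs0 : 0 < s := one_pos.trans hs
      rw [(hd s hs0).deriv]
      have h1 := (le_abs_self _).trans ((fderiv ℝ P (s • x)).le_opNorm x)
      have h2 := h.le (s • x) (smul_ne_zero hs0.ne' hx)
      rw [norm_smul, Real.norm_eq_abs, abs_of_pos hs0] at h2
      have h3 : M / (s * ‖x‖) ^ 3 * ‖x‖ ≤ M / ‖x‖ ^ 2 / s ^ 2 := by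
        rw [show M / (s * ‖x‖) ^ 3 * ‖x‖ = M / ‖x‖ ^ 2 / s ^ 3 by field_simp]
        have := h.nonneg
        gcongr
        · linarith
        · norm_num
      have h4 := h1.trans ((mul_le_mul_of_nonneg_right h2 hx0.le).trans h3)
      linarith
  have := hanti (mem_Ici.2 le_rfl) (mem_Ici.2 ht) ht
  simp only [one_smul, div_one] at this
  have h5 : 0 ≤ M / ‖x‖ ^ 2 / t := by have := h.nonneg; positivity
  linarith

lemma CubicGrad.segment_le {M : ℝ} {P : E n → ℝ} (h : CubicGrad M P) {x y : E n} {r : ℝ}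
    (hr : 0 < r) (hx : ‖x‖ = r) (hy : ‖y‖ = r) (hxy : 0 ≤ inner ℝ x y) :
    |P x - P y| ≤ 16 * (M / r ^ 2) := by
  have hz : ∀ z ∈ segment ℝ x y, r / 2 ≤ ‖z‖ := by
    rintro z ⟨a, b, ha, hb, hab, rfl⟩
    have h1 : (r / 2) ^ 2 ≤ ‖a • x + b • y‖ ^ 2 := by
      rw [norm_add_sq_real, norm_smul, norm_smul, hx, hy, inner_smul_left, inner_smul_right,
        Real.norm_eq_abs, Real.norm_eq_abs, mul_pow, mul_pow, sq_abs, sq_abs]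
      simp only [conj_trivial]
      have : 0 ≤ a * (b * inner ℝ x y) := by positivity
      have hb' : b = 1 - a := by linarith
      have h3 : 0 ≤ r ^ 2 * (a - 1 / 2) ^ 2 := by positivity
      subst hb'
      nlinarith
    exact le_of_sq_le_sq h1 (norm_nonneg _)
  have hne : ∀ z ∈ segment ℝ x y, z ≠ 0 := fun z hz' h0 => by
    have := hz z hz'
    rw [h0, norm_zero] at this
    linarith
  have := Convex.norm_image_sub_le_of_norm_fderiv_le (𝕜 := ℝ) (f := P) (C := M / (r / 2) ^ 3)
    (fun z hz' => h.diff z (hne z hz')) (fun z hz' => (h.le z (hne z hz')).trans (by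
      have := hz z hz'
      have := h.nonneg
      gcongr)) (convex_segment x y) (right_mem_segment ℝ x y) (left_mem_segment ℝ x y)
  rw [Real.norm_eq_abs] at this
  refine this.trans ?_
  have h2 : ‖x - y‖ ≤ r + r := (norm_sub_le x y).trans (by rw [hx, hy])
  have := h.nonneg
  calc M / (r / 2) ^ 3 * ‖x - y‖ ≤ M / (r / 2) ^ 3 * (r + r) := by gcongr
    _ = 16 * (M / r ^ 2) := by field_simp; ring

lemma exists_orthogonal (hn : 2 ≤ n) (x : E n) {r : ℝ} (hr : 0 < r) :
    ∃ f : E n, ‖f‖ = r ∧ inner ℝ x f = 0 := by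
  have h1 : 0 < Module.finrank ℝ (ℝ ∙ x)ᗮ := by
    have h2 := Submodule.finrank_add_finrank_orthogonal (ℝ ∙ x)
    have h3 : Module.finrank ℝ (ℝ ∙ x) ≤ 1 := (finrank_span_le_card ({x} : Set (E n))).trans (by simp)
    rw [finrank_euclideanSpace_fin] at h2
    omega
  have := Module.nontrivial_of_finrank_pos h1
  obtain ⟨⟨v, hv⟩, hv0⟩ := exists_ne (0 : (ℝ ∙ x)ᗮ)
  have hv1 : v ≠ 0 := fun h => hv0 (by simpa using h)
  have hv2 := norm_pos_iff.2 hv1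
  refine ⟨(r / ‖v‖) • v, ?_, ?_⟩
  · rw [norm_smul, Real.norm_eq_abs, abs_of_pos (by positivity)]
    field_simp
  · rw [inner_smul_right, Submodule.mem_orthogonal_singleton_iff_inner_right.1 hv, mul_zero]

lemma CubicGrad.sphere_le (hn : 2 ≤ n) {M : ℝ} {P : E n → ℝ} (h : CubicGrad M P) {x y : E n} {r : ℝ}
    (hr : 0 < r) (hx : ‖x‖ = r) (hy : ‖y‖ = r) : |P x - P y| ≤ 32 * (M / r ^ 2) := by
  obtain ⟨f, hf, hxf⟩ := exists_orthogonal hn x hr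
  have key : ∀ g : E n, ‖g‖ = r → inner ℝ x g = 0 → 0 ≤ inner ℝ g y →
      |P x - P y| ≤ 32 * (M / r ^ 2) := by
    intro g hg hxg hgy
    have h1 := h.segment_le hr hx hg hxg.ge
    have h2 := h.segment_le hr hg hy hgy
    have h3 := abs_sub_le (P x) (P g) (P y)
    linarith
  rcases le_total 0 (inner ℝ f y : ℝ) with h1 | h1
  · exact key f hf hxf h1
  · exact key (-f) (by rwa [norm_neg]) (by rw [inner_neg_right, hxf, neg_zero])
      (by rw [inner_neg_left]; linarith)

lemma CubicGrad.dist_le (hn : 2 ≤ n) {M : ℝ} {P : E n → ℝ} (h : CubicGrad M P) {x y : E n}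
    (hx : x ≠ 0) (hxy : ‖x‖ ≤ ‖y‖) : |P x - P y| ≤ 33 * M / ‖x‖ ^ 2 := by
  have hx0 := norm_pos_iff.2 hx
  set t := ‖y‖ / ‖x‖ with ht
  have ht1 : 1 ≤ t := by rw [ht, one_le_div hx0]; exact hxy
  have ht0 : 0 < t := by linarith
  have hy : y = t • (t⁻¹ • y) := by rw [smul_smul, mul_inv_cancel₀ ht0.ne', one_smul]
  have hny : ‖t⁻¹ • y‖ = ‖x‖ := by
    rw [norm_smul, norm_inv, Real.norm_eq_abs, abs_of_pos ht0, ht]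
    have : ‖y‖ ≠ 0 := by linarith
    field_simp
  have hy0 : t⁻¹ • y ≠ 0 := by rw [← norm_pos_iff, hny]; exact hx0
  have h1 := h.radial_le hy0 ht1
  have h2 := h.neg.radial_le hy0 ht1
  have h3 := abs_le.1 (h.sphere_le hn hx0 rfl hny)
  rw [← hy, hny] at h1 h2
  have e : 33 * M / ‖x‖ ^ 2 = 33 * (M / ‖x‖ ^ 2) := by ring
  rw [e, abs_le]
  constructor <;> linarith [h3.1, h3.2]

lemma CubicGrad.exists_limit (hn : 2 ≤ n) {M : ℝ} {P : E n → ℝ} (h : CubicGrad M P) :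
    ∃ c, ∀ x, x ≠ 0 → |P x - c| ≤ 33 * M / ‖x‖ ^ 2 := by
  have : Nontrivial (E n) := Module.nontrivial_of_finrank_pos (R := ℝ) (by
    rw [finrank_euclideanSpace_fin]; omega)
  obtain ⟨e, he⟩ := exists_norm_eq (E n) (zero_le_one)
  have hk : ∀ k : ℕ, ‖((k:ℝ) + 1) • e‖ = k + 1 := fun k => by
    rw [norm_smul, he, mul_one, Real.norm_eq_abs, abs_of_pos (by positivity)]
  have hk0 : ∀ k : ℕ, ((k:ℝ) + 1) • e ≠ 0 := fun k => by
    rw [← norm_pos_iff, hk]; positivity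
  have hc : CauchySeq fun k : ℕ => P (((k:ℝ) + 1) • e) := by
    refine cauchySeq_of_le_tendsto_0' (fun k : ℕ => 33 * M / ((k:ℝ) + 1) ^ 2) ?_ ?_
    · intro k m hkm
      have h1 := h.dist_le hn (x := ((k:ℝ) + 1) • e) (y := ((m:ℝ) + 1) • e) (hk0 k)
      rw [Real.dist_eq]
      rw [hk, hk] at h1
      refine h1 ?_
      have : (k:ℝ) ≤ m := by exact_mod_cast hkm
      linarith
    · refine Tendsto.const_div_atTop ?_ _
      refine (tendsto_pow_atTop two_ne_zero).comp ?_
      exact tendsto_atTop_add_const_right _ _ tendsto_natCast_atTop_atTop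
  obtain ⟨c, hc⟩ := cauchySeq_tendsto_of_complete hc
  refine ⟨c, fun x hx => ?_⟩
  refine le_of_tendsto (((tendsto_const_nhds (x := P x)).sub hc).abs) ?_
  obtain ⟨N, hN⟩ := exists_nat_ge ‖x‖
  filter_upwards [eventually_ge_atTop N] with k hkN
  refine h.dist_le hn hx ?_
  rw [hk]
  have : (N:ℝ) ≤ k := by exact_mod_cast hkN
  linarith

lemma pd_sub_const (f : E n → ℝ) (c : ℝ) (i : Fin n) : pd i (fun x => f x - c) = pd i f := by
  funext x
  simp [pd, fderiv_sub_const]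

/-- Solutions whose pressure vanishes at infinity, with all scale invariant bounds. -/
structure Sol' (K : ℝ) (U : Fin n → E n → ℝ) (P : E n → ℝ) : Prop extends WeakSol {0}ᶜ U P where
  pos : 0 < K
  boundU : ∀ j x, x ≠ 0 → |U j x| ≤ K / ‖x‖
  boundDU : ∀ i j x, x ≠ 0 → |pd i (U j) x| ≤ K / ‖x‖ ^ 2
  boundP : ∀ x, x ≠ 0 → |P x| ≤ K / ‖x‖ ^ 2
  boundDP : ∀ j x, x ≠ 0 → |pd j P x| ≤ K / ‖x‖ ^ 3

lemma Sol.exists_sol' (hn : 2 ≤ n) {C : ℝ} {U : Fin n → E n → ℝ} {P : E n → ℝ} (h : Sol C U P) :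
    ∃ K c, Sol' K U (fun x => P x - c) := by
  obtain ⟨K, hK, H⟩ := h.exists_bounds (by omega)
  have hg : CubicGrad (n * K) P := by
    refine ⟨fun x hx => diffAt isOpen_compl_singleton h.regP hx, by positivity, fun x hx => ?_⟩
    have hx0 := norm_pos_iff.2 hx
    refine (norm_fderiv_le (by positivity) (H x hx).2).trans_eq ?_
    ring
  obtain ⟨c, hc⟩ := hg.exists_limit hn
  have hC := h.pos
  have h33 : 0 ≤ 33 * (n * K) := by positivity
  refine ⟨C + K + 33 * (n * K), c, ?_⟩
  refine { regU := h.regU, regP := h.regP.sub contDiffOn_const, div := h.div, mom := ?_, mom' := ?_,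
           pres := ?_, pos := by positivity, boundU := fun j x hx => ?_, boundDU := fun i j x hx => ?_,
           boundP := fun x hx => ?_, boundDP := fun j x hx => ?_ }
  · simpa only [pd_sub_const] using h.mom
  · simpa only [pd_sub_const] using h.mom'
  · simpa only [pd_sub_const] using h.pres
  · refine (h.bound j x hx).trans ?_
    gcongr; linarith
  · refine ((H x hx).1 i j).trans ?_
    gcongr; linarith
  · refine (hc x hx).trans ?_
    gcongr; linarith
  · rw [pd_sub_const]
    refine ((H x hx).2 j).trans ?_
    gcongr; linarith

/-- The squared speed. -/
noncomputable def usq (U : Fin n → E n → ℝ) (x : E n) : ℝ := ∑ j, U j x ^ 2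

/-- The squared norm of the velocity gradient. -/
noncomputable def gsq (U : Fin n → E n → ℝ) (x : E n) : ℝ := ∑ j, ∑ i, pd i (U j) x ^ 2

/-- The squared norm of the vorticity. -/
noncomputable def wsq (U : Fin n → E n → ℝ) (x : E n) : ℝ := ∑ j, ∑ i, vort U i j x ^ 2

/-- The total head pressure. -/
noncomputable def hd (U : Fin n → E n → ℝ) (P : E n → ℝ) (x : E n) : ℝ := 1 / 2 * usq U x + P x

/-- The directional derivative along `U`. -/
noncomputable def adv (U : Fin n → E n → ℝ) (f : E n → ℝ) (x : E n) : ℝ := ∑ i, U i x * pd i f x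

section Identities
variable {Ω : Set (E n)} {U : Fin n → E n → ℝ} {P : E n → ℝ}

lemma usq_nonneg (U : Fin n → E n → ℝ) (x : E n) : 0 ≤ usq U x :=
  Finset.sum_nonneg fun _ _ => sq_nonneg _

lemma gsq_nonneg (U : Fin n → E n → ℝ) (x : E n) : 0 ≤ gsq U x :=
  Finset.sum_nonneg fun _ _ => Finset.sum_nonneg fun _ _ => sq_nonneg _

lemma wsq_nonneg (U : Fin n → E n → ℝ) (x : E n) : 0 ≤ wsq U x :=
  Finset.sum_nonneg fun _ _ => Finset.sum_nonneg fun _ _ => sq_nonneg _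

lemma gsq_eq (U : Fin n → E n → ℝ) (x : E n) : gsq U x = 1 / 2 * wsq U x + src U x := by
  have h1 : wsq U x = ∑ j, ∑ i, (pd i (U j) x ^ 2 + pd j (U i) x ^ 2 -
      2 * (pd i (U j) x * pd j (U i) x)) :=
    Finset.sum_congr rfl fun j _ => Finset.sum_congr rfl fun i _ => by rw [vort]; ring
  have h2 : ∑ j, ∑ i, pd j (U i) x ^ 2 = ∑ j, ∑ i, pd i (U j) x ^ 2 := Finset.sum_comm
  have h3 : ∑ j, ∑ i, pd i (U j) x * pd j (U i) x = src U x := Finset.sum_comm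
  simp only [Finset.sum_sub_distrib, Finset.sum_add_distrib, ← Finset.mul_sum, h2, h3] at h1
  rw [h1, gsq]
  ring

lemma contDiffOn_usq (hU : ∀ j, ContDiffOn ℝ 1 (U j) Ω) : ContDiffOn ℝ 1 (usq U) Ω :=
  ContDiffOn.sum fun j _ => (hU j).pow 2

lemma contDiffOn_hd (hU : ∀ j, ContDiffOn ℝ 1 (U j) Ω) (hP : ContDiffOn ℝ 1 P Ω) :
    ContDiffOn ℝ 1 (hd U P) Ω := (contDiffOn_const.mul (contDiffOn_usq hU)).add hP

lemma continuousOn_gsq (hΩ : IsOpen Ω) (hU : ∀ j, ContDiffOn ℝ 1 (U j) Ω) :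
    ContinuousOn (gsq U) Ω :=
  continuousOn_finsetSum _ fun _ _ => continuousOn_finsetSum _ fun _ _ =>
    (continuousOn_pd hΩ (hU _)).pow 2

lemma continuousOn_wsq (hΩ : IsOpen Ω) (hU : ∀ j, ContDiffOn ℝ 1 (U j) Ω) :
    ContinuousOn (wsq U) Ω :=
  continuousOn_finsetSum _ fun _ _ => continuousOn_finsetSum _ fun _ _ =>
    (continuousOn_vort hΩ hU _ _).pow 2

lemma continuousOn_adv (hΩ : IsOpen Ω) (hU : ∀ j, ContDiffOn ℝ 1 (U j) Ω) {f : E n → ℝ}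
    (hf : ContDiffOn ℝ 1 f Ω) : ContinuousOn (adv U f) Ω :=
  continuousOn_finsetSum _ fun _ _ => (hU _).continuousOn.mul (continuousOn_pd hΩ hf)

lemma Test.adv_cc (hΩ : IsOpen Ω) (hU : ∀ j, ContDiffOn ℝ 1 (U j) Ω) {φ : E n → ℝ}
    (hφ : Test Ω φ) : CC Ω (adv U φ) :=
  CC.sum fun i _ => (hφ.pd_cc i).mul_left hΩ (hU i).continuousOn

lemma pd_usq (hΩ : IsOpen Ω) (hU : ∀ j, ContDiffOn ℝ 1 (U j) Ω) {x : E n} (hx : x ∈ Ω) (i : Fin n) :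
    pd i (usq U) x = 2 * ∑ j, U j x * pd i (U j) x := by
  have h : usq U = fun x => ∑ j, U j x * U j x := by
    funext x; exact Finset.sum_congr rfl fun j _ => sq _
  have hd := fun j => diffAt hΩ (hU j) hx
  rw [h, pd_sum fun j _ => (hd j).fun_mul (hd j), Finset.mul_sum]
  refine Finset.sum_congr rfl fun j _ => ?_
  rw [pd_mul (hd j) (hd j)]
  ring

lemma pd_hd (hΩ : IsOpen Ω) (hU : ∀ j, ContDiffOn ℝ 1 (U j) Ω) (hP : ContDiffOn ℝ 1 P Ω) {x : E n}
    (hx : x ∈ Ω) (i : Fin n) :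
    pd i (hd U P) x = ∑ j, U j x * pd i (U j) x + pd i P x := by
  have h1 := diffAt hΩ (contDiffOn_usq hU) hx
  rw [show hd U P = fun x => 1 / 2 * usq U x + P x from rfl,
    pd_add (h1.const_mul _) (diffAt hΩ hP hx), pd_const_mul _ h1, pd_usq hΩ hU hx]
  ring

lemma WeakSol.transport (h : WeakSol Ω U P) (hΩ : IsOpen Ω) {g φ : E n → ℝ}
    (hg : ContDiffOn ℝ 1 g Ω) (hφ : Test Ω φ) :
    ∫ x in Ω, adv U g x * φ x = - ∫ x in Ω, g x * adv U φ x := by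
  have h0 : ∫ x in Ω, (adv U g x * φ x + g x * adv U φ x) = 0 := by
    refine integral_div_zero hΩ (V := fun i x => U i x * (g x * φ x))
      (fun i => (hφ.mul_left hΩ hg).mul_left hΩ (h.regU i)) fun x hx => ?_
    have e : ∀ i, pd i (fun x => U i x * (g x * φ x)) x = pd i (U i) x * (g x * φ x) +
        (U i x * pd i g x * φ x + g x * (U i x * pd i φ x)) := fun i => by
      rw [pd_mul (diffAt hΩ (h.regU i) hx) ((diffAt hΩ hg hx).fun_mul (hφ.diff x)),
        pd_mul (diffAt hΩ hg hx) (hφ.diff x)]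
      ring
    simp only [e, Finset.sum_add_distrib, ← Finset.sum_mul, ← Finset.mul_sum, h.div x hx, adv]
    ring
  rw [integral_add (hφ.cc.mul_left hΩ (continuousOn_adv hΩ h.regU hg)).integrableOn
    ((hφ.adv_cc hΩ h.regU).mul_left hΩ hg.continuousOn).integrableOn] at h0
  linarith

lemma adv_hd (hΩ : IsOpen Ω) (hU : ∀ j, ContDiffOn ℝ 1 (U j) Ω) (hP : ContDiffOn ℝ 1 P Ω) {x : E n}
    (hx : x ∈ Ω) : adv U (hd U P) x = ∑ j, (conv U j x + pd j P x) * U j x := by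
  have h1 : ∑ j, conv U j x * U j x = ∑ i, U i x * ∑ j, U j x * pd i (U j) x := by
    simp only [conv, Finset.sum_mul, Finset.mul_sum]
    rw [Finset.sum_comm]
    exact Finset.sum_congr rfl fun i _ => Finset.sum_congr rfl fun j _ => by ring
  simp only [adv, pd_hd hΩ hU hP hx, mul_add, add_mul, Finset.sum_add_distrib, h1]
  congr 1
  exact Finset.sum_congr rfl fun i _ => mul_comm _ _

lemma WeakSol.tested (h : WeakSol Ω U P) (hΩ : IsOpen Ω) {φ : E n → ℝ} (hφ : Test Ω φ) :
    ∫ x in Ω, ∑ i, (1 / 2 * pd i (usq U) x) * pd i φ x =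
      - ∫ x in Ω, (gsq U x + adv U (hd U P) x) * φ x := by
  have ht : ∀ j, Test Ω (fun x => U j x * φ x) := fun j => hφ.mul_left hΩ (h.regU j)
  have c0 : ∀ j, CC Ω (fun x => (conv U j x + pd j P x) * (U j x * φ x)) := fun j =>
    (ht j).cc.mul_left hΩ ((continuousOn_conv hΩ h.regU j).add (continuousOn_pd hΩ h.regP))
  have h1 := Finset.sum_congr (rfl : (Finset.univ : Finset (Fin n)) = _) fun j _ => h.mom _ (ht j) j
  rw [Finset.sum_neg_distrib, ← integral_finsetSum _ fun j _ => (CC.sum fun i _ =>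
    ((ht j).pd_cc i).mul_left hΩ (continuousOn_pd hΩ (h.regU j))).integrableOn,
    ← integral_finsetSum _ fun j _ => (c0 j).integrableOn] at h1
  have e1 : ∀ x ∈ Ω, ∑ j, ∑ i, pd i (U j) x * pd i (fun x => U j x * φ x) x =
      gsq U x * φ x + ∑ i, (1 / 2 * pd i (usq U) x) * pd i φ x := by
    intro x hx
    have : ∀ i, (1 / 2 * pd i (usq U) x) * pd i φ x = ∑ j, U j x * pd i (U j) x * pd i φ x :=
      fun i => by rw [pd_usq hΩ h.regU hx, ← Finset.sum_mul]; ring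
    simp only [this]
    rw [Finset.sum_comm (s := (Finset.univ : Finset (Fin n)))
      (f := fun i j => U j x * pd i (U j) x * pd i φ x), gsq, Finset.sum_mul,
      ← Finset.sum_add_distrib]
    refine Finset.sum_congr rfl fun j _ => ?_
    rw [Finset.sum_mul, ← Finset.sum_add_distrib]
    refine Finset.sum_congr rfl fun i _ => ?_
    rw [pd_mul (diffAt hΩ (h.regU j) hx) (hφ.diff x)]
    ring
  have e2 : ∀ x ∈ Ω, ∑ j, (conv U j x + pd j P x) * (U j x * φ x) = adv U (hd U P) x * φ x := by
    intro x hx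
    rw [adv_hd hΩ h.regU h.regP hx, Finset.sum_mul]
    exact Finset.sum_congr rfl fun j _ => by ring
  rw [setIntegral_congr_fun hΩ.measurableSet e1, setIntegral_congr_fun hΩ.measurableSet e2] at h1
  have c1 := hφ.cc.mul_left hΩ (continuousOn_gsq hΩ h.regU)
  have c2 := hφ.cc.mul_left hΩ (continuousOn_adv hΩ h.regU (contDiffOn_hd h.regU h.regP))
  have c3 : CC Ω (fun x => ∑ i, (1 / 2 * pd i (usq U) x) * pd i φ x) := CC.sum fun i _ =>
    (hφ.pd_cc i).mul_left hΩ (continuousOn_const.mul (continuousOn_pd hΩ (contDiffOn_usq h.regU)))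
  rw [integral_add c1.integrableOn c3.integrableOn] at h1
  simp only [add_mul]
  rw [integral_add c1.integrableOn c2.integrableOn]
  linarith

/-- The local energy identity. -/
lemma WeakSol.energy (h : WeakSol Ω U P) (hΩ : IsOpen Ω) {φ : E n → ℝ} (hφ : ContDiff ℝ 2 φ)
    (hc : HasCompactSupport φ) (hs : tsupport φ ⊆ Ω) :
    ∫ x in Ω, gsq U x * φ x = ∫ x in Ω, (1 / 2 * usq U x * lap φ x + hd U P x * adv U φ x) := by
  have hT : Test Ω φ := ⟨hφ.of_le (by norm_num), hc, hs⟩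
  have h1 := h.tested hΩ hT
  have hq := contDiffOn_usq h.regU
  have h2 := integral_mul_lap hΩ (a := fun x => 1 / 2 * usq U x) (contDiffOn_const.mul hq) hφ hc hs
  rw [setIntegral_congr_fun (g := fun x => ∑ i, (1 / 2 * pd i (usq U) x) * pd i φ x)
    hΩ.measurableSet fun x hx => Finset.sum_congr rfl fun i _ => by
      rw [pd_const_mul _ (diffAt hΩ hq hx)], h1] at h2
  have hH := contDiffOn_hd h.regU h.regP
  have h3 := h.transport hΩ hH hT
  have c1 := hT.cc.mul_left hΩ (continuousOn_gsq hΩ h.regU)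
  have c2 := hT.cc.mul_left hΩ (continuousOn_adv hΩ h.regU hH)
  have c4 : CC Ω (lap φ) := CC.sum fun i _ => Test.pd_cc ⟨contDiff_pd hφ (by norm_num),
    hc.of_isClosed_subset (isClosed_tsupport _) (tsupport_pd φ), (tsupport_pd φ).trans hs⟩ i
  simp only [add_mul] at h2
  rw [integral_add c1.integrableOn c2.integrableOn] at h2
  rw [integral_add (c4.mul_left hΩ (contDiffOn_const.mul hq).continuousOn).integrableOn
    ((hT.adv_cc hΩ h.regU).mul_left hΩ hH.continuousOn).integrableOn]
  linarith

/-- The weak form of the equation for the head pressure. -/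
lemma WeakSol.head (h : WeakSol Ω U P) (hΩ : IsOpen Ω) {φ : E n → ℝ} (hφ : Test Ω φ) :
    ∫ x in Ω, ∑ i, pd i (hd U P) x * pd i φ x =
      - ∫ x in Ω, (1 / 2 * wsq U x + adv U (hd U P) x) * φ x := by
  have hq := contDiffOn_usq h.regU
  have hH := contDiffOn_hd h.regU h.regP
  have e1 : ∀ x ∈ Ω, ∑ i, pd i (hd U P) x * pd i φ x =
      ∑ i, (1 / 2 * pd i (usq U) x) * pd i φ x + ∑ i, pd i P x * pd i φ x := by
    intro x hx
    rw [← Finset.sum_add_distrib]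
    refine Finset.sum_congr rfl fun i _ => ?_
    rw [pd_hd hΩ h.regU h.regP hx, pd_usq hΩ h.regU hx]
    ring
  have c1 : CC Ω (fun x => ∑ i, (1 / 2 * pd i (usq U) x) * pd i φ x) := CC.sum fun i _ =>
    (hφ.pd_cc i).mul_left hΩ (continuousOn_const.mul (continuousOn_pd hΩ hq))
  have c2 : CC Ω (fun x => ∑ i, pd i P x * pd i φ x) := CC.sum fun i _ =>
    (hφ.pd_cc i).mul_left hΩ (continuousOn_pd hΩ h.regP)
  have c3 : CC Ω (fun x => (gsq U x + adv U (hd U P) x) * φ x) := hφ.cc.mul_left hΩ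
    ((continuousOn_gsq hΩ h.regU).add (continuousOn_adv hΩ h.regU hH))
  have c4 := hφ.cc.mul_left hΩ (continuousOn_src hΩ h.regU)
  rw [setIntegral_congr_fun hΩ.measurableSet e1, integral_add c1.integrableOn c2.integrableOn,
    h.tested hΩ hφ, h.pres φ hφ]
  have e2 : ∀ x, (1 / 2 * wsq U x + adv U (hd U P) x) * φ x =
      (gsq U x + adv U (hd U P) x) * φ x - src U x * φ x := fun x => by rw [gsq_eq]; ring
  simp only [e2]
  rw [integral_sub c3.integrableOn c4.integrableOn]
  ring

/-- Renormalised equation for the head pressure. -/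
lemma WeakSol.head_renorm (h : WeakSol Ω U P) (hΩ : IsOpen Ω) {Φ Φ₁ Φ₂ : ℝ → ℝ}
    (h1 : ∀ s, HasDerivAt Φ (Φ₁ s) s) (h2 : ∀ s, HasDerivAt Φ₁ (Φ₂ s) s) (hc2 : Continuous Φ₂)
    {φ : E n → ℝ} (hφ : ContDiff ℝ 2 φ) (hc : HasCompactSupport φ) (hs : tsupport φ ⊆ Ω) :
    ∫ x in Ω, (Φ₂ (hd U P x) * ∑ i, pd i (hd U P) x ^ 2 + 1 / 2 * Φ₁ (hd U P x) * wsq U x) * φ x =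
      ∫ x in Ω, Φ (hd U P x) * (lap φ x + adv U φ x) := by
  have hT : Test Ω φ := ⟨hφ.of_le (by norm_num), hc, hs⟩
  have hH := contDiffOn_hd h.regU h.regP
  have hdiff : ∀ {F F' : ℝ → ℝ}, (∀ s, HasDerivAt F (F' s) s) → Continuous F' → ContDiff ℝ 1 F := by
    intro F F' hF hF'
    rw [contDiff_one_iff_deriv]
    refine ⟨fun s => (hF s).differentiableAt, ?_⟩
    rwa [show deriv F = F' from funext fun s => (hF s).deriv]
  have hΦ₁ : ContDiff ℝ 1 Φ₁ := hdiff h2 hc2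
  have hΦ : ContDiff ℝ 1 Φ := hdiff h1 hΦ₁.continuous
  have hv : ContDiffOn ℝ 1 (fun x => Φ (hd U P x)) Ω := hΦ.comp_contDiffOn hH
  have hv1 : ContDiffOn ℝ 1 (fun x => Φ₁ (hd U P x)) Ω := hΦ₁.comp_contDiffOn hH
  have hT1 := hT.mul_left hΩ hv1
  have k1 := h.head hΩ hT1
  have k2 := integral_mul_lap hΩ hv hφ hc hs
  have k3 := h.transport hΩ hv hT
  have pv : ∀ x ∈ Ω, ∀ i, pd i (fun x => Φ (hd U P x)) x = Φ₁ (hd U P x) * pd i (hd U P) x :=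
    fun x hx i => pd_comp (h1 _) (diffAt hΩ hH hx)
  have pv1 : ∀ x ∈ Ω, ∀ i, pd i (fun x => Φ₁ (hd U P x)) x = Φ₂ (hd U P x) * pd i (hd U P) x :=
    fun x hx i => pd_comp (h2 _) (diffAt hΩ hH hx)
  have e1 : ∀ x ∈ Ω, ∑ i, pd i (hd U P) x * pd i (fun x => Φ₁ (hd U P x) * φ x) x =
      (Φ₂ (hd U P x) * ∑ i, pd i (hd U P) x ^ 2) * φ x +
      ∑ i, pd i (fun x => Φ (hd U P x)) x * pd i φ x := by
    intro x hx
    rw [Finset.mul_sum, Finset.sum_mul, ← Finset.sum_add_distrib]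
    refine Finset.sum_congr rfl fun i _ => ?_
    rw [pd_mul (diffAt hΩ hv1 hx) (hT.diff x), pv x hx, pv1 x hx]
    ring
  have e2 : ∀ x ∈ Ω, (1 / 2 * wsq U x + adv U (hd U P) x) * (Φ₁ (hd U P x) * φ x) =
      (1 / 2 * Φ₁ (hd U P x) * wsq U x) * φ x + adv U (fun x => Φ (hd U P x)) x * φ x := by
    intro x hx
    have : adv U (fun x => Φ (hd U P x)) x = Φ₁ (hd U P x) * adv U (hd U P) x := by
      simp only [adv, pv x hx, Finset.mul_sum]
      exact Finset.sum_congr rfl fun i _ => by ring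
    rw [this]
    ring
  have hcΦ₂ : ContinuousOn (fun x => Φ₂ (hd U P x)) Ω := hc2.comp_continuousOn hH.continuousOn
  have c1 : CC Ω (fun x => (Φ₂ (hd U P x) * ∑ i, pd i (hd U P) x ^ 2) * φ x) :=
    hT.cc.mul_left hΩ (hcΦ₂.mul (continuousOn_finsetSum Finset.univ fun i _ =>
    (continuousOn_pd (i := i) hΩ hH).pow 2))
  have c2 : CC Ω (fun x => ∑ i, pd i (fun x => Φ (hd U P x)) x * pd i φ x) := CC.sum fun i _ =>
    (hT.pd_cc i).mul_left hΩ (continuousOn_pd hΩ hv)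
  have c3 : CC Ω (fun x => (1 / 2 * Φ₁ (hd U P x) * wsq U x) * φ x) := hT.cc.mul_left hΩ ((continuousOn_const (c := (1 / 2 : ℝ)).mul hv1.continuousOn).mul
    (continuousOn_wsq hΩ h.regU))
  have c4 := hT.cc.mul_left hΩ (continuousOn_adv hΩ h.regU hv)
  have c5 : CC Ω (lap φ) := CC.sum fun i _ => Test.pd_cc ⟨contDiff_pd hφ (by norm_num),
    hc.of_isClosed_subset (isClosed_tsupport _) (tsupport_pd φ), (tsupport_pd φ).trans hs⟩ i
  rw [setIntegral_congr_fun hΩ.measurableSet e1, setIntegral_congr_fun hΩ.measurableSet e2,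
    integral_add c1.integrableOn c2.integrableOn, integral_add c3.integrableOn c4.integrableOn] at k1
  simp only [add_mul, mul_add]
  rw [integral_add c1.integrableOn c3.integrableOn,
    integral_add (c5.mul_left hΩ hv.continuousOn).integrableOn
    ((hT.adv_cc hΩ h.regU).mul_left hΩ hv.continuousOn).integrableOn]
  linarith

end Identities

/-- Functions of `|x|²` supported in an annulus, with a continuous derivative. -/
structure Rad (f f₁ : ℝ → ℝ) (α β : ℝ) : Prop where
  pos : 0 < α
  deriv : ∀ q, 0 < q → HasDerivAt f (f₁ q) q
  cont : ContinuousOn f₁ (Ioi 0)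
  supp : ∀ q, q ∉ Icc α β → f q = 0

section Radial
variable {f f₁ f₂ : ℝ → ℝ} {α β : ℝ}

lemma Rad.supp_deriv (h : Rad f f₁ α β) {q : ℝ} (hq : 0 < q) (hq' : q ∉ Icc α β) : f₁ q = 0 := by
  have h1 : f =ᶠ[𝓝 q] fun _ => 0 := by
    filter_upwards [isClosed_Icc.isOpen_compl.mem_nhds hq'] with y hy using h.supp y hy
  exact ((h.deriv q hq).congr_of_eventuallyEq h1.symm).unique (hasDerivAt_const q 0)

lemma tsupport_radial (hs : ∀ q, q ∉ Icc α β → f q = 0) :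
    tsupport (fun x : E n => f (nsq x)) ⊆ nsq ⁻¹' Icc α β := by
  refine closure_minimal (fun x hx => ?_)
    (isClosed_Icc.preimage (contDiff_nsq (m := 0)).continuous)
  by_contra hc
  exact hx (hs _ hc)

lemma tsupport_radial_sub (hα : 0 < α) (hs : ∀ q, q ∉ Icc α β → f q = 0) :
    tsupport (fun x : E n => f (nsq x)) ⊆ {0}ᶜ := fun x hx h0 => by
  have := (tsupport_radial hs hx).1
  rw [mem_singleton_iff.1 h0] at this
  simp [nsq] at this
  linarith

lemma compact_radial (hs : ∀ q, q ∉ Icc α β → f q = 0) :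
    HasCompactSupport (fun x : E n => f (nsq x)) := by
  refine HasCompactSupport.of_support_subset_isCompact
    (isCompact_closedBall (0 : E n) (Real.sqrt β)) fun x hx => ?_
  have := (tsupport_radial hs (subset_tsupport _ hx)).2
  rw [mem_closedBall_zero_iff]
  exact Real.le_sqrt_of_sq_le this

lemma contDiff_radial {k : WithTop ℕ∞} (hα : 0 < α) (hs : ∀ q, q ∉ Icc α β → f q = 0)
    (hf : ContDiffOn ℝ k f (Ioi 0)) : ContDiff ℝ k (fun x : E n => f (nsq x)) := by
  rw [contDiff_iff_contDiffAt]
  intro x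
  by_cases hx : x = 0
  · have h1 : x ∉ tsupport (fun x : E n => f (nsq x)) := fun h =>
      tsupport_radial_sub hα hs h (mem_singleton_iff.2 hx)
    have h2 : (fun x : E n => f (nsq x)) =ᶠ[𝓝 x] fun _ => 0 :=
      notMem_tsupport_iff_eventuallyEq.1 h1
    exact contDiffAt_const.congr_of_eventuallyEq h2
  · exact (hf.contDiffAt (Ioi_mem_nhds (nsq_pos hx))).comp x contDiff_nsq.contDiffAt

lemma contDiffOn_one_of_hasDerivAt (h : ∀ q, 0 < q → HasDerivAt f (f₁ q) q)
    (hc : ContinuousOn f₁ (Ioi 0)) : ContDiffOn ℝ 1 f (Ioi 0) := by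
  rw [show (1 : WithTop ℕ∞) = 0 + 1 by simp, contDiffOn_succ_iff_deriv_of_isOpen isOpen_Ioi]
  refine ⟨fun q hq => (h q hq).differentiableAt.differentiableWithinAt, by simp, ?_⟩
  rw [contDiffOn_zero]
  exact hc.congr fun q hq => (h q hq).deriv

lemma contDiffOn_two_of_hasDerivAt (h : ∀ q, 0 < q → HasDerivAt f (f₁ q) q)
    (h' : ContDiffOn ℝ 1 f₁ (Ioi 0)) : ContDiffOn ℝ 2 f (Ioi 0) := by
  rw [show (2 : WithTop ℕ∞) = 1 + 1 by norm_num, contDiffOn_succ_iff_deriv_of_isOpen isOpen_Ioi]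
  exact ⟨fun q hq => (h q hq).differentiableAt.differentiableWithinAt, by simp,
    h'.congr fun q hq => (h q hq).deriv⟩

lemma Rad.test (h : Rad f f₁ α β) : Test ({0}ᶜ : Set (E n)) (fun x => f (nsq x)) :=
  ⟨contDiff_radial h.pos h.supp (contDiffOn_one_of_hasDerivAt h.deriv h.cont),
    compact_radial h.supp, tsupport_radial_sub h.pos h.supp⟩

lemma Rad.smooth (h : Rad f f₁ α β) (h' : Rad f₁ f₂ α β) :
    ContDiff ℝ 2 (fun x : E n => f (nsq x)) :=
  contDiff_radial h.pos h.supp (contDiffOn_two_of_hasDerivAt h.deriv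
    (contDiffOn_one_of_hasDerivAt h'.deriv h'.cont))

lemma Rad.pd_eq (h : Rad f f₁ α β) {x : E n} (hx : x ≠ 0) (i : Fin n) :
    pd i (fun x => f (nsq x)) x = f₁ (nsq x) * (2 * x i) :=
  pd_radial (h.deriv _ (nsq_pos hx))

lemma Rad.lap_eq (h : Rad f f₁ α β) (h' : Rad f₁ f₂ α β) {x : E n} (hx : x ≠ 0) :
    lap (fun x => f (nsq x)) x = 2 * n * f₁ (nsq x) + 4 * nsq x * f₂ (nsq x) := by
  have h1 : ∀ i, pd i (pd i (fun x => f (nsq x))) x =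
      f₂ (nsq x) * (2 * x i) * (2 * x i) + f₁ (nsq x) * 2 := by
    intro i
    have e : pd i (fun x : E n => f (nsq x)) =ᶠ[𝓝 x] fun x => f₁ (nsq x) * (2 * x i) := by
      filter_upwards [isOpen_compl_singleton.mem_nhds hx] with y hy using h.pd_eq hy i
    rw [pd_congr e, pd_mul (h'.test.diff x) ((differentiableAt_coord i x).const_mul 2),
      h'.pd_eq hx, pd_const_mul 2 (differentiableAt_coord i x), pd_coord, if_pos rfl, mul_one]
  simp only [lap, h1, Finset.sum_add_distrib]
  rw [nsq_eq, Finset.mul_sum, Finset.sum_mul]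
  simp only [Finset.sum_const, Finset.card_univ, Fintype.card_fin, nsmul_eq_mul]
  rw [add_comm]
  congr 1
  · ring
  · exact Finset.sum_congr rfl fun i _ => by ring

/-- The radial component `x · U`. -/
noncomputable def xu (U : Fin n → E n → ℝ) (x : E n) : ℝ := ∑ i, x i * U i x

lemma Rad.adv_eq (h : Rad f f₁ α β) (U : Fin n → E n → ℝ) {x : E n} (hx : x ≠ 0) :
    adv U (fun x => f (nsq x)) x = 2 * f₁ (nsq x) * xu U x := by
  simp only [adv, h.pd_eq hx, xu, Finset.mul_sum]
  exact Finset.sum_congr rfl fun i _ => by ring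

lemma Rad.pd_coord_mul (h : Rad f f₁ α β) {x : E n} (hx : x ≠ 0) (i j : Fin n) :
    pd i (fun x => x j * f (nsq x)) x =
      (if i = j then f (nsq x) else 0) + 2 * f₁ (nsq x) * (x i * x j) := by
  rw [pd_mul (differentiableAt_coord j x) (h.test.diff x), h.pd_eq hx, pd_coord]
  split_ifs <;> ring

lemma Rad.cc_deriv (h : Rad f f₁ α β) :
    CC ({0}ᶜ : Set (E n)) (fun x => nsq x * f₁ (nsq x)) := by
  have h1 : CC ({0}ᶜ : Set (E n)) (fun x => ∑ i, (1 / 2 * x i) * pd i (fun x => f (nsq x)) x) :=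
    CC.sum fun i _ => (h.test.pd_cc i).mul_left isOpen_compl_singleton
      ((contDiff_coord (m := 0) i).continuous.continuousOn.const_mul _ )
  have h2 : (fun x : E n => nsq x * f₁ (nsq x)) =
      fun x => (if x = 0 then 0 else nsq x * f₁ (nsq x)) := by
    funext x
    split_ifs with hx
    · simp [hx, nsq]
    · rfl
  have h3 : (fun x => ∑ i, (1 / 2 * x i) * pd i (fun x => f (nsq x)) x) =
      fun x : E n => (if x = 0 then 0 else nsq x * f₁ (nsq x)) := by
    funext x
    split_ifs with hx
    · simp [hx]
    · rw [nsq_eq, Finset.sum_mul]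
      refine Finset.sum_congr rfl fun i _ => ?_
      rw [h.pd_eq hx, ← nsq_eq]
      ring
  rwa [h2, ← h3]

lemma sum_coord_mul_pd {U : Fin n → E n → ℝ} {x : E n}
    (hx : x ≠ 0) (hU : ∀ j, ContDiffOn ℝ 1 (U j) {0}ᶜ) :
    ∑ i, x i * pd i (usq U) x = 2 * ∑ j, U j x * ∑ i, x i * pd i (U j) x := by
  simp only [pd_usq isOpen_compl_singleton hU hx, Finset.mul_sum]
  rw [Finset.sum_comm]
  exact Finset.sum_congr rfl fun i _ => Finset.sum_congr rfl fun j _ => by ring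

/-- Testing a divergence against a radial weight. -/
lemma Rad.div_identity (h : Rad f f₁ α β) {g : E n → ℝ} (hg : ContDiffOn ℝ 1 g {0}ᶜ) :
    ∫ x in ({0}ᶜ : Set (E n)), g x * (n * f (nsq x) + 2 * (nsq x * f₁ (nsq x))) =
      - ∫ x in ({0}ᶜ : Set (E n)), (∑ i, x i * pd i g x) * f (nsq x) := by
  have hΩ : IsOpen ({0}ᶜ : Set (E n)) := isOpen_compl_singleton
  have h0 : ∫ x in ({0}ᶜ : Set (E n)), (g x * (n * f (nsq x) + 2 * (nsq x * f₁ (nsq x))) +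
      (∑ i, x i * pd i g x) * f (nsq x)) = 0 := by
    refine integral_div_zero hΩ (V := fun i x => g x * (x i * f (nsq x)))
      (fun i => (h.test.mul_left hΩ (contDiff_coord i).contDiffOn).mul_left hΩ hg) fun x hx => ?_
    have e : ∀ i, pd i (fun x => g x * (x i * f (nsq x))) x = x i * pd i g x * f (nsq x) +
        (g x * f (nsq x) + g x * (2 * f₁ (nsq x)) * x i ^ 2) := fun i => by
      rw [pd_mul (diffAt hΩ hg hx) ((differentiableAt_coord i x).fun_mul (h.test.diff x)),
        h.pd_coord_mul hx, if_pos rfl]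
      ring
    simp only [e, Finset.sum_add_distrib, ← Finset.sum_mul, ← Finset.mul_sum]
    rw [← nsq_eq]
    simp
    ring
  have c1 : CC ({0}ᶜ : Set (E n))
      (fun x => g x * (n * f (nsq x) + 2 * (nsq x * f₁ (nsq x)))) :=
    ((h.test.cc.const_mul _).add (h.cc_deriv.const_mul 2)).mul_left hΩ hg.continuousOn
  have c2 : CC ({0}ᶜ : Set (E n)) (fun x => (∑ i, x i * pd i g x) * f (nsq x)) :=
    h.test.cc.mul_left hΩ (continuousOn_finsetSum _ fun i _ =>
      (contDiff_coord (m := 0) i).continuous.continuousOn.mul (continuousOn_pd hΩ hg))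
  rw [integral_add c1.integrableOn c2.integrableOn] at h0
  linarith

/-- The momentum equation tested with a radial gradient field. -/
lemma WeakSol.radial_momentum {U : Fin n → E n → ℝ} {P : E n → ℝ} (hS : WeakSol {0}ᶜ U P)
    (h : Rad f f₁ α β) :
    ∫ x in ({0}ᶜ : Set (E n)), (usq U x * f (nsq x) + 2 * f₁ (nsq x) * xu U x ^ 2 +
      P x * (n * f (nsq x) + 2 * (nsq x * f₁ (nsq x)))) = 0 := by
  have hΩ : IsOpen ({0}ᶜ : Set (E n)) := isOpen_compl_singleton
  have ht : ∀ j, Test ({0}ᶜ : Set (E n)) (fun x => x j * f (nsq x)) := fun j =>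
    h.test.mul_left hΩ (contDiff_coord j).contDiffOn
  have c1 : ∀ j, CC ({0}ᶜ : Set (E n))
      (fun x => ∑ i, vort U i j x * pd i (fun x => x j * f (nsq x)) x) := fun j =>
    CC.sum fun i _ => ((ht j).pd_cc i).mul_left hΩ (continuousOn_vort hΩ hS.regU i j)
  have c2 : ∀ j, CC ({0}ᶜ : Set (E n)) (fun x => (conv U j x + pd j P x) * (x j * f (nsq x))) :=
    fun j => (ht j).cc.mul_left hΩ ((continuousOn_conv hΩ hS.regU j).add
      (continuousOn_pd hΩ hS.regP))
  have h1 := Finset.sum_congr (rfl : (Finset.univ : Finset (Fin n)) = _)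
    fun j _ => hS.mom' _ (ht j) j
  rw [Finset.sum_neg_distrib, ← integral_finsetSum _ fun j _ => (c1 j).integrableOn,
    ← integral_finsetSum _ fun j _ => (c2 j).integrableOn] at h1
  have e1 : ∀ x ∈ ({0}ᶜ : Set (E n)),
      ∑ j, ∑ i, vort U i j x * pd i (fun x => x j * f (nsq x)) x = 0 := by
    intro x hx
    have e : ∑ j, ∑ i, vort U i j x * pd i (fun x => x j * f (nsq x)) x =
        - ∑ j, ∑ i, vort U i j x * pd i (fun x => x j * f (nsq x)) x := by
      rw [← Finset.sum_neg_distrib, Finset.sum_comm]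
      refine Finset.sum_congr rfl fun j _ => ?_
      rw [← Finset.sum_neg_distrib]
      refine Finset.sum_congr rfl fun i _ => ?_
      rw [h.pd_coord_mul hx, h.pd_coord_mul hx, vort, vort]
      simp only [eq_comm (a := j) (b := i)]
      ring
    linarith
  rw [setIntegral_congr_fun hΩ.measurableSet e1, integral_zero] at h1
  have h2 : ∀ j, ∫ x in ({0}ᶜ : Set (E n)), adv U (U j) x * (x j * f (nsq x)) =
      - ∫ x in ({0}ᶜ : Set (E n)), U j x * adv U (fun x => x j * f (nsq x)) x :=
    fun j => hS.transport hΩ (hS.regU j) (ht j)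
  have c3 : ∀ j, CC ({0}ᶜ : Set (E n)) (fun x => adv U (U j) x * (x j * f (nsq x))) := fun j =>
    (ht j).cc.mul_left hΩ (continuousOn_adv hΩ hS.regU (hS.regU j))
  have c4 : ∀ j, CC ({0}ᶜ : Set (E n)) (fun x => U j x * adv U (fun x => x j * f (nsq x)) x) :=
    fun j => ((ht j).adv_cc hΩ hS.regU).mul_left hΩ (hS.regU j).continuousOn
  have h3 := Finset.sum_congr (rfl : (Finset.univ : Finset (Fin n)) = _) fun j _ => h2 j
  rw [Finset.sum_neg_distrib, ← integral_finsetSum _ fun j _ => (c3 j).integrableOn,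
    ← integral_finsetSum _ fun j _ => (c4 j).integrableOn] at h3
  have h4 := h.div_identity hS.regP
  have e2 : ∀ x ∈ ({0}ᶜ : Set (E n)), ∑ j, U j x * adv U (fun x => x j * f (nsq x)) x =
      usq U x * f (nsq x) + 2 * f₁ (nsq x) * xu U x ^ 2 := by
    intro x hx
    have : ∀ j, U j x * adv U (fun x => x j * f (nsq x)) x =
        U j x ^ 2 * f (nsq x) + 2 * f₁ (nsq x) * xu U x * (x j * U j x) := by
      intro j
      simp only [adv, h.pd_coord_mul hx, mul_add, Finset.sum_add_distrib, mul_ite, mul_zero,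
        Finset.sum_ite_eq', Finset.mem_univ, if_true]
      congr 1
      · ring
      · simp only [xu, Finset.mul_sum, Finset.sum_mul]
        exact Finset.sum_congr rfl fun i _ => by ring
    simp only [this, Finset.sum_add_distrib, ← Finset.sum_mul, ← Finset.mul_sum]
    rw [← xu, ← usq]
    ring
  have e3 : ∀ x, ∑ j, (conv U j x + pd j P x) * (x j * f (nsq x)) =
      ∑ j, adv U (U j) x * (x j * f (nsq x)) + (∑ i, x i * pd i P x) * f (nsq x) := by
    intro x
    rw [Finset.sum_mul, ← Finset.sum_add_distrib]
    refine Finset.sum_congr rfl fun j _ => ?_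
    rw [conv, adv]
    ring
  have c5 : CC ({0}ᶜ : Set (E n)) (fun x => (∑ i, x i * pd i P x) * f (nsq x)) :=
    h.test.cc.mul_left hΩ (continuousOn_finsetSum _ fun i _ =>
      (contDiff_coord (m := 0) i).continuous.continuousOn.mul (continuousOn_pd hΩ hS.regP))
  have c6 : CC ({0}ᶜ : Set (E n))
      (fun x => P x * (n * f (nsq x) + 2 * (nsq x * f₁ (nsq x)))) :=
    ((h.test.cc.const_mul _).add (h.cc_deriv.const_mul 2)).mul_left hΩ hS.regP.continuousOn
  simp only [e3] at h1
  rw [integral_add (CC.sum fun j _ => c3 j).integrableOn c5.integrableOn] at h1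
  rw [setIntegral_congr_fun (g := fun x => ∑ j, U j x * adv U (fun x => x j * f (nsq x)) x +
    P x * (n * f (nsq x) + 2 * (nsq x * f₁ (nsq x)))) hΩ.measurableSet
    (fun x hx => by beta_reduce; rw [e2 x hx]), integral_add (CC.sum fun j _ => c4 j).integrableOn
    c6.integrableOn]
  linarith

end Radial

section Cutoff

lemma Rad.add {f f₁ g g₁ : ℝ → ℝ} {α β : ℝ} (hf : Rad f f₁ α β) (hg : Rad g g₁ α β) :
    Rad (fun q => f q + g q) (fun q => f₁ q + g₁ q) α β where
  pos := hf.pos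
  deriv q hq := (hf.deriv q hq).add (hg.deriv q hq)
  cont := hf.cont.add hg.cont
  supp q hq := by rw [hf.supp q hq, hg.supp q hq, add_zero]

lemma Rad.mul_left {f f₁ g g₁ : ℝ → ℝ} {α β : ℝ} (hf : Rad f f₁ α β)
    (hg : ∀ q, 0 < q → HasDerivAt g (g₁ q) q) (hc : ContinuousOn g₁ (Ioi 0)) :
    Rad (fun q => g q * f q) (fun q => g₁ q * f q + g q * f₁ q) α β where
  pos := hf.pos
  deriv q hq := (hg q hq).mul (hf.deriv q hq)
  cont := (hc.mul fun q hq => (hf.deriv q hq).continuousAt.continuousWithinAt).add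
    (ContinuousOn.mul (fun q hq => (hg q hq).continuousAt.continuousWithinAt) hf.cont)
  supp q hq := by rw [hf.supp q hq, mul_zero]

lemma hasDerivAt_rpow_pos (s : ℝ) {q : ℝ} (hq : 0 < q) :
    HasDerivAt (fun q : ℝ => q ^ s) (s * q ^ (s - 1)) q :=
  Real.hasDerivAt_rpow_const (Or.inl hq.ne')

lemma continuousOn_rpow_pos (c s : ℝ) : ContinuousOn (fun q : ℝ => c * q ^ s) (Ioi 0) :=
  continuousOn_const.mul fun q hq =>
    (Real.continuousAt_rpow_const q s (Or.inl (ne_of_gt hq))).continuousWithinAt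

lemma Rad.rpow_mul {f f₁ : ℝ → ℝ} {α β : ℝ} (hf : Rad f f₁ α β) (s : ℝ) :
    Rad (fun q => q ^ s * f q) (fun q => s * q ^ (s - 1) * f q + q ^ s * f₁ q) α β :=
  hf.mul_left (fun _ hq => hasDerivAt_rpow_pos s hq) (continuousOn_rpow_pos s (s - 1))

lemma Rad.rpow_mul' {f f₁ f₂ : ℝ → ℝ} {α β : ℝ} (hf : Rad f f₁ α β) (hf' : Rad f₁ f₂ α β) (s : ℝ) :
    Rad (fun q => s * q ^ (s - 1) * f q + q ^ s * f₁ q)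
      (fun q => (s * ((s - 1) * q ^ (s - 1 - 1)) * f q + s * q ^ (s - 1) * f₁ q) +
        (s * q ^ (s - 1) * f₁ q + q ^ s * f₂ q)) α β := by
  refine (hf.mul_left (g := fun q => s * q ^ (s - 1)) (fun _ hq =>
    (hasDerivAt_rpow_pos (s - 1) hq).const_mul s) ?_).add (hf'.rpow_mul s)
  exact continuousOn_const.mul (continuousOn_rpow_pos _ _)

/-- The two annuli where the cutoff functions are not constant. -/
def ann (N : ℝ) : Set ℝ := Icc (1 / N) (2 / N) ∪ Icc N (2 * N)

/-- A cutoff function between the scales `1 / N` and `N`. -/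
structure Cut (c N : ℝ) (Z Z₁ Z₂ : ℝ → ℝ) : Prop where
  rad : Rad Z Z₁ (1 / N) (2 * N)
  rad' : Rad Z₁ Z₂ (1 / N) (2 * N)
  nonneg : ∀ q, 0 ≤ Z q
  le_one : ∀ q, Z q ≤ 1
  one : ∀ q ∈ Icc (2 / N) N, Z q = 1
  zero₁ : ∀ q ∉ ann N, Z₁ q = 0
  zero₂ : ∀ q ∉ ann N, Z₂ q = 0
  le₁ : ∀ q, |q * Z₁ q| ≤ c
  le₂ : ∀ q, |q ^ 2 * Z₂ q| ≤ c

lemma deriv_eq_zero_of_const {S : ℝ → ℝ} (a b : ℝ) (h0 : ∀ t ≤ 0, S t = a) (h1 : ∀ t, 1 ≤ t → S t = b)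
    {t : ℝ} (ht : t ∉ Icc (0:ℝ) 1) : deriv S t = 0 := by
  rw [mem_Icc, not_and_or] at ht
  rcases ht with ht | ht
  · have : S =ᶠ[𝓝 t] fun _ => a := by
      filter_upwards [Iio_mem_nhds (lt_of_not_ge ht)] with y hy using h0 y hy.le
    rw [this.deriv_eq, deriv_const]
  · have : S =ᶠ[𝓝 t] fun _ => b := by
      filter_upwards [Ioi_mem_nhds (lt_of_not_ge ht)] with y hy using h1 y hy.le
    rw [this.deriv_eq, deriv_const]

lemma exists_transition : ∃ (S S₁ S₂ : ℝ → ℝ) (M : ℝ), 0 ≤ M ∧ (∀ t, HasDerivAt S (S₁ t) t) ∧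
    (∀ t, HasDerivAt S₁ (S₂ t) t) ∧ Continuous S₂ ∧ (∀ t, 0 ≤ S t) ∧ (∀ t, S t ≤ 1) ∧
    (∀ t ≤ 0, S t = 0) ∧ (∀ t, 1 ≤ t → S t = 1) ∧ (∀ t ∉ Icc (0:ℝ) 1, S₁ t = 0) ∧
    (∀ t ∉ Icc (0:ℝ) 1, S₂ t = 0) ∧ (∀ t, |S₁ t| ≤ M) ∧ (∀ t, |S₂ t| ≤ M) := by
  have hS : ContDiff ℝ 3 Real.smoothTransition := Real.smoothTransition.contDiff
  have hS1 : ContDiff ℝ 2 (deriv Real.smoothTransition) := by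
    rw [show (3 : WithTop ℕ∞) = 2 + 1 by norm_num, contDiff_succ_iff_deriv] at hS
    exact hS.2.2
  have hS2 : ContDiff ℝ 1 (deriv (deriv Real.smoothTransition)) := by
    rw [show (2 : WithTop ℕ∞) = 1 + 1 by norm_num, contDiff_succ_iff_deriv] at hS1
    exact hS1.2.2
  have z0 : ∀ t ≤ (0:ℝ), Real.smoothTransition t = 0 := fun t ht =>
    Real.smoothTransition.zero_of_nonpos ht
  have z1 : ∀ t, 1 ≤ t → Real.smoothTransition t = 1 := fun t ht =>
    Real.smoothTransition.one_of_one_le ht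
  have d1 : ∀ t ∉ Icc (0:ℝ) 1, deriv Real.smoothTransition t = 0 := fun t ht =>
    deriv_eq_zero_of_const 0 1 z0 z1 ht
  have d2 : ∀ t ∉ Icc (0:ℝ) 1, deriv (deriv Real.smoothTransition) t = 0 := by
    intro t ht
    have : deriv Real.smoothTransition =ᶠ[𝓝 t] fun _ => 0 := by
      filter_upwards [isClosed_Icc.isOpen_compl.mem_nhds ht] with y hy using d1 y hy
    rw [this.deriv_eq, deriv_const]
  obtain ⟨M1, hM1⟩ := isCompact_Icc.exists_bound_of_continuousOn (s := Icc (0:ℝ) 1)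
    hS1.continuous.continuousOn
  obtain ⟨M2, hM2⟩ := isCompact_Icc.exists_bound_of_continuousOn (s := Icc (0:ℝ) 1)
    hS2.continuous.continuousOn
  refine ⟨_, _, _, |M1| + |M2|, by positivity,
    fun t => (hS.differentiable (by norm_num) t).hasDerivAt,
    fun t => (hS1.differentiable (by norm_num) t).hasDerivAt, hS2.continuous,
    Real.smoothTransition.nonneg, Real.smoothTransition.le_one, z0, z1, d1, d2, fun t => ?_,
    fun t => ?_⟩
  · by_cases ht : t ∈ Icc (0:ℝ) 1
    · exact (hM1 t ht).trans ((le_abs_self _).trans (by linarith [abs_nonneg M2]))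
    · rw [d1 t ht, abs_zero]; positivity
  · by_cases ht : t ∈ Icc (0:ℝ) 1
    · exact (hM2 t ht).trans ((le_abs_self _).trans (by linarith [abs_nonneg M1]))
    · rw [d2 t ht, abs_zero]; positivity

theorem exists_cut : ∃ c, 0 ≤ c ∧ ∀ N : ℝ, 0 < N → ∃ Z Z₁ Z₂, Cut c N Z Z₁ Z₂ := by
  obtain ⟨S, S₁, S₂, M, hM, hd, hd', hc, h0, h1, z0, z1, d1, d2, b1, b2⟩ := exists_transition
  refine ⟨16 * M + 16 * M ^ 2, by positivity, fun N hN => ?_⟩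
  have da : ∀ {F F' : ℝ → ℝ} (q : ℝ), (∀ t, HasDerivAt F (F' t) t) →
      HasDerivAt (fun q => F (N * q - 1)) (N * F' (N * q - 1)) q := by
    intro F F' q hF
    have : HasDerivAt (fun q => N * q - 1) (N * 1) q := ((hasDerivAt_id q).const_mul N).sub_const 1
    exact ((hF _).comp q this).congr_deriv (by ring)
  have db : ∀ {F F' : ℝ → ℝ} (q : ℝ), (∀ t, HasDerivAt F (F' t) t) →
      HasDerivAt (fun q => F (2 - N⁻¹ * q)) (-(N⁻¹ * F' (2 - N⁻¹ * q))) q := by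
    intro F F' q hF
    have : HasDerivAt (fun q => 2 - N⁻¹ * q) (-(N⁻¹ * 1)) q :=
      ((hasDerivAt_id q).const_mul N⁻¹).const_sub 2
    exact ((hF _).comp q this).congr_deriv (by ring)
  have cS1 : Continuous S₁ := continuous_iff_continuousAt.2 fun t => (hd' t).continuousAt
  have cS : Continuous S := continuous_iff_continuousAt.2 fun t => (hd t).continuousAt
  have hNi : 0 < N⁻¹ := inv_pos.2 hN
  have ma : ∀ q, q ∉ ann N → N * q - 1 ∉ Icc (0:ℝ) 1 := fun q hq h => hq (Or.inl
    ⟨by rw [div_le_iff₀ hN]; linarith [h.1], by rw [le_div_iff₀ hN]; linarith [h.2]⟩)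
  have mb : ∀ q, q ∉ ann N → 2 - N⁻¹ * q ∉ Icc (0:ℝ) 1 := fun q hq h => hq (Or.inr
    ⟨by have := h.2; rw [← div_eq_inv_mul] at this
        have : 1 ≤ q / N := by linarith
        rwa [one_le_div hN] at this,
      by have := h.1; rw [← div_eq_inv_mul] at this
         have : q / N ≤ 2 := by linarith
         rwa [div_le_iff₀ hN] at this⟩)
  have ba : ∀ {F : ℝ → ℝ} (q : ℝ), (∀ t ∉ Icc (0:ℝ) 1, F t = 0) → (∀ t, |F t| ≤ M) →
      |F (N * q - 1)| ≤ M ∧ |N * q * F (N * q - 1)| ≤ 2 * M ∧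
      |N ^ 2 * q ^ 2 * F (N * q - 1)| ≤ 4 * M := by
    intro F q hF hb
    by_cases ht : N * q - 1 ∈ Icc (0:ℝ) 1
    · have h1 : |N * q| ≤ 2 := abs_le.2 ⟨by linarith [ht.1], by linarith [ht.2]⟩
      have h2 : |(N * q) ^ 2| ≤ 4 := by rw [abs_pow]; nlinarith [abs_nonneg (N * q)]
      refine ⟨hb _, ?_, ?_⟩
      · rw [abs_mul]; exact mul_le_mul h1 (hb _) (abs_nonneg _) (by norm_num)
      · rw [← mul_pow, abs_mul]; exact mul_le_mul h2 (hb _) (abs_nonneg _) (by norm_num)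
    · rw [hF _ ht]; simp [hM]
  have bb : ∀ {F : ℝ → ℝ} (q : ℝ), (∀ t ∉ Icc (0:ℝ) 1, F t = 0) → (∀ t, |F t| ≤ M) →
      |F (2 - N⁻¹ * q)| ≤ M ∧ |N⁻¹ * q * F (2 - N⁻¹ * q)| ≤ 2 * M ∧
      |N⁻¹ ^ 2 * q ^ 2 * F (2 - N⁻¹ * q)| ≤ 4 * M := by
    intro F q hF hb
    by_cases ht : 2 - N⁻¹ * q ∈ Icc (0:ℝ) 1
    · have h1 : |N⁻¹ * q| ≤ 2 := abs_le.2 ⟨by linarith [ht.2], by linarith [ht.1]⟩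
      have h2 : |(N⁻¹ * q) ^ 2| ≤ 4 := by rw [abs_pow]; nlinarith [abs_nonneg (N⁻¹ * q)]
      refine ⟨hb _, ?_, ?_⟩
      · rw [abs_mul]; exact mul_le_mul h1 (hb _) (abs_nonneg _) (by norm_num)
      · rw [← mul_pow, abs_mul]; exact mul_le_mul h2 (hb _) (abs_nonneg _) (by norm_num)
    · rw [hF _ ht]; simp [hM]
  have aS : ∀ t, |S t| ≤ 1 := fun t => abs_le.2 ⟨by linarith [h0 t], h1 t⟩
  have p1 : ∀ {x y X Y : ℝ}, |x| ≤ X → |y| ≤ Y → |x * y| ≤ X * Y := fun {x y X Y} hx hy => by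
    rw [abs_mul]; exact mul_le_mul hx hy (abs_nonneg _) ((abs_nonneg _).trans hx)
  refine ⟨fun q => S (N * q - 1) * S (2 - N⁻¹ * q),
    fun q => N * S₁ (N * q - 1) * S (2 - N⁻¹ * q) - S (N * q - 1) * (N⁻¹ * S₁ (2 - N⁻¹ * q)),
    fun q => N ^ 2 * S₂ (N * q - 1) * S (2 - N⁻¹ * q) - 2 * (S₁ (N * q - 1) * S₁ (2 - N⁻¹ * q)) +
      S (N * q - 1) * (N⁻¹ ^ 2 * S₂ (2 - N⁻¹ * q)), ?_⟩
  have out : ∀ q, q ∉ Icc (1 / N) (2 * N) → N * q - 1 < 0 ∨ 2 - N⁻¹ * q < 0 := by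
    intro q hq
    rw [mem_Icc, not_and_or, not_le, not_le] at hq
    rcases hq with hq | hq
    · rw [lt_div_iff₀ hN] at hq; left; linarith
    · right
      rw [← lt_div_iff₀ hN, div_eq_inv_mul] at hq
      linarith
  refine ⟨⟨by positivity, fun q _ => ?_, ?_, fun q hq => ?_⟩,
    ⟨by positivity, fun q _ => ?_, ?_, fun q hq => ?_⟩, fun q => mul_nonneg (h0 _) (h0 _),
    fun q => mul_le_one₀ (h1 _) (h0 _) (h1 _), fun q hq => ?_, fun q hq => ?_, fun q hq => ?_,
    fun q => ?_, fun q => ?_⟩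
  · exact ((da q hd).mul (db q hd)).congr_deriv (by ring)
  · exact Continuous.continuousOn (by fun_prop)
  · rcases out q hq with h | h <;> simp only [z0 _ h.le] <;> ring
  · refine ((((da q hd').const_mul N).mul (db q hd)).sub
      ((da q hd).mul ((db q hd').const_mul N⁻¹))).congr_deriv ?_
    field_simp
    ring
  · exact Continuous.continuousOn (by fun_prop)
  · rcases out q hq with h | h <;> simp only [z0 _ h.le, d1 _ (fun h' => absurd h'.1 (not_le.2 h))]
      <;> ring
  · have e1 : 1 ≤ N * q - 1 := by have := hq.1; rw [div_le_iff₀ hN] at this; linarith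
    have e2 : 1 ≤ 2 - N⁻¹ * q := by
      have : N⁻¹ * q ≤ N⁻¹ * N := by have := hq.2; gcongr
      rw [inv_mul_cancel₀ hN.ne'] at this; linarith
    simp only [z1 _ e1, z1 _ e2, mul_one]
  · simp only [d1 _ (ma q hq), d1 _ (mb q hq)]; ring
  · simp only [d1 _ (ma q hq), d1 _ (mb q hq), d2 _ (ma q hq), d2 _ (mb q hq)]; ring
  · have k1 := p1 (ba q d1 b1).2.1 (aS (2 - N⁻¹ * q))
    have k2 := p1 (bb q d1 b1).2.1 (aS (N * q - 1))
    have e : q * (N * S₁ (N * q - 1) * S (2 - N⁻¹ * q) - S (N * q - 1) * (N⁻¹ * S₁ (2 - N⁻¹ * q))) =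
      N * q * S₁ (N * q - 1) * S (2 - N⁻¹ * q) - N⁻¹ * q * S₁ (2 - N⁻¹ * q) * S (N * q - 1) := by ring
    rw [e]
    refine (abs_sub _ _).trans ?_
    nlinarith
  · have k1 := p1 (ba q d2 b2).2.2 (aS (2 - N⁻¹ * q))
    have k2 := p1 (bb q d2 b2).2.2 (aS (N * q - 1))
    have k3 := p1 (ba q d1 b1).2.1 (bb q d1 b1).2.1
    have e : q ^ 2 * (N ^ 2 * S₂ (N * q - 1) * S (2 - N⁻¹ * q) -
        2 * (S₁ (N * q - 1) * S₁ (2 - N⁻¹ * q)) + S (N * q - 1) * (N⁻¹ ^ 2 * S₂ (2 - N⁻¹ * q))) =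
      N ^ 2 * q ^ 2 * S₂ (N * q - 1) * S (2 - N⁻¹ * q) +
      N⁻¹ ^ 2 * q ^ 2 * S₂ (2 - N⁻¹ * q) * S (N * q - 1) -
      2 * ((N * q * S₁ (N * q - 1)) * (N⁻¹ * q * S₁ (2 - N⁻¹ * q))) := by
      field_simp; ring
    rw [e]
    rw [abs_le] at k1 k2 k3 ⊢
    constructor <;> nlinarith

end Cutoff

/-- The spherical shell `s ≤ ‖x‖² ≤ 2 s`. -/
def shell (n : ℕ) (s : ℝ) : Set (E n) := nsq ⁻¹' Icc s (2 * s)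

/-- The two shells on which a cutoff function is not constant. -/
def shells (n : ℕ) (N : ℝ) : Set (E n) := shell n (1 / N) ∪ shell n N

lemma mem_shells {N : ℝ} {x : E n} : x ∈ shells n N ↔ nsq x ∈ ann N := by
  simp only [shells, shell, ann, mem_union, mem_preimage, mul_one_div]

lemma isClosed_nsq_preimage (a b : ℝ) : IsClosed ((nsq : E n → ℝ) ⁻¹' Icc a b) :=
  isClosed_Icc.preimage (contDiff_nsq (m := 0)).continuous

lemma isCompact_nsq_preimage (a b : ℝ) : IsCompact ((nsq : E n → ℝ) ⁻¹' Icc a b) :=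
  (isCompact_closedBall (0 : E n) (Real.sqrt b)).of_isClosed_subset (isClosed_nsq_preimage a b)
    fun x hx => by
      rw [mem_closedBall_zero_iff]
      exact Real.le_sqrt_of_sq_le hx.2

lemma nsq_preimage_sub {a b : ℝ} (ha : 0 < a) : (nsq : E n → ℝ) ⁻¹' Icc a b ⊆ {0}ᶜ := by
  intro x hx h0
  rw [mem_singleton_iff] at h0
  have := hx.1
  rw [h0] at this
  simp [nsq] at this
  linarith

lemma isCompact_shells (N : ℝ) : IsCompact (shells n N) :=
  (isCompact_nsq_preimage _ _).union (isCompact_nsq_preimage _ _)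

lemma shells_sub {N : ℝ} (hN : 0 < N) : shells n N ⊆ {0}ᶜ :=
  union_subset (nsq_preimage_sub (by positivity)) (nsq_preimage_sub hN)

lemma exists_shell_volume (n : ℕ) : ∃ v, 0 ≤ v ∧ ∀ s, 0 < s →
    volume.real (shell n s) ≤ v * s ^ ((n:ℝ) / 2) := by
  refine ⟨(2:ℝ) ^ ((n:ℝ) / 2) * volume.real (Metric.ball (0 : E n) 1), by positivity,
    fun s hs => ?_⟩
  have h1 : shell n s ⊆ Metric.closedBall 0 (Real.sqrt (2 * s)) := fun x hx => by
    rw [mem_closedBall_zero_iff]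
    exact Real.le_sqrt_of_sq_le hx.2
  have h2 := measureReal_mono (μ := volume) h1 measure_closedBall_lt_top.ne
  refine h2.trans_eq ?_
  rw [measureReal_def, Measure.addHaar_closedBall _ _ (Real.sqrt_nonneg _), ENNReal.toReal_mul,
    ENNReal.toReal_ofReal (by positivity), finrank_euclideanSpace_fin, ← measureReal_def,
    Real.sqrt_eq_rpow, ← Real.rpow_natCast, ← Real.rpow_mul (by positivity),
    Real.mul_rpow (by norm_num) hs.le]
  rw [show (1:ℝ) / 2 * n = n / 2 by ring]
  ring

lemma setIntegral_union_le {A B : Set (E n)} {g : E n → ℝ} (hA : IntegrableOn g A)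
    (hB : IntegrableOn g B) (h0 : ∀ x, 0 ≤ g x) :
    ∫ x in A ∪ B, g x ≤ (∫ x in A, g x) + ∫ x in B, g x := by
  rw [← integral_add_measure hA hB]
  exact integral_mono_measure (Measure.restrict_union_le _ _) (ae_of_all _ h0)
    (Integrable.add_measure hA hB)

/-- Functions of the critical decay have uniformly bounded integrals over shells. -/
lemma exists_shells_bound (n : ℕ) (M : ℝ) : ∃ c, ∀ g : E n → ℝ, (∀ x, 0 ≤ g x) →
    ContinuousOn g {0}ᶜ → (∀ x, x ≠ 0 → g x ≤ M * nsq x ^ (-((n:ℝ) / 2))) → ∀ N, 0 < N →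
    ∫ x in shells n N, g x ≤ c := by
  obtain ⟨v, hv, H⟩ := exists_shell_volume n
  refine ⟨2 * (|M| * v), fun g h0 hc hg N hN => ?_⟩
  have key : ∀ s, 0 < s → ∫ x in shell n s, g x ≤ |M| * v := by
    intro s hs
    have h1 : ∀ x ∈ shell n s, ‖g x‖ ≤ |M| * s ^ (-((n:ℝ) / 2)) := fun x hx => by
      have hx0 : x ≠ 0 := nsq_preimage_sub hs hx
      rw [Real.norm_of_nonneg (h0 x)]
      refine (hg x hx0).trans ?_
      refine mul_le_mul (le_abs_self M) ?_ (Real.rpow_nonneg (nsq_nonneg x) _) (abs_nonneg M)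
      exact Real.rpow_le_rpow_of_nonpos hs hx.1 (by simp; positivity)
    have h2 := norm_setIntegral_le_of_norm_le_const (μ := volume)
      (isCompact_nsq_preimage s (2 * s)).measure_lt_top h1
    refine (le_abs_self _).trans (h2.trans ?_)
    calc |M| * s ^ (-((n:ℝ) / 2)) * volume.real (shell n s)
        ≤ |M| * s ^ (-((n:ℝ) / 2)) * (v * s ^ ((n:ℝ) / 2)) :=
          mul_le_mul_of_nonneg_left (H s hs) (by positivity)
      _ = |M| * v * (s ^ (-((n:ℝ) / 2)) * s ^ ((n:ℝ) / 2)) := by ring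
      _ = |M| * v := by rw [← Real.rpow_add hs, neg_add_cancel, Real.rpow_zero, mul_one]
  have hi : ∀ s, 0 < s → IntegrableOn g (shell n s) := fun s hs =>
    (hc.mono (nsq_preimage_sub hs)).integrableOn_compact (isCompact_nsq_preimage _ _)
  have := setIntegral_union_le (hi (1 / N) (by positivity)) (hi N hN) h0
  have k1 := key (1 / N) (by positivity)
  have k2 := key N hN
  rw [shells]
  linarith

lemma CC.setIntegral_le {F X g : E n → ℝ} {N : ℝ} (hN : 0 < N) (hF : CC {0}ᶜ F) (hX : CC {0}ᶜ X)
    (hg : ContinuousOn g {0}ᶜ) (h : ∀ x, x ≠ 0 → F x ≤ (shells n N).indicator g x + X x) :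
    ∫ x in ({0}ᶜ : Set (E n)), F x ≤
      (∫ x in shells n N, g x) + ∫ x in ({0}ᶜ : Set (E n)), X x := by
  have hm : MeasurableSet (shells n N) := (isCompact_shells N).isClosed.measurableSet
  have hi : Integrable ((shells n N).indicator g) :=
    (integrable_indicator_iff hm).2 ((hg.mono (shells_sub hN)).integrableOn_compact
      (isCompact_shells N))
  have h1 : ∫ x in shells n N, g x = ∫ x in ({0}ᶜ : Set (E n)), (shells n N).indicator g x := by
    rw [setIntegral_indicator hm, inter_eq_right.2 (shells_sub hN)]
  rw [h1, ← integral_add hi.integrableOn hX.integrableOn]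
  exact setIntegral_mono_on hF.integrableOn (hi.integrableOn.add hX.integrableOn)
    isOpen_compl_singleton.measurableSet fun x hx => h x hx

lemma aecover_shells : AECover (volume.restrict ({0}ᶜ : Set (E n))) atTop
    (fun k : ℕ => (nsq : E n → ℝ) ⁻¹' Icc (2 / ((k:ℝ) + 1)) (k + 1)) where
  ae_eventually_mem := by
    filter_upwards [ae_restrict_mem isOpen_compl_singleton.measurableSet] with x hx
    have h1 : Tendsto (fun k : ℕ => (k:ℝ) + 1) atTop atTop :=
      tendsto_atTop_add_const_right _ _ tendsto_natCast_atTop_atTop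
    filter_upwards [h1.eventually_ge_atTop (nsq x),
      (h1.const_div_atTop 2).eventually_le_const (nsq_pos hx)] with k hk hk'
    exact ⟨hk', hk⟩
  measurableSet k := (isClosed_nsq_preimage _ _).measurableSet

section Sequences
variable {g : E n → ℝ} {c : ℝ} {Z Z₁ Z₂ : ℕ → ℝ → ℝ}

lemma integrableOn_of_cut (hZ : ∀ k : ℕ, Cut c (k + 1) (Z k) (Z₁ k) (Z₂ k)) (h0 : ∀ x, 0 ≤ g x)
    (hc : ContinuousOn g {0}ᶜ) {B : ℝ}
    (hB : ∀ᶠ k in atTop, ∫ x in ({0}ᶜ : Set (E n)), g x * Z k (nsq x) ≤ B) :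
    IntegrableOn g {0}ᶜ ∧ ∫ x in ({0}ᶜ : Set (E n)), g x ≤ B := by
  have hm : ∀ k : ℕ, MeasurableSet ((nsq : E n → ℝ) ⁻¹' Icc (2 / ((k:ℝ) + 1)) (k + 1)) :=
    fun k => (isClosed_nsq_preimage _ _).measurableSet
  have hi : ∀ k : ℕ, IntegrableOn g ((nsq : E n → ℝ) ⁻¹' Icc (2 / ((k:ℝ) + 1)) (k + 1)) :=
    fun k => (hc.mono (nsq_preimage_sub (by positivity))).integrableOn_compact
      (isCompact_nsq_preimage _ _)
  have hi' := fun k : ℕ => (hi k).mono_measure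
    (Measure.restrict_le_self (μ := volume) (s := ({0}ᶜ : Set (E n))))
  have hb : ∀ᶠ k : ℕ in atTop, ∫ x in (nsq : E n → ℝ) ⁻¹' Icc (2 / ((k:ℝ) + 1)) (k + 1),
      g x ∂(volume.restrict {0}ᶜ) ≤ B := by
    filter_upwards [hB] with k hk
    refine le_trans ?_ hk
    rw [← integral_indicator (hm k)]
    refine setIntegral_mono_on ((integrable_indicator_iff (hm k)).2 (hi k)).integrableOn
      ((hZ k).rad.test.cc.mul_left isOpen_compl_singleton hc).integrableOn
      isOpen_compl_singleton.measurableSet fun x _ => ?_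
    by_cases hx : x ∈ (nsq : E n → ℝ) ⁻¹' Icc (2 / ((k:ℝ) + 1)) (k + 1)
    · rw [indicator_of_mem hx, (hZ k).one _ hx, mul_one]
    · rw [indicator_of_notMem hx]
      exact mul_nonneg (h0 x) ((hZ k).nonneg _)
  have h1 : IntegrableOn g {0}ᶜ := aecover_shells.integrable_of_integral_bounded_of_nonneg_ae B
    hi' (ae_of_all _ h0) hb
  exact ⟨h1, le_of_tendsto (aecover_shells.integral_tendsto_of_countably_generated h1) hb⟩

lemma eq_zero_of_cut (hZ : ∀ k : ℕ, Cut c (k + 1) (Z k) (Z₁ k) (Z₂ k)) (h0 : ∀ x, 0 ≤ g x)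
    (hc : ContinuousOn g {0}ᶜ)
    (hB : ∀ ε > 0, ∀ᶠ k in atTop, ∫ x in ({0}ᶜ : Set (E n)), g x * Z k (nsq x) ≤ ε) {x : E n}
    (hx : x ≠ 0) : g x = 0 := by
  have h1 := (integrableOn_of_cut hZ h0 hc (hB 1 one_pos)).1
  have h2 : ∫ x in ({0}ᶜ : Set (E n)), g x = 0 :=
    le_antisymm (le_of_forall_pos_le_add fun ε hε => by
      rw [zero_add]; exact (integrableOn_of_cut hZ h0 hc (hB ε hε)).2)
      (integral_nonneg h0)
  have h3 := (integral_eq_zero_iff_of_nonneg h0 h1).1 h2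
  exact Measure.eqOn_open_of_ae_eq h3 isOpen_compl_singleton hc continuousOn_const hx

lemma tendsto_shells (hi : IntegrableOn g {0}ᶜ) :
    Tendsto (fun k : ℕ => ∫ x in shells n (k + 1), g x) atTop (𝓝 0) := by
  have hm : ∀ k : ℕ, MeasurableSet (shells n (k + 1)) :=
    fun k => (isCompact_shells _).isClosed.measurableSet
  have e : ∀ k : ℕ, ∫ x in shells n (k + 1), g x =
      ∫ x in ({0}ᶜ : Set (E n)), (shells n (k + 1)).indicator g x := fun k => by
    rw [setIntegral_indicator (hm k), inter_eq_right.2 (shells_sub (by positivity))]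
  simp only [e]
  rw [← integral_zero (E n) ℝ (μ := volume.restrict ({0}ᶜ : Set (E n)))]
  refine tendsto_integral_of_dominated_convergence (fun x => ‖g x‖)
    (fun k => hi.aestronglyMeasurable.indicator (hm k)) hi.norm
    (fun k => ae_of_all _ fun x => norm_indicator_le_norm_self _ _) ?_
  filter_upwards [ae_restrict_mem isOpen_compl_singleton.measurableSet] with x hx
  have h1 : Tendsto (fun k : ℕ => (k:ℝ) + 1) atTop atTop :=
    tendsto_atTop_add_const_right _ _ tendsto_natCast_atTop_atTop
  refine tendsto_const_nhds.congr' ?_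
  filter_upwards [h1.eventually_gt_atTop (nsq x),
    (h1.const_div_atTop 2).eventually_lt_const (nsq_pos hx)] with k hk hk'
  rw [indicator_of_notMem]
  rw [mem_shells, ann]
  rintro (h | h)
  · linarith [h.2]
  · linarith [h.1]

end Sequences

section Algebra
variable {q m z z₁ z₂ u H X s c K L ε : ℝ}

lemma young_aux (hq : 0 < q) (hX : X ^ 2 ≤ q * u) (hε : 0 < ε) :
    2 * (|X| / q) ≤ 1 / ε * u + ε / q := by
  have h1 : 2 * (|X| * ε) ≤ q * u + ε ^ 2 := by
    nlinarith [sq_nonneg (|X| - ε), sq_abs X]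
  have h2 : 2 * (|X| / q) = 2 * (|X| * ε) / (q * ε) := by field_simp
  have h3 : 1 / ε * u + ε / q = (q * u + ε ^ 2) / (q * ε) := by field_simp
  rw [h2, h3]
  gcongr

lemma energy_flux_le {N : ℝ} (hN : 0 ≤ N) (hq : 0 < q) (hm : 0 ≤ m) (hu : 0 ≤ u) (hz : 0 ≤ z) (hs : s ≤ 0)
    (hX : X ^ 2 ≤ q * u) (hXL : |X| ≤ L) (hH : |H| ≤ K / q) (h1 : |q * z₁| ≤ c)
    (h2 : |q ^ 2 * z₂| ≤ c) (hε : 0 < ε) (hid : 2 * N * s + 4 * s * (s - 1) = 4 * s) :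
    1 / 2 * u * (2 * N * (s * m * z + q * m * z₁) +
      4 * q * ((s * ((s - 1) * (m / q)) * z + s * m * z₁) + (s * m * z₁ + q * m * z₂))) +
      H * (2 * (s * m * z + q * m * z₁) * X) ≤
    c * ((N - 4 * s + 2 + K) * ((1 + 1 / ε) * (m * u) + ε * (m / q))) +
      2 * L * (-s * (m * |H|) * z) := by
  have hc : 0 ≤ c := (abs_nonneg _).trans h1
  have hK : 0 ≤ K := by
    have := (abs_nonneg _).trans hH
    rwa [le_div_iff₀ hq, zero_mul] at this
  have hi : 0 < 1 / ε := by positivity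
  have e : 1 / 2 * u * (2 * N * (s * m * z + q * m * z₁) +
      4 * q * ((s * ((s - 1) * (m / q)) * z + s * m * z₁) + (s * m * z₁ + q * m * z₂))) +
      H * (2 * (s * m * z + q * m * z₁) * X) = 2 * s * (m * z * u) + (N + 4 * s) * (m * u) * (q * z₁)
        + 2 * (m * u) * (q ^ 2 * z₂) + 2 * s * (m * z) * (H * X) + 2 * m * (H * X) * (q * z₁) := by
    have : 1 / 2 * u * (2 * N * (s * m * z + q * m * z₁) +
      4 * q * ((s * ((s - 1) * (m / q)) * z + s * m * z₁) + (s * m * z₁ + q * m * z₂))) +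
      H * (2 * (s * m * z + q * m * z₁) * X) = 1 / 2 * (2 * N * s + 4 * s * (s - 1)) * (m * z * u) +
        (N + 4 * s) * (m * u) * (q * z₁)
        + 2 * (m * u) * (q ^ 2 * z₂) + 2 * s * (m * z) * (H * X) + 2 * m * (H * X) * (q * z₁) := by
      field_simp
      ring
    rw [this, hid]; ring
  rw [e]
  have t1 : 2 * s * (m * z * u) ≤ 0 := mul_nonpos_of_nonpos_of_nonneg (by linarith) (by positivity)
  have t2 : (N + 4 * s) * (m * u) * (q * z₁) ≤ (N - 4 * s) * (m * u) * c := by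
    refine (le_abs_self _).trans ?_
    rw [abs_mul, abs_mul, abs_of_nonneg (mul_nonneg hm hu)]
    gcongr
    · have : 0 ≤ N - 4 * s := by linarith
      positivity
    · rw [abs_le]; constructor <;> linarith
  have t3 : 2 * (m * u) * (q ^ 2 * z₂) ≤ 2 * (m * u) * c := by
    refine mul_le_mul_of_nonneg_left ((le_abs_self _).trans h2) (by positivity)
  have t4 : 2 * s * (m * z) * (H * X) ≤ 2 * L * (-s * (m * |H|) * z) := by
    have a1 : -(H * X) ≤ |H| * L := by
      refine (neg_le_abs _).trans ?_
      rw [abs_mul]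
      gcongr
    have a2 : 0 ≤ 2 * (-s) * (m * z) := by
      have : 0 ≤ -s := by linarith
      positivity
    calc _ = 2 * (-s) * (m * z) * (-(H * X)) := by ring
      _ ≤ 2 * (-s) * (m * z) * (|H| * L) := mul_le_mul_of_nonneg_left a1 a2
      _ = _ := by ring
  have t5 : 2 * m * (H * X) * (q * z₁) ≤ c * (K * (1 / ε * (m * u) + ε * (m / q))) := by
    have a1 : |H * X| ≤ K * (|X| / q) := by
      rw [abs_mul]
      calc _ ≤ K / q * |X| := by gcongr
        _ = _ := by ring
    have a2 := young_aux hq hX hε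
    calc _ ≤ |2 * m * (H * X) * (q * z₁)| := le_abs_self _
      _ = 2 * m * |H * X| * |q * z₁| := by
        rw [abs_mul, abs_mul, abs_of_nonneg (by positivity : 0 ≤ 2 * m)]
      _ ≤ 2 * m * (K * (|X| / q)) * c := by gcongr
      _ = c * (K * (m * (2 * (|X| / q)))) := by ring
      _ ≤ c * (K * (m * (1 / ε * u + ε / q))) := by gcongr
      _ = _ := by ring
  have e2 : c * ((N - 4 * s + 2 + K) * ((1 + 1 / ε) * (m * u) + ε * (m / q))) =
      (N - 4 * s) * (m * u) * c + 2 * (m * u) * c + c * (K * (1 / ε * (m * u) + ε * (m / q))) +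
      (c * (N - 4 * s + 2) * (1 / ε * (m * u) + ε * (m / q)) + c * K * (m * u)) := by ring
  have t6 : 0 ≤ c * (N - 4 * s + 2) * (1 / ε * (m * u) + ε * (m / q)) + c * K * (m * u) := by
    have : 0 ≤ N - 4 * s + 2 := by linarith
    positivity
  linarith

lemma hardy_le {G S : ℝ} (hq : 0 < q) (hm : 0 ≤ m) (hu : 0 ≤ u) (hz : 0 ≤ z)
    (hS : S ^ 2 ≤ u * (q * G)) (hG : 0 ≤ G) (h1 : |q * z₁| ≤ c) :
    m * u * z ≤ c * (2 * (m * u)) + (u * (2 * (m * z) + 2 * (q * (m * z₁))) + 2 * S * (m * z) +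
      G * (q * m * z)) := by
  have a1 : 0 ≤ u + 2 * S + q * G := by
    have : 0 ≤ q * G := by positivity
    have h4 : |2 * S| ≤ |u + q * G| := by
      rw [← sq_le_sq]; nlinarith [sq_nonneg (u - q * G)]
    rw [abs_of_nonneg (by positivity : 0 ≤ u + q * G)] at h4
    linarith [neg_abs_le (2 * S)]
  have a2 : -(c * (2 * (m * u))) ≤ 2 * (m * u) * (q * z₁) := by
    have := mul_le_mul_of_nonneg_left ((neg_le_abs _).trans h1) (by positivity : 0 ≤ 2 * (m * u))
    linarith
  have a3 := mul_nonneg (mul_nonneg hm hz) a1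
  linarith

lemma momentum_le (hq : 0 < q) (hm : 0 ≤ m) (hu : 0 ≤ u) (hz : 0 ≤ z) (hs : s ≤ 1)
    (hX : X ^ 2 ≤ q * u) (hH : H ≤ 0) (h1 : |q * z₁| ≤ c) :
    m * |H| * z ≤ c * (2 * (m * u) + m * |H|) +
      (-(1 / 2)) * (u * (m * z) + 2 * ((s - 1) * (m / q) * z + m * z₁) * X ^ 2 +
        (H - 1 / 2 * u) * (2 * (m * z) + 2 * (q * (m * z₁)))) := by
  rw [abs_of_nonpos hH]
  have a1 : 0 ≤ (1 - s) * (m / q) * z * X ^ 2 := by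
    have : 0 ≤ 1 - s := by linarith
    positivity
  have a2 : m * z₁ * X ^ 2 ≤ c * (m * u) := by
    have : m * z₁ * X ^ 2 = (q * z₁) * (m * (X ^ 2 / q)) := by field_simp
    rw [this]
    have h3 : X ^ 2 / q ≤ u := by rw [div_le_iff₀ hq]; linarith
    calc _ ≤ c * (m * (X ^ 2 / q)) :=
          mul_le_mul_of_nonneg_right ((le_abs_self _).trans h1) (by positivity)
      _ ≤ _ := by have : 0 ≤ c := (abs_nonneg _).trans h1
                  gcongr
  have a3 : m * H * (q * z₁) ≤ c * (m * (-H)) := by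
    have := mul_le_mul_of_nonneg_left ((neg_le_abs _).trans h1) (mul_nonneg hm (neg_nonneg.2 hH))
    linarith
  have a4 : -(1 / 2 * (m * u) * (q * z₁)) ≤ c * (m * u) := by
    have := mul_le_mul_of_nonneg_left ((neg_le_abs _).trans h1) (mul_nonneg hm hu)
    have h5 : 0 ≤ c * (m * u) := mul_nonneg ((abs_nonneg _).trans h1) (by positivity)
    linarith
  have e : (-(1 / 2)) * (u * (m * z) + 2 * ((s - 1) * (m / q) * z + m * z₁) * X ^ 2 +
        (H - 1 / 2 * u) * (2 * (m * z) + 2 * (q * (m * z₁)))) =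
      (1 - s) * (m / q) * z * X ^ 2 - m * z₁ * X ^ 2 - m * z * H - m * H * (q * z₁) +
        1 / 2 * (m * u) * (q * z₁) := by ring
  rw [e]
  linarith

end Algebra

section Bounds
variable {K : ℝ} {U : Fin n → E n → ℝ} {P : E n → ℝ} {x : E n}

lemma Sol'.usq_le (h : Sol' K U P) (hx : x ≠ 0) : usq U x ≤ n * K ^ 2 / nsq x := by
  have hx0 := norm_pos_iff.2 hx
  calc usq U x ≤ ∑ _j : Fin n, K ^ 2 / nsq x := by
        refine Finset.sum_le_sum fun j _ => ?_
        have := pow_le_pow_left₀ (abs_nonneg _) (h.boundU j x hx) 2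
        rwa [sq_abs, div_pow] at this
    _ = _ := by simp; ring

lemma Sol'.abs_hd_le (h : Sol' K U P) (hx : x ≠ 0) :
    |hd U P x| ≤ (n * K ^ 2 + K) / nsq x := by
  have h1 := h.usq_le hx
  have h2 := h.boundP x hx
  have h3 := usq_nonneg U x
  rw [add_div, hd]
  refine (abs_add_le _ _).trans ?_
  rw [abs_of_nonneg (by positivity)]
  rw [← nsq] at h2
  linarith

lemma Sol'.abs_xu_le (h : Sol' K U P) (hx : x ≠ 0) : |xu U x| ≤ n * K := by
  have hx0 := norm_pos_iff.2 hx
  calc |xu U x| ≤ ∑ i, |x i * U i x| := Finset.abs_sum_le_sum_abs _ _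
    _ ≤ ∑ _i : Fin n, K := by
        refine Finset.sum_le_sum fun i _ => ?_
        rw [abs_mul]
        calc _ ≤ ‖x‖ * (K / ‖x‖) := mul_le_mul (abs_coord_le x i) (h.boundU i x hx)
              (abs_nonneg _) (norm_nonneg _)
          _ = K := by field_simp
    _ = _ := by simp

lemma xu_sq_le (U : Fin n → E n → ℝ) (x : E n) : xu U x ^ 2 ≤ nsq x * usq U x := by
  rw [nsq_eq]
  exact Finset.sum_mul_sq_le_sq_mul_sq _ _ _

lemma radial_deriv_sq_le (U : Fin n → E n → ℝ) (x : E n) :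
    (∑ j, U j x * ∑ i, x i * pd i (U j) x) ^ 2 ≤ usq U x * (nsq x * gsq U x) := by
  refine (Finset.sum_mul_sq_le_sq_mul_sq _ _ _).trans ?_
  refine mul_le_mul_of_nonneg_left ?_ (usq_nonneg U x)
  rw [gsq, Finset.mul_sum]
  refine Finset.sum_le_sum fun j _ => ?_
  rw [nsq_eq]
  exact Finset.sum_mul_sq_le_sq_mul_sq _ _ _

lemma continuous_nsq : Continuous (nsq : E n → ℝ) := (contDiff_nsq (m := 0)).continuous

lemma continuousOn_nsq_rpow (r : ℝ) : ContinuousOn (fun x : E n => nsq x ^ r) {0}ᶜ :=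
  continuous_nsq.continuousOn.rpow_const fun _ hx => Or.inl (nsq_pos hx).ne'

end Bounds

/-- The exponent `(4 - n) / 2`. -/
noncomputable def expo (n : ℕ) : ℝ := -(((n:ℝ) - 4) / 2)

/-- The weighted kinetic energy density `|x|^(2 - n) |U|²`. -/
noncomputable def eden (U : Fin n → E n → ℝ) (x : E n) : ℝ := nsq x ^ (expo n - 1) * usq U x

/-- The weighted head pressure, which vanishes in dimension four. -/
noncomputable def hden (U : Fin n → E n → ℝ) (P : E n → ℝ) (x : E n) : ℝ :=
  -expo n * (nsq x ^ (expo n - 1) * |hd U P x|)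

section Densities
variable {U : Fin n → E n → ℝ} {P : E n → ℝ}

lemma expo_nonpos (hn : 4 ≤ n) : expo n ≤ 0 := by
  have : (4:ℝ) ≤ n := by exact_mod_cast hn
  unfold expo; linarith

lemma wt_nonneg (r : ℝ) (x : E n) : 0 ≤ nsq x ^ r := Real.rpow_nonneg (nsq_nonneg x) _

lemma eden_nonneg (U : Fin n → E n → ℝ) (x : E n) : 0 ≤ eden U x :=
  mul_nonneg (wt_nonneg _ x) (usq_nonneg U x)

lemma hden_nonneg (hn : 4 ≤ n) (U : Fin n → E n → ℝ) (P : E n → ℝ) (x : E n) : 0 ≤ hden U P x :=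
  mul_nonneg (neg_nonneg.2 (expo_nonpos hn)) (mul_nonneg (wt_nonneg _ x) (abs_nonneg _))

lemma continuousOn_eden (hU : ∀ j, ContDiffOn ℝ 1 (U j) {0}ᶜ) : ContinuousOn (eden U) {0}ᶜ :=
  (continuousOn_nsq_rpow _).mul (contDiffOn_usq hU).continuousOn

lemma continuousOn_hden (hU : ∀ j, ContDiffOn ℝ 1 (U j) {0}ᶜ) (hP : ContDiffOn ℝ 1 P {0}ᶜ) :
    ContinuousOn (hden U P) {0}ᶜ :=
  continuousOn_const.mul ((continuousOn_nsq_rpow _).mul (contDiffOn_hd hU hP).continuousOn.abs)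

lemma wt_div {x : E n} (hx : x ≠ 0) (r : ℝ) : nsq x ^ (r - 1) = nsq x ^ r / nsq x :=
  Real.rpow_sub_one (nsq_pos hx).ne' r

lemma wt_mul {x : E n} (hx : x ≠ 0) (r : ℝ) : nsq x ^ r = nsq x * nsq x ^ (r - 1) := by
  rw [wt_div hx, mul_div_cancel₀ _ (nsq_pos hx).ne']

lemma wt_crit (x : E n) : nsq x ^ (expo n - 1 - 1) = nsq x ^ (-((n:ℝ) / 2)) := by
  congr 1; unfold expo; ring

variable {K c N : ℝ} {Z Z₁ Z₂ : ℝ → ℝ}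

lemma Sol'.eden_le (h : Sol' K U P) {x : E n} (hx : x ≠ 0) :
    eden U x ≤ n * K ^ 2 * nsq x ^ (-((n:ℝ) / 2)) := by
  rw [← wt_crit, wt_div hx, eden]
  have := mul_le_mul_of_nonneg_left (h.usq_le hx) (wt_nonneg (expo n - 1) x)
  refine this.trans_eq ?_
  ring

lemma Sol'.hden_le (hn : 4 ≤ n) (h : Sol' K U P) {x : E n} (hx : x ≠ 0) :
    hden U P x ≤ -expo n * (n * K ^ 2 + K) * nsq x ^ (-((n:ℝ) / 2)) := by
  rw [← wt_crit, wt_div hx, hden]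
  have := mul_le_mul_of_nonneg_left (h.abs_hd_le hx) (wt_nonneg (expo n - 1) x)
  have := mul_le_mul_of_nonneg_left this (neg_nonneg.2 (expo_nonpos hn))
  refine this.trans_eq ?_
  ring

lemma Cut.cc (hZ : Cut c N Z Z₁ Z₂) {g : E n → ℝ} (hg : ContinuousOn g {0}ᶜ) :
    CC {0}ᶜ (fun x => g x * Z (nsq x)) :=
  hZ.rad.test.cc.mul_left isOpen_compl_singleton hg

lemma Cut.eq_zero (hZ : Cut c N Z Z₁ Z₂) {x : E n} (hx : x ∉ shells n N) :
    Z₁ (nsq x) = 0 ∧ Z₂ (nsq x) = 0 :=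
  ⟨hZ.zero₁ _ fun h => hx (mem_shells.2 h), hZ.zero₂ _ fun h => hx (mem_shells.2 h)⟩

/-- An alternative on membership in the shells, in the form used for pointwise estimates. -/
lemma le_indicator_add {A : Set (E n)} {g : E n → ℝ} {x : E n} {F X : ℝ} (h1 : x ∈ A → F ≤ g x + X)
    (h2 : x ∉ A → F ≤ X) : F ≤ A.indicator g x + X := by
  by_cases hx : x ∈ A
  · rw [indicator_of_mem hx]; exact h1 hx
  · rw [indicator_of_notMem hx, zero_add]; exact h2 hx

lemma cc_lap {Ω : Set (E n)} {φ : E n → ℝ} (hφ : ContDiff ℝ 2 φ) (hc : HasCompactSupport φ)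
    (hs : tsupport φ ⊆ Ω) : CC Ω (lap φ) :=
  CC.sum fun i _ => Test.pd_cc (f := pd i φ) (i := i) ⟨contDiff_pd hφ one_add_one_eq_two.le,
    hc.mono' ((subset_tsupport _).trans (tsupport_pd φ)), (tsupport_pd φ).trans hs⟩

set_option maxHeartbeats 1000000 in
lemma Sol'.energy_cut (hn : 4 ≤ n) (h : Sol' K U P) (hN : 0 < N) (hZ : Cut c N Z Z₁ Z₂) {ε : ℝ}
    (hε : 0 < ε) :
    ∫ x in ({0}ᶜ : Set (E n)), gsq U x * (nsq x ^ expo n * Z (nsq x)) ≤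
      (∫ x in shells n N, c * ((n - 4 * expo n + 2 + (n * K ^ 2 + K)) *
        ((1 + 1 / ε) * eden U x + ε * nsq x ^ (-((n:ℝ) / 2))))) +
      ∫ x in ({0}ᶜ : Set (E n)), 2 * (n * K) * (hden U P x * Z (nsq x)) := by
  have hΩ : IsOpen ({0}ᶜ : Set (E n)) := isOpen_compl_singleton
  have r := hZ.rad.rpow_mul (expo n)
  have r' := hZ.rad.rpow_mul' hZ.rad' (expo n)
  rw [h.energy hΩ (φ := fun x => nsq x ^ expo n * Z (nsq x)) (r.smooth r') r.test.compact r.test.sub]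
  have cH := (contDiffOn_hd h.regU h.regP).continuousOn
  have c1 : CC {0}ᶜ (fun x : E n => 1 / 2 * usq U x * lap (fun x => nsq x ^ expo n * Z (nsq x)) x) := by
    have := cc_lap (r.smooth r' (n := n)) r.test.compact r.test.sub
    exact this.mul_left hΩ (continuousOn_const.mul (contDiffOn_usq h.regU).continuousOn)
  have c2 : CC {0}ᶜ (fun x : E n => hd U P x * adv U (fun x => nsq x ^ expo n * Z (nsq x)) x) :=
    (r.test.adv_cc hΩ h.regU).mul_left hΩ cH
  refine CC.setIntegral_le hN (c1.add c2)
    ((hZ.cc (continuousOn_hden h.regU h.regP)).const_mul _) ?_ fun x hx => ?_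
  · exact continuousOn_const.mul (continuousOn_const.mul
      ((continuousOn_const.mul (continuousOn_eden h.regU)).add
        (continuousOn_const.mul (continuousOn_nsq_rpow _))))
  · have hq := nsq_pos hx
    have key := fun (c : ℝ) (h1 : |nsq x * Z₁ (nsq x)| ≤ c) (h2 : |nsq x ^ 2 * Z₂ (nsq x)| ≤ c) =>
      energy_flux_le (N := (n:ℝ)) (by positivity) hq (wt_nonneg (expo n - 1) x) (usq_nonneg U x)
        (hZ.nonneg (nsq x)) (expo_nonpos hn) (xu_sq_le U x) (h.abs_xu_le hx) (h.abs_hd_le hx)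
        h1 h2 hε (by unfold expo; ring)
    rw [r.lap_eq r' hx, r.adv_eq U hx, wt_div hx (expo n - 1), wt_mul hx (expo n)]
    refine le_indicator_add (fun _ => ?_) fun hA => ?_
    · rw [← wt_crit, wt_div hx (expo n - 1)]
      exact key c (hZ.le₁ _) (hZ.le₂ _)
    obtain ⟨z1, z2⟩ := hZ.eq_zero hA
    refine (key 0 (by simp [z1]) (by simp [z2])).trans_eq ?_
    rw [zero_mul, zero_add]
    rfl

end Densities

section Cuts
variable {U : Fin n → E n → ℝ} {P : E n → ℝ} {K c N : ℝ} {Z Z₁ Z₂ : ℝ → ℝ}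

lemma trace_aux {q m z z₁ : ℝ} (hq : 0 < q) :
    (n:ℝ) * (m * z) + 2 * (q * ((expo n - 1) * (m / q) * z + m * z₁)) =
      2 * (m * z) + 2 * (q * (m * z₁)) := by
  have : q * ((expo n - 1) * (m / q) * z + m * z₁) = (expo n - 1) * (m * z) + q * (m * z₁) := by
    field_simp
  rw [this]
  unfold expo
  ring

set_option maxHeartbeats 1000000 in
lemma Sol'.hardy_cut (h : Sol' K U P) (hN : 0 < N) (hZ : Cut c N Z Z₁ Z₂) :
    ∫ x in ({0}ᶜ : Set (E n)), eden U x * Z (nsq x) ≤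
      (∫ x in shells n N, c * (2 * eden U x)) +
      ∫ x in ({0}ᶜ : Set (E n)), gsq U x * (nsq x ^ expo n * Z (nsq x)) := by
  have hΩ : IsOpen ({0}ᶜ : Set (E n)) := isOpen_compl_singleton
  have r := hZ.rad.rpow_mul (expo n - 1)
  have cu := (contDiffOn_usq h.regU)
  have I := r.div_identity cu
  have c1 : CC {0}ᶜ (fun x : E n => usq U x * (n * (nsq x ^ (expo n - 1) * Z (nsq x)) + 2 * (nsq x *
      ((expo n - 1) * nsq x ^ (expo n - 1 - 1) * Z (nsq x) + nsq x ^ (expo n - 1) * Z₁ (nsq x))))) :=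
    ((r.test.cc.const_mul _).add (r.cc_deriv.const_mul _)).mul_left hΩ cu.continuousOn
  have c2 : CC {0}ᶜ (fun x : E n => (∑ i, x i * pd i (usq U) x) *
      (nsq x ^ (expo n - 1) * Z (nsq x))) :=
    r.test.cc.mul_left hΩ (continuousOn_finsetSum _ fun i _ =>
      (contDiff_coord (m := 0) i).continuous.continuousOn.mul (continuousOn_pd hΩ cu))
  have c3 : CC {0}ᶜ (fun x : E n => gsq U x * (nsq x ^ expo n * Z (nsq x))) :=
    (hZ.rad.rpow_mul (expo n)).test.cc.mul_left hΩ (continuousOn_gsq hΩ h.regU)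
  have hX : ∫ x in ({0}ᶜ : Set (E n)), gsq U x * (nsq x ^ expo n * Z (nsq x)) =
      ∫ x in ({0}ᶜ : Set (E n)), (usq U x * (n * (nsq x ^ (expo n - 1) * Z (nsq x)) + 2 * (nsq x *
      ((expo n - 1) * nsq x ^ (expo n - 1 - 1) * Z (nsq x) + nsq x ^ (expo n - 1) * Z₁ (nsq x)))) +
      (∑ i, x i * pd i (usq U) x) * (nsq x ^ (expo n - 1) * Z (nsq x)) +
      gsq U x * (nsq x ^ expo n * Z (nsq x))) := by
    rw [integral_add (c1.add c2).integrableOn c3.integrableOn,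
      integral_add c1.integrableOn c2.integrableOn, I, neg_add_cancel, zero_add]
  rw [hX]
  refine CC.setIntegral_le hN (hZ.cc (continuousOn_eden h.regU)) ((c1.add c2).add c3)
    (continuousOn_const.mul (continuousOn_const.mul (continuousOn_eden h.regU))) fun x hx => ?_
  have hq := nsq_pos hx
  have key := fun (c : ℝ) (h1 : |nsq x * Z₁ (nsq x)| ≤ c) =>
    hardy_le hq (wt_nonneg (expo n - 1) x) (usq_nonneg U x) (hZ.nonneg (nsq x))
      (radial_deriv_sq_le U x) (gsq_nonneg U x) h1
  rw [sum_coord_mul_pd hx h.regU, wt_div hx (expo n - 1), trace_aux hq, wt_mul hx (expo n)]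
  refine le_indicator_add (fun _ => key c (hZ.le₁ _)) fun hA => ?_
  refine (key 0 (by simp [(hZ.eq_zero hA).1])).trans_eq ?_
  rw [zero_mul, zero_add]

set_option maxHeartbeats 1000000 in
lemma Sol'.momentum_cut (hn : 4 ≤ n) (h : Sol' K U P) (hN : 0 < N) (hZ : Cut c N Z Z₁ Z₂)
    (hH : n = 4 ∨ ∀ x, x ≠ 0 → hd U P x ≤ 0) :
    ∫ x in ({0}ᶜ : Set (E n)), hden U P x * Z (nsq x) ≤
      ∫ x in shells n N, c * (-expo n * (2 * eden U x) + hden U P x) := by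
  rcases hH with h4 | hH
  · have e0 : expo n = 0 := by rw [expo, h4]; norm_num
    simp [hden, e0]
  have hΩ : IsOpen ({0}ᶜ : Set (E n)) := isOpen_compl_singleton
  have r := hZ.rad.rpow_mul (expo n - 1)
  have r' := hZ.rad.rpow_mul' hZ.rad' (expo n - 1)
  have I := h.radial_momentum r
  have c1 : CC {0}ᶜ (fun x : E n => usq U x * (nsq x ^ (expo n - 1) * Z (nsq x)) +
      2 * ((expo n - 1) * nsq x ^ (expo n - 1 - 1) * Z (nsq x) + nsq x ^ (expo n - 1) * Z₁ (nsq x)) *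
        xu U x ^ 2 + P x * (n * (nsq x ^ (expo n - 1) * Z (nsq x)) + 2 * (nsq x *
      ((expo n - 1) * nsq x ^ (expo n - 1 - 1) * Z (nsq x) +
        nsq x ^ (expo n - 1) * Z₁ (nsq x))))) := by
    have hxu : ContinuousOn (xu U) {0}ᶜ := continuousOn_finsetSum _ fun i _ =>
      (contDiff_coord (m := 0) i).continuous.continuousOn.mul (h.regU i).continuousOn
    refine (CC.add ?_ ?_).add ?_
    · exact r.test.cc.mul_left hΩ (contDiffOn_usq h.regU).continuousOn
    · exact (r'.test.cc.const_mul 2).mul_right hΩ (hxu.pow 2)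
    · exact ((r.test.cc.const_mul _).add (r.cc_deriv.const_mul _)).mul_left hΩ h.regP.continuousOn
  have I0 := congrArg (fun t => expo n * (1 / 2) * t) I
  rw [mul_zero] at I0
  have I1 := integral_const_mul (μ := volume.restrict ({0}ᶜ : Set (E n))) (expo n * (1 / 2))
    (fun x : E n => usq U x * (nsq x ^ (expo n - 1) * Z (nsq x)) +
      2 * ((expo n - 1) * nsq x ^ (expo n - 1 - 1) * Z (nsq x) + nsq x ^ (expo n - 1) * Z₁ (nsq x)) *
        xu U x ^ 2 + P x * (n * (nsq x ^ (expo n - 1) * Z (nsq x)) + 2 * (nsq x *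
      ((expo n - 1) * nsq x ^ (expo n - 1 - 1) * Z (nsq x) +
        nsq x ^ (expo n - 1) * Z₁ (nsq x)))))
  have I2 := I1.trans I0
  rw [← add_zero (∫ x in shells n N, _), ← I2]
  refine CC.setIntegral_le hN (hZ.cc (continuousOn_hden h.regU h.regP)) (c1.const_mul _)
    (continuousOn_const.mul ((continuousOn_const.mul
      (continuousOn_const.mul (continuousOn_eden h.regU))).add
      (continuousOn_hden h.regU h.regP))) fun x hx => ?_
  have hq := nsq_pos hx
  have hs := expo_nonpos hn
  have key : ∀ c : ℝ, |nsq x * Z₁ (nsq x)| ≤ c → hden U P x * Z (nsq x) ≤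
      c * (-expo n * (2 * eden U x) + hden U P x) + expo n * (1 / 2) *
      (usq U x * (nsq x ^ (expo n - 1) * Z (nsq x)) +
      2 * ((expo n - 1) * nsq x ^ (expo n - 1 - 1) * Z (nsq x) + nsq x ^ (expo n - 1) * Z₁ (nsq x)) *
        xu U x ^ 2 + P x * (n * (nsq x ^ (expo n - 1) * Z (nsq x)) + 2 * (nsq x *
      ((expo n - 1) * nsq x ^ (expo n - 1 - 1) * Z (nsq x) +
        nsq x ^ (expo n - 1) * Z₁ (nsq x))))) := fun c h1 => by
    have := mul_le_mul_of_nonneg_left (momentum_le hq (wt_nonneg (expo n - 1) x) (usq_nonneg U x)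
      (hZ.nonneg (nsq x)) (hs.trans zero_le_one) (xu_sq_le U x) (hH x hx) h1) (neg_nonneg.2 hs)
    have e : P x = hd U P x - 1 / 2 * usq U x := by rw [hd]; ring
    rw [wt_div hx (expo n - 1), trace_aux hq, e, hden, eden]
    linarith
  refine le_indicator_add (fun _ => key c (hZ.le₁ _)) fun hA => ?_
  refine (key 0 (by simp [(hZ.eq_zero hA).1])).trans_eq ?_
  rw [zero_mul, zero_add]

end Cuts

section Vanishing
variable {U : Fin n → E n → ℝ} {P : E n → ℝ} {K : ℝ}

lemma integrableOn_shells {g : E n → ℝ} (hg : ContinuousOn g {0}ᶜ) {N : ℝ} (hN : 0 < N) :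
    IntegrableOn g (shells n N) :=
  (hg.mono (shells_sub hN)).integrableOn_compact (isCompact_shells N)

lemma Sol'.cut_estimates (hn : 4 ≤ n) (h : Sol' K U P) (hH : n = 4 ∨ ∀ x, x ≠ 0 → hd U P x ≤ 0)
    {c : ℝ} (hc : 0 ≤ c) : ∃ D T, 0 ≤ D ∧ 0 ≤ T ∧ ∀ N, 0 < N → ∀ Z Z₁ Z₂, Cut c N Z Z₁ Z₂ →
      (∫ x in ({0}ᶜ : Set (E n)), hden U P x * Z (nsq x) ≤
        D * ((∫ x in shells n N, eden U x) + ∫ x in shells n N, hden U P x)) ∧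
      (∀ ε, 0 < ε → ∫ x in ({0}ᶜ : Set (E n)), eden U x * Z (nsq x) ≤
        D * ((1 + 1 / ε) * (∫ x in shells n N, eden U x) +
          ∫ x in shells n N, hden U P x) + ε * T) ∧
      (∫ x in shells n N, eden U x ≤ T) ∧ (∫ x in shells n N, hden U P x ≤ T) := by
  obtain ⟨T₁, hT₁⟩ := exists_shells_bound n 1
  obtain ⟨T₂, hT₂⟩ := exists_shells_bound n (n * K ^ 2)
  obtain ⟨T₃, hT₃⟩ := exists_shells_bound n (-expo n * (n * K ^ 2 + K))
  have ce := continuousOn_eden h.regU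
  have ch := continuousOn_hden h.regU h.regP
  have cq := continuousOn_nsq_rpow (n := n) (-((n:ℝ) / 2))
  have hK := h.pos
  have hs := neg_nonneg.2 (expo_nonpos hn)
  set s := -expo n with hs_def
  have hA : 0 ≤ n + 4 * s + 2 + (n * K ^ 2 + K) := by positivity
  have B1 := fun N hN => hT₁ (fun x : E n => nsq x ^ (-((n:ℝ) / 2))) (fun x => wt_nonneg _ x) cq
    (fun x hx => by rw [one_mul]) N hN
  have B2 := fun N hN => hT₂ (eden U) (eden_nonneg U) ce (fun x hx => h.eden_le hx) N hN
  have B3 := fun N hN => hT₃ (hden U P) (hden_nonneg hn U P) ch (fun x hx => h.hden_le hn hx) N hN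
  have p1 : 0 ≤ T₁ := (setIntegral_nonneg (isCompact_shells 1).isClosed.measurableSet
    fun x _ => wt_nonneg _ x).trans (B1 1 one_pos)
  have p2 : 0 ≤ T₂ := (setIntegral_nonneg (isCompact_shells 1).isClosed.measurableSet
    fun x _ => eden_nonneg U x).trans (B2 1 one_pos)
  have p3 : 0 ≤ T₃ := (setIntegral_nonneg (isCompact_shells 1).isClosed.measurableSet
    fun x _ => hden_nonneg hn U P x).trans (B3 1 one_pos)
  set A := n + 4 * s + 2 + (n * K ^ 2 + K) with hA_def
  set D₁ := c * (2 * s + 1) with hD₁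
  have hD₁0 : 0 ≤ D₁ := by positivity
  refine ⟨D₁ + 2 * c + c * A + 2 * (n * K) * D₁, c * A * T₁ + T₂ + T₃, by positivity, by positivity,
    fun N hN Z Z₁ Z₂ hZ => ?_⟩
  have i1 := integrableOn_shells ce hN
  have i2 := integrableOn_shells ch hN
  have i3 := integrableOn_shells cq hN
  have m1 := h.momentum_cut hn hN hZ hH
  have m2 := h.hardy_cut hN hZ
  have n1 : 0 ≤ ∫ x in shells n N, eden U x := setIntegral_nonneg
    (isCompact_shells N).isClosed.measurableSet fun x _ => eden_nonneg U x
  have n2 : 0 ≤ ∫ x in shells n N, hden U P x := setIntegral_nonneg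
    (isCompact_shells N).isClosed.measurableSet fun x _ => hden_nonneg hn U P x
  rw [integral_const_mul, integral_add ((i1.const_mul 2).const_mul _) i2, integral_const_mul,
    integral_const_mul] at m1
  rw [integral_const_mul, integral_const_mul] at m2
  have m3 := fun (ε : ℝ) (hε : 0 < ε) => h.energy_cut hn hN hZ hε
  simp only [integral_const_mul] at m3
  have m3' : ∀ ε : ℝ, 0 < ε → ∫ x in shells n N, ((1 + 1 / ε) * eden U x +
      ε * nsq x ^ (-((n:ℝ) / 2))) = (1 + 1 / ε) * (∫ x in shells n N, eden U x) +
        ε * ∫ x in shells n N, nsq x ^ (-((n:ℝ) / 2)) := fun ε hε => by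
    rw [integral_add (i1.const_mul _) (i3.const_mul _), integral_const_mul, integral_const_mul]
  have b1 := B1 N hN
  have b2 := B2 N hN
  have b3 := B3 N hN
  have eA : (n:ℝ) - 4 * expo n + 2 + (n * K ^ 2 + K) = A := by rw [hA_def, hs_def]; ring
  set Ie := ∫ x in shells n N, eden U x
  set Ih := ∫ x in shells n N, hden U P x
  have m4 : ∫ x in ({0}ᶜ : Set (E n)), hden U P x * Z (nsq x) ≤ D₁ * (Ie + Ih) := by
    refine m1.trans ?_
    have : 0 ≤ c * Ie + c * 2 * s * Ih := by positivity
    rw [hD₁]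
    linarith
  have hq : 0 ≤ (2 * c + c * A + 2 * (n * K) * D₁) * (Ie + Ih) := by positivity
  refine ⟨?_, fun ε hε => ?_, ?_, ?_⟩
  · refine m4.trans ?_
    linarith
  · have m5 := m3 ε hε
    rw [m3' ε hε, eA] at m5
    have m6 := mul_le_mul_of_nonneg_left m4 (by positivity : 0 ≤ 2 * (n * K))
    have m7 := mul_le_mul_of_nonneg_left b1 (by positivity : 0 ≤ c * A * ε)
    have hi : 0 < 1 / ε := by positivity
    have r1 : 0 ≤ D₁ * ((1 + 1 / ε) * Ie + Ih) + 2 * c * (1 / ε * Ie + Ih) + c * A * Ih +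
      2 * (n * K) * D₁ * (1 / ε * Ie) + ε * (T₂ + T₃) := by positivity
    linarith
  · have : 0 ≤ c * A * T₁ := by positivity
    linarith
  · have : 0 ≤ c * A * T₁ := by positivity
    linarith

theorem Sol'.eq_zero_of_head (hn : 4 ≤ n) (h : Sol' K U P)
    (hH : n = 4 ∨ ∀ x, x ≠ 0 → hd U P x ≤ 0) (j : Fin n) {x : E n} (hx : x ≠ 0) : U j x = 0 := by
  obtain ⟨c, hc, hcut⟩ := exists_cut
  obtain ⟨D, T, hD, hT, H⟩ := h.cut_estimates hn hH hc
  choose Z Z₁ Z₂ hZ using fun k : ℕ => hcut (k + 1) (by positivity)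
  have hN : ∀ k : ℕ, (0:ℝ) < k + 1 := fun k => by positivity
  have H' := fun k : ℕ => H (k + 1) (hN k) _ _ _ (hZ k)
  have ce := continuousOn_eden h.regU
  have ch := continuousOn_hden h.regU h.regP
  have ih : IntegrableOn (hden U P) {0}ᶜ := (integrableOn_of_cut hZ (hden_nonneg hn U P) ch
    (B := D * (T + T)) (Eventually.of_forall fun k => (H' k).1.trans
      (mul_le_mul_of_nonneg_left (add_le_add (H' k).2.2.1 (H' k).2.2.2) hD))).1
  have ie : IntegrableOn (eden U) {0}ᶜ := (integrableOn_of_cut hZ (eden_nonneg U) ce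
    (B := D * ((1 + 1 / 1) * T + T) + 1 * T) (Eventually.of_forall fun k =>
      ((H' k).2.1 1 one_pos).trans (by
        have h1 := (H' k).2.2.1
        have h2 := (H' k).2.2.2
        gcongr))).1
  have te := tendsto_shells ie
  have th := tendsto_shells ih
  have key : eden U x = 0 := by
    refine eq_zero_of_cut hZ (eden_nonneg U) ce (fun ε₀ hε₀ => ?_) hx
    set ε := ε₀ / (2 * (T + 1)) with hε_def
    have hε : 0 < ε := by positivity
    have e1 : ε * T ≤ ε₀ / 2 := by
      rw [hε_def, div_mul_eq_mul_div, div_le_div_iff₀ (by positivity) (by norm_num)]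
      nlinarith
    have t := ((te.const_mul (1 + 1 / ε)).add th).const_mul D
    rw [mul_zero, add_zero, mul_zero] at t
    filter_upwards [t.eventually_le_const (half_pos hε₀)] with k hk
    have := (H' k).2.1 ε hε
    linarith
  have h2 : usq U x = 0 := by
    rcases mul_eq_zero.1 key with h0 | h0
    · exact absurd h0 (Real.rpow_pos_of_pos (nsq_pos hx) _).ne'
    · exact h0
  have := (Finset.sum_eq_zero_iff_of_nonneg (fun j _ => sq_nonneg (U j x))).1 h2 j (Finset.mem_univ j)
  exact pow_eq_zero_iff two_ne_zero |>.1 this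

end Vanishing

lemma hasDerivAt_comp_pos {F F' : ℝ → ℝ} (h : ∀ s, HasDerivAt F (F' s) s) (h0 : F' 0 = 0) (s : ℝ) :
    HasDerivAt (fun s => F (max s 0)) (F' (max s 0)) s := by
  rcases lt_trichotomy s 0 with hs | rfl | hs
  · rw [max_eq_right hs.le, h0]
    refine (hasDerivAt_const s (F 0)).congr_of_eventuallyEq ?_
    filter_upwards [Iio_mem_nhds hs] with y hy
    rw [max_eq_right (le_of_lt hy)]
  · rw [max_self, h0, ← hasDerivWithinAt_univ, ← Iic_union_Ici (a := (0:ℝ))]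
    refine HasDerivWithinAt.union ?_ ?_
    · refine (hasDerivWithinAt_const (0:ℝ) _ (F 0)).congr (fun y hy => ?_) (by simp)
      rw [max_eq_right hy]
    · have := (h 0).hasDerivWithinAt (s := Ici 0)
      rw [h0] at this
      refine this.congr (fun y hy => ?_) (by simp)
      rw [max_eq_left hy]
  · rw [max_eq_left hs.le]
    refine (h s).congr_of_eventuallyEq ?_
    filter_upwards [Ioi_mem_nhds hs] with y hy
    rw [max_eq_left (le_of_lt hy)]

/-- A convex `C²` function of linear growth, positive exactly on `(δ, ∞)`. -/
lemma exists_renorm (δ : ℝ) (hδ : 0 < δ) : ∃ Φ Φ₁ Φ₂ : ℝ → ℝ, (∀ s, HasDerivAt Φ (Φ₁ s) s) ∧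
    (∀ s, HasDerivAt Φ₁ (Φ₂ s) s) ∧ Continuous Φ₂ ∧ (∀ s, 0 ≤ Φ s) ∧ (∀ s, Φ s ≤ |s|) ∧
    (∀ s, 0 ≤ Φ₁ s) ∧ (∀ s, 0 ≤ Φ₂ s) ∧ (∀ s ≤ δ, Φ s = 0 ∧ Φ₁ s = 0) ∧
    (∀ s, δ < s → 0 < Φ s ∧ 0 < Φ₂ s) := by
  have d0 : ∀ T : ℝ, HasDerivAt (fun T => T - Real.arctan T) (T ^ 2 / (1 + T ^ 2)) T := fun T => by
    refine ((hasDerivAt_id T).sub (Real.hasDerivAt_arctan T)).congr_deriv ?_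
    field_simp
    ring
  have d1 : ∀ T : ℝ, HasDerivAt (fun T => T ^ 2 / (1 + T ^ 2)) (2 * T / (1 + T ^ 2) ^ 2) T := by
    intro T
    refine ((hasDerivAt_pow 2 T).fun_div ((hasDerivAt_pow 2 T).const_add 1)
      (by positivity)).congr_deriv ?_
    congr 1
    push_cast
    ring
  have hpos : ∀ T : ℝ, 0 < T → 0 < T - Real.arctan T := fun T hT => by
    have := Real.lt_tan (Real.arctan_pos.2 hT) (Real.arctan_lt_pi_div_two T)
    rw [Real.tan_arctan] at this
    linarith
  have hnn : ∀ T : ℝ, 0 ≤ T → 0 ≤ T - Real.arctan T := fun T hT => by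
    rcases hT.eq_or_lt with rfl | h
    · simp
    · exact (hpos T h).le
  have hm : ∀ s : ℝ, 0 ≤ max (s - δ) 0 := fun s => le_max_right _ _
  have sh : ∀ {F F' : ℝ → ℝ}, (∀ s, HasDerivAt F (F' s) s) → ∀ s, HasDerivAt (fun s => F (s - δ))
      (F' (s - δ)) s := fun {F F'} h s => by
    have := (h (s - δ)).comp s ((hasDerivAt_id s).sub_const δ)
    rwa [mul_one] at this
  refine ⟨_, _, fun s => 2 * max (s - δ) 0 / (1 + max (s - δ) 0 ^ 2) ^ 2,
    sh (hasDerivAt_comp_pos d0 (by simp)), sh (hasDerivAt_comp_pos d1 (by simp)), ?_,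
    fun s => hnn _ (hm s), fun s => ?_, fun s => by positivity, fun s => ?_, fun s hs => ?_,
    fun s hs => ?_⟩
  · refine Continuous.div (by fun_prop) (by fun_prop) fun s => by positivity
  · have h1 : 0 ≤ Real.arctan (max (s - δ) 0) := Real.arctan_nonneg.2 (hm s)
    have h2 : max (s - δ) 0 ≤ |s| := max_le (by linarith [le_abs_self s]) (abs_nonneg s)
    linarith
  · have := hm s
    positivity
  · have : max (s - δ) 0 = 0 := max_eq_right (by linarith)
    simp [this]
  · have : max (s - δ) 0 = s - δ := max_eq_left (by linarith)
    have h0 : 0 < s - δ := by linarith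
    simp only [this]
    exact ⟨hpos _ h0, by positivity⟩

section Head
variable {U : Fin n → E n → ℝ} {P : E n → ℝ} {K : ℝ}

lemma cut_flux_le {q z₁ z₂ X c L Φ N : ℝ} (hq : 0 < q) (hN : 0 ≤ N) (hΦ : 0 ≤ Φ)
    (hXL : |X| ≤ L) (h1 : |q * z₁| ≤ c) (h2 : |q ^ 2 * z₂| ≤ c) :
    Φ * (2 * N * z₁ + 4 * q * z₂ + 2 * z₁ * X) ≤ c * ((2 * N + 4 + 2 * L) * (Φ / q)) := by
  have hc : 0 ≤ c := (abs_nonneg _).trans h1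
  have e : Φ * (2 * N * z₁ + 4 * q * z₂ + 2 * z₁ * X) =
      Φ / q * (2 * N * (q * z₁) + 4 * (q ^ 2 * z₂) + 2 * (q * z₁ * X)) := by
    field_simp
  have h3 : q * z₁ * X ≤ c * L := by
    refine (le_abs_self _).trans ?_
    rw [abs_mul]
    gcongr
  have h4 := mul_le_mul_of_nonneg_left ((le_abs_self _).trans h1) (by positivity : 0 ≤ 2 * N)
  have h5 := (le_abs_self _).trans h2
  rw [e]
  calc _ ≤ Φ / q * (2 * N * c + 4 * c + 2 * (c * L)) :=
        mul_le_mul_of_nonneg_left (by linarith) (by positivity)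
    _ = _ := by ring

set_option maxHeartbeats 1000000 in
/-- The total head pressure is nonpositive in dimension at least five. -/
theorem Sol'.head_nonpos (hn : 5 ≤ n) (h : Sol' K U P) {x : E n} (hx : x ≠ 0) : hd U P x ≤ 0 := by
  refine le_of_forall_pos_le_add fun δ hδ => ?_
  rw [zero_add]
  obtain ⟨Φ, Φ₁, Φ₂, d0, d1, hc2, p0, le0, p1, p2, hz, hp⟩ := exists_renorm δ hδ
  have hΩ : IsOpen ({0}ᶜ : Set (E n)) := isOpen_compl_singleton
  have hH := contDiffOn_hd h.regU h.regP
  have cΦ : Continuous Φ := continuous_iff_continuousAt.2 fun s => (d0 s).continuousAt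
  have cΦ₁ : Continuous Φ₁ := continuous_iff_continuousAt.2 fun s => (d1 s).continuousAt
  have hK := h.pos
  obtain ⟨c, hc, hcut⟩ := exists_cut
  choose Z Z₁ Z₂ hZ using fun k : ℕ => hcut (k + 1) (by positivity)
  obtain ⟨v, hv, hvol⟩ := exists_shell_volume n
  set M := n * K ^ 2 + K with hM
  have hM0 : 0 ≤ M := by positivity
  set A := 2 * (n:ℝ) + 4 + 2 * (n * K) with hA
  set g : E n → ℝ := fun x => Φ (hd U P x) / nsq x with hg
  have cg : ContinuousOn g {0}ᶜ := (cΦ.comp_continuousOn hH.continuousOn).div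
    continuous_nsq.continuousOn fun x hx => (nsq_pos hx).ne'
  have g0 : ∀ x, 0 ≤ g x := fun x => div_nonneg (p0 _) (nsq_nonneg x)
  set G : E n → ℝ := fun x => Φ₂ (hd U P x) * ∑ i, pd i (hd U P) x ^ 2 +
    1 / 2 * Φ₁ (hd U P x) * wsq U x with hG
  have G1 : ∀ x, 0 ≤ Φ₂ (hd U P x) * ∑ i, pd i (hd U P) x ^ 2 := fun x =>
    mul_nonneg (p2 _) (Finset.sum_nonneg fun i _ => sq_nonneg _)
  have G2 : ∀ x, 0 ≤ 1 / 2 * Φ₁ (hd U P x) * wsq U x := fun x =>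
    mul_nonneg (mul_nonneg (by norm_num) (p1 _)) (wsq_nonneg U x)
  have G0 : ∀ x, 0 ≤ G x := fun x => add_nonneg (G1 x) (G2 x)
  have cG : ContinuousOn G {0}ᶜ := by
    refine ((hc2.comp_continuousOn hH.continuousOn).mul (continuousOn_finsetSum _ fun i _ =>
      (continuousOn_pd hΩ hH).pow 2)).add ((continuousOn_const.mul
        (cΦ₁.comp_continuousOn hH.continuousOn)).mul (continuousOn_wsq hΩ h.regU))
  have flux : ∀ k : ℕ, ∫ x in ({0}ᶜ : Set (E n)), G x * Z k (nsq x) ≤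
      ∫ x in shells n (k + 1), c * (A * g x) := fun k => by
    have r := (hZ k).rad
    have r' := (hZ k).rad'
    have := h.head_renorm hΩ d0 d1 hc2 (φ := fun x => Z k (nsq x)) (r.smooth r') r.test.compact
      r.test.sub
    rw [this]
    have c1 : CC {0}ᶜ (fun x => Φ (hd U P x) * (lap (fun x : E n => Z k (nsq x)) x +
        adv U (fun x => Z k (nsq x)) x)) :=
      ((cc_lap (r.smooth r') r.test.compact r.test.sub).add (r.test.adv_cc hΩ h.regU)).mul_left hΩ
        (cΦ.comp_continuousOn hH.continuousOn)
    have cz : CC {0}ᶜ (fun _ : E n => (0:ℝ)) := CC.zero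
    rw [← add_zero (∫ x in shells n (k + 1), c * (A * g x)),
      ← integral_zero (E n) ℝ (μ := volume.restrict ({0}ᶜ : Set (E n)))]
    refine CC.setIntegral_le (by positivity) c1 cz (continuousOn_const.mul
      (continuousOn_const.mul cg)) fun x hx => ?_
    have key := fun (c : ℝ) (h1 : |nsq x * Z₁ k (nsq x)| ≤ c)
        (h2 : |nsq x ^ 2 * Z₂ k (nsq x)| ≤ c) => cut_flux_le (N := (n:ℝ)) (nsq_pos hx)
      (by positivity) (p0 (hd U P x)) (h.abs_xu_le hx) h1 h2
    rw [r.lap_eq r' hx, r.adv_eq U hx]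
    refine le_indicator_add (fun _ => ?_) fun hA => ?_
    · rw [add_zero]
      exact key c ((hZ k).le₁ _) ((hZ k).le₂ _)
    · obtain ⟨z1, z2⟩ := (hZ k).eq_zero hA
      refine (key 0 (by simp [z1]) (by simp [z2])).trans_eq ?_
      rw [zero_mul]
  have h1 : Tendsto (fun k : ℕ => (k:ℝ) + 1) atTop atTop :=
    tendsto_atTop_add_const_right _ _ tendsto_natCast_atTop_atTop
  have outer : ∀ᶠ k : ℕ in atTop, ∫ x in shells n (k + 1), c * (A * g x) ≤
      c * (A * (M * v * ((k:ℝ) + 1) ^ (-((n:ℝ) / 2 - 2)))) := by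
    filter_upwards [h1.eventually_ge_atTop (M / δ)] with k hk
    have hN : (0:ℝ) < k + 1 := by positivity
    set N : ℝ := k + 1
    rw [integral_const_mul, integral_const_mul]
    refine mul_le_mul_of_nonneg_left (mul_le_mul_of_nonneg_left ?_ (by positivity)) hc
    have i : ∀ s, 0 < s → IntegrableOn g (shell n s) := fun s hs =>
      (cg.mono (nsq_preimage_sub hs)).integrableOn_compact (isCompact_nsq_preimage _ _)
    have hle := setIntegral_union_le (i (1 / N) (by positivity)) (i N hN) g0
    have hz0 : ∫ x in shell n N, g x = 0 := by
      refine setIntegral_eq_zero_of_forall_eq_zero fun x hx => ?_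
      have hx0 : x ≠ 0 := nsq_preimage_sub hN hx
      have : hd U P x ≤ δ := by
        refine ((le_abs_self _).trans (h.abs_hd_le hx0)).trans ?_
        rw [div_le_iff₀ (nsq_pos hx0)]
        rw [div_le_iff₀ hδ] at hk
        have := mul_le_mul_of_nonneg_left hx.1 hδ.le
        linarith
      rw [hg]
      simp only [(hz _ this).1, zero_div]
    rw [hz0, add_zero] at hle
    refine hle.trans ?_
    have hb : ∀ x ∈ shell n (1 / N), ‖g x‖ ≤ M * N ^ 2 := fun x hx => by
      have hx0 : x ≠ 0 := nsq_preimage_sub (by positivity) hx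
      have hq := nsq_pos hx0
      rw [Real.norm_of_nonneg (g0 x)]
      have h3 : g x ≤ M / nsq x / nsq x :=
        div_le_div_of_nonneg_right ((le0 _).trans (h.abs_hd_le hx0)) hq.le
      refine h3.trans ?_
      have h4 : 1 / nsq x ≤ N := by
        rw [div_le_iff₀ hq]
        have := mul_le_mul_of_nonneg_left hx.1 hN.le
        rwa [mul_one_div, div_self hN.ne'] at this
      calc M / nsq x / nsq x = M * (1 / nsq x) ^ 2 := by field_simp
        _ ≤ _ := by gcongr
    have h2 := norm_setIntegral_le_of_norm_le_const (μ := volume)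
      (isCompact_nsq_preimage (1 / N) (2 * (1 / N))).measure_lt_top hb
    refine (le_abs_self _).trans (h2.trans ?_)
    calc M * N ^ 2 * volume.real (shell n (1 / N))
        ≤ M * N ^ 2 * (v * (1 / N) ^ ((n:ℝ) / 2)) :=
          mul_le_mul_of_nonneg_left (hvol _ (by positivity)) (by positivity)
      _ = M * v * (N ^ (2:ℝ) * N ^ (-((n:ℝ) / 2))) := by
          rw [one_div, Real.inv_rpow hN.le, ← Real.rpow_neg hN.le]; norm_cast; ring
      _ = _ := by
          rw [← Real.rpow_add hN]
          congr 2
          ring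
  have lim : Tendsto (fun k : ℕ => c * (A * (M * v * ((k:ℝ) + 1) ^ (-((n:ℝ) / 2 - 2))))) atTop
      (𝓝 0) := by
    have h5 : (5:ℝ) ≤ n := by exact_mod_cast hn
    have := (tendsto_rpow_neg_atTop (y := (n:ℝ) / 2 - 2) (by linarith)).comp h1
    simpa using ((this.const_mul (M * v)).const_mul A).const_mul c
  have van : ∀ y, y ≠ 0 → G y = 0 := fun y hy => eq_zero_of_cut hZ G0 cG (fun ε hε => by
    filter_upwards [outer, lim.eventually_le_const hε] with k hk hk'
    exact (flux k).trans (hk.trans hk')) hy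
  have dW : ∀ y, y ≠ 0 → DifferentiableAt ℝ (hd U P) y := fun y hy => diffAt hΩ hH hy
  have zero : ∀ y, y ≠ 0 → ∀ i, Φ₁ (hd U P y) * pd i (hd U P) y = 0 := fun y hy i => by
    by_cases hyδ : hd U P y ≤ δ
    · rw [(hz _ hyδ).2, zero_mul]
    · push Not at hyδ
      have h3 := ((add_eq_zero_iff_of_nonneg (G1 y) (G2 y)).1 (van y hy)).1
      have h4 := (mul_eq_zero.1 h3).resolve_left (hp _ hyδ).2.ne'
      have := (Finset.sum_eq_zero_iff_of_nonneg (fun i _ => sq_nonneg (pd i (hd U P) y))).1 h4 i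
        (Finset.mem_univ i)
      rw [(pow_eq_zero_iff two_ne_zero).1 this, mul_zero]
  have hconn : IsPreconnected ({0}ᶜ : Set (E n)) := by
    refine (isConnected_compl_singleton_of_one_lt_rank ?_ 0).isPreconnected
    rw [← Module.finrank_eq_rank, finrank_euclideanSpace_fin]
    exact_mod_cast (by omega : 1 < n)
  have const : ∀ y, y ≠ 0 → Φ (hd U P y) = Φ (hd U P x) := fun y hy => by
    refine hΩ.is_const_of_fderiv_eq_zero (𝕜 := ℝ) hconn (f := fun y => Φ (hd U P y))
      (fun y hy => ((d0 _).differentiableAt.comp y (dW y hy)).differentiableWithinAt)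
      (fun y hy => ?_) hy hx
    ext w
    rw [fderiv_eq_sum]
    simp only [pd_comp (d0 _) (dW y hy), zero y hy, mul_zero, Finset.sum_const_zero]
    rfl
  by_contra hcon
  push Not at hcon
  set t : ℝ := M / δ / nsq x + 1 with ht
  have hq := nsq_pos hx
  have ht1 : 1 ≤ t := by
    have : 0 ≤ M / δ / nsq x := by positivity
    linarith
  have htx : t • x ≠ 0 := smul_ne_zero (by positivity) hx
  have hfar : hd U P (t • x) ≤ δ := by
    refine ((le_abs_self _).trans (h.abs_hd_le htx)).trans ?_
    have e : nsq (t • x) = t ^ 2 * nsq x := by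
      rw [nsq, norm_smul, mul_pow, nsq, Real.norm_eq_abs, sq_abs]
    rw [e, div_le_iff₀ (by positivity)]
    have h6 : t * nsq x ≤ t ^ 2 * nsq x := by gcongr; nlinarith
    have h7 : δ * (t * nsq x) = M + δ * nsq x := by
      rw [ht]; field_simp
    have := mul_le_mul_of_nonneg_left h6 hδ.le
    have : 0 ≤ δ * nsq x := by positivity
    linarith
  have := const _ htx
  rw [(hz _ hfar).1] at this
  exact absurd this (hp _ hcon).1.ne

end Head

/-- Rigidity in the whole space punctured at the origin. -/
theorem Sol.eq_zero (hn : 4 ≤ n) {C : ℝ} {U : Fin n → E n → ℝ} {P : E n → ℝ} (h : Sol C U P)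
    (j : Fin n) {x : E n} (hx : x ≠ 0) : U j x = 0 := by
  obtain ⟨K, c, h'⟩ := h.exists_sol' (by omega)
  refine h'.eq_zero_of_head hn ?_ j hx
  rcases hn.eq_or_lt with h4 | h5
  · exact Or.inl h4.symm
  · exact Or.inr fun x hx => h'.head_nonpos h5 hx

section Reflection

/-- The sign of the `i`-th coordinate under the reflection of the coordinate `l`. -/
def sg (l i : Fin n) : ℝ := if i = l then -1 else 1

lemma sg_self (l : Fin n) : sg l l = -1 := if_pos rfl

lemma sg_of_ne {l i : Fin n} (h : i ≠ l) : sg l i = 1 := if_neg h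

lemma sg_mul_self (l i : Fin n) : sg l i * sg l i = 1 := by
  unfold sg; split_ifs <;> norm_num

lemma abs_sg (l i : Fin n) : |sg l i| = 1 := by
  unfold sg; split_ifs <;> norm_num

/-- The reflection of the coordinate `l`. -/
noncomputable def mirror (l : Fin n) : E n ≃ₗᵢ[ℝ] E n :=
  LinearIsometryEquiv.piLpCongrRight 2
    (fun i => if i = l then LinearIsometryEquiv.neg ℝ else LinearIsometryEquiv.refl ℝ ℝ)

variable (l : Fin n)

lemma mirror_apply (x : E n) (i : Fin n) : mirror l x i = sg l i * x i := by
  simp only [mirror, sg, LinearIsometryEquiv.piLpCongrRight_apply]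
  split_ifs <;> simp

lemma mirror_mirror (x : E n) : mirror l (mirror l x) = x := by
  ext i; rw [mirror_apply, mirror_apply, ← mul_assoc, sg_mul_self, one_mul]

lemma mirror_last (x : E n) : mirror l x l = - x l := by
  rw [mirror_apply, sg_self, neg_one_mul]

lemma mirror_eq {x : E n} (h : x l = 0) : mirror l x = x := by
  ext i; rw [mirror_apply]
  by_cases hi : i = l
  · subst hi; simp [h]
  · rw [sg_of_ne hi, one_mul]

lemma mirror_single (i : Fin n) :
    mirror l (EuclideanSpace.single i 1) = sg l i • EuclideanSpace.single i (1:ℝ) := by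
  ext k
  rw [mirror_apply]
  by_cases h : k = i
  · subst h; simp
  · simp [h]

lemma norm_sub_mirror (x : E n) : ‖x - mirror l x‖ = 2 * |x l| := by
  have : x - mirror l x = EuclideanSpace.single l (2 * x l) := by
    ext k
    by_cases h : k = l
    · subst h; simp [mirror_apply, sg]; ring
    · simp [mirror_apply, sg, h]
  rw [this]; simp

lemma pd_mirror (f : E n → ℝ) (i : Fin n) (x : E n) :
    pd i (fun y => f (mirror l y)) x = sg l i * pd i f (mirror l x) := by
  have h := (mirror l).toContinuousLinearEquiv.comp_right_fderiv (f := f) (x := x)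
  simp only [pd]
  rw [show (fun y => f (mirror l y)) = f ∘ (mirror l).toContinuousLinearEquiv from rfl, h]
  have : (mirror l).toContinuousLinearEquiv (EuclideanSpace.single i (1:ℝ)) =
    sg l i • EuclideanSpace.single i (1:ℝ) := mirror_single l i
  simp only [ContinuousLinearMap.comp_apply, ContinuousLinearEquiv.coe_coe, this, map_smul,
    smul_eq_mul]
  rfl

lemma measurePreserving_mirror : MeasurePreserving (mirror l) (volume : Measure (E n)) volume :=
  (mirror l).measurePreserving

lemma integral_mirror (f : E n → ℝ) : ∫ x, f (mirror l x) = ∫ x, f x :=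
  (measurePreserving_mirror l).integral_comp (mirror l).toHomeomorph.measurableEmbedding f

end Reflection

section Slab

/-- The complement of the interface `x l = 0`. -/
def Off (l : Fin n) : Set (E n) := {x | x l ≠ 0}

variable (l : Fin n)

lemma continuous_coord : Continuous (fun x : E n => x l) := (contDiff_coord l (m := 0)).continuous

lemma isOpen_Off : IsOpen (Off l) := isOpen_ne_fun (continuous_coord l) continuous_const

lemma Off_subset : Off l ⊆ ({0}ᶜ : Set (E n)) := by
  rintro x hx rfl; exact hx (by simp)

/-- Functions of one coordinate are integrable on balls. -/
theorem integrableOn_coord {R : ℝ} {h : ℝ → ℝ}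
    (hh : IntegrableOn h (Icc (-R) R)) :
    IntegrableOn (fun x : E n => h (x l)) (Metric.closedBall 0 R) ∧
    ∫ x in Metric.closedBall (0 : E n) R, |h (x l)| ≤
      |2 * R| ^ (n - 1) * ∫ t in Icc (-R) R, |h t| := by
  set f : Fin n → ℝ → ℝ := fun i => (Icc (-R) R).indicator (if i = l then h else fun _ => 1) with hf
  have hfi : ∀ i, Integrable (f i) := by
    intro i
    rw [hf]; dsimp only
    rw [integrable_indicator_iff measurableSet_Icc]
    split_ifs
    · exact hh
    · exact integrableOn_const (by simp)
  have hF : Integrable (fun x : E n => ∏ i, f i (x i)) := 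
    (PiLp.volume_preserving_ofLp (Fin n)).integrable_comp_of_integrable
      (Integrable.fintype_prod (μ := fun _ => volume) hfi)
  have hmem : ∀ x ∈ Metric.closedBall (0 : E n) R, ∀ i, x i ∈ Icc (-R) R := by
    intro x hx i
    rw [mem_closedBall_zero_iff] at hx
    exact abs_le.1 ((abs_coord_le x i).trans hx)
  have heq : ∀ x ∈ Metric.closedBall (0 : E n) R, ∏ i, f i (x i) = h (x l) := by
    intro x hx
    rw [Finset.prod_eq_single l]
    · simp [hf, indicator_of_mem (hmem x hx l)]
    · intro i _ hi
      simp [hf, hi, indicator_of_mem (hmem x hx i)]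
    · simp
  refine ⟨(integrableOn_congr_fun heq Metric.isClosed_closedBall.measurableSet).1
    hF.integrableOn, ?_⟩
  calc ∫ x in Metric.closedBall (0 : E n) R, |h (x l)|
      = ∫ x in Metric.closedBall (0 : E n) R, |∏ i, f i (x i)| := by
        refine setIntegral_congr_fun Metric.isClosed_closedBall.measurableSet fun x hx => ?_
        dsimp only; rw [heq x hx]
    _ ≤ ∫ x : E n, |∏ i, f i (x i)| :=
        setIntegral_le_integral hF.abs (Eventually.of_forall fun x => abs_nonneg _)
    _ = ∫ x : E n, ∏ i, |f i (x i)| := by simp only [Finset.abs_prod]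
    _ = ∫ x : Fin n → ℝ, ∏ i, |f i (x i)| :=
        (PiLp.volume_preserving_ofLp (Fin n)).integral_comp
          (MeasurableEquiv.toLp 2 (Fin n → ℝ)).symm.measurableEmbedding
          (fun x : Fin n → ℝ => ∏ i, |f i (x i)|)
    _ = ∏ i, ∫ t, |f i t| := integral_fintype_prod_volume_eq_prod fun i t => |f i t|
    _ ≤ _ := by
        have e : ∀ i, ∫ t, |f i t| = ∫ t in Icc (-R) R, |(if i = l then h else fun _ => 1) t| := by
          intro i
          rw [← integral_indicator measurableSet_Icc]
          congr 1; ext t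
          by_cases ht : t ∈ Icc (-R) R <;> simp [hf, ht]
        rw [← Finset.mul_prod_erase _ _ (Finset.mem_univ l), mul_comm, e l]
        simp only [if_true]
        refine mul_le_mul_of_nonneg_right ?_ (integral_nonneg fun _ => abs_nonneg _)
        calc ∏ i ∈ Finset.univ.erase l, ∫ t, |f i t| ≤ ∏ i ∈ Finset.univ.erase l, |2 * R| := by
              refine Finset.prod_le_prod (fun i _ => integral_nonneg fun _ => abs_nonneg _)
                fun i hi => ?_
              rw [e i, if_neg (Finset.ne_of_mem_erase hi)]
              simp only [abs_one, integral_const, smul_eq_mul, mul_one]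
              simp only [Measure.real, Measure.restrict_apply_univ, Real.volume_Icc]
              rw [ENNReal.toReal_ofReal']
              exact max_le ((by ring : R - -R = 2 * R) ▸ le_abs_self _) (abs_nonneg _)
          _ = _ := by simp

lemma ae_mem_Off : ∀ᵐ x : E n, x ∈ Off l := by
  have h : volume ((Off l)ᶜ : Set (E n)) = 0 := by
    set H : Submodule ℝ (E n) := LinearMap.ker (EuclideanSpace.proj l : E n →L[ℝ] ℝ).toLinearMap
    have : ((Off l)ᶜ : Set (E n)) = H := by
      ext x; simp [Off, H]
    rw [this]
    refine Measure.addHaar_submodule _ _ fun ht => ?_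
    have : EuclideanSpace.single l (1:ℝ) ∈ H := ht ▸ Submodule.mem_top
    simp [H] at this
  exact h

end Slab

section

variable {l : Fin n}

lemma Test.of_zero {Ω K : Set (E n)} (hΩ : IsOpen Ω) {f : E n → ℝ} (hf : ContDiffOn ℝ 1 f Ω)
    (hK : IsCompact K) (hKΩ : K ⊆ Ω) (hz : ∀ x ∉ K, f x = 0) : Test Ω f := by
  have hts : tsupport f ⊆ K := by
    refine closure_minimal (fun x hx => ?_) hK.isClosed
    by_contra h
    exact hx (hz x h)
  refine ⟨?_, HasCompactSupport.intro hK hz, hts.trans hKΩ⟩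
  rw [contDiff_iff_contDiffAt]
  intro x
  by_cases hx : x ∈ Ω
  · exact hf.contDiffAt (hΩ.mem_nhds hx)
  · have : f =ᶠ[𝓝 x] fun _ => 0 := notMem_tsupport_iff_eventuallyEq.1 fun h => hx (hKΩ (hts h))
    exact contDiffAt_const.congr_of_eventuallyEq this

lemma integral_Off (f : E n → ℝ) : ∫ x in Off l, f x = ∫ x, f x := by
  rw [Measure.restrict_eq_self_of_ae_mem (ae_mem_Off l)]

lemma abs_integral_cutoff_le {S S₁ : ℝ → ℝ} {M : ℝ} (hM : 0 ≤ M)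
    (hS : ContDiff ℝ 1 S) (hd : ∀ t, HasDerivAt S (S₁ t) t)
    (h0 : ∀ t, 0 ≤ S t) (h1 : ∀ t, S t ≤ 1) (z0 : ∀ t ≤ 0, S t = 0)
    (d1 : ∀ t ∉ Icc (0 : ℝ) 1, S₁ t = 0) (b1 : ∀ t, |S₁ t| ≤ M) (hc1 : Continuous S₁)
    {V : Fin n → E n → ℝ} {g : E n → ℝ} {R : ℝ}
    (hV : ∀ i, ContDiffOn ℝ 1 (V i) (Off l)) (hs : ∀ i x, R < ‖x‖ → V i x = 0)
    (hg : ∀ x ∈ Off l, g x = ∑ i, pd i (V i) x) (hgi : Integrable g) {δ ε : ℝ} (hδ : 0 ≤ δ)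
    (hε : 0 < ε) (hVd : ∀ x, x l ≠ 0 → |x l| ≤ 2 * ε → |V l x - V l (mirror l x)| ≤ δ) :
    |∫ x, S ((ε⁻¹ * x l) ^ 2 - 1) * g x| ≤ δ * (|2 * R| ^ (n - 1) * (16 * M)) := by
  set c : ℝ → ℝ := fun t => S ((ε⁻¹ * t) ^ 2 - 1) with hc
  set c' : ℝ → ℝ := fun t => S₁ ((ε⁻¹ * t) ^ 2 - 1) * (2 * ε⁻¹ ^ 2 * t) with hc'
  have hcd : ∀ t, HasDerivAt c (c' t) t := by
    intro t
    have : HasDerivAt (fun t : ℝ => (ε⁻¹ * t) ^ 2 - 1) (2 * ε⁻¹ ^ 2 * t) t := by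
      refine ((((hasDerivAt_id t).const_mul ε⁻¹).pow 2).sub_const 1).congr_deriv ?_
      simp; ring
    exact (hd _).comp t this
  have hcs : ContDiff ℝ 1 c := hS.comp (by fun_prop)
  have hc'c : Continuous c' := by
    have : Continuous fun t : ℝ => (ε⁻¹ * t) ^ 2 - 1 := by fun_prop
    exact (hc1.comp this).mul (by fun_prop)
  have hc'z : ∀ t, 2 * ε < |t| → c' t = 0 := by
    intro t ht
    have : (2:ℝ) ^ 2 < (ε⁻¹ * t) ^ 2 := by
      rw [← sq_abs (ε⁻¹ * t), abs_mul, abs_of_pos (inv_pos.2 hε)]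
      have : 2 < ε⁻¹ * |t| := by rw [inv_mul_eq_div, lt_div_iff₀ hε]; linarith
      exact pow_lt_pow_left₀ this (by norm_num) (by norm_num)
    have h := d1 ((ε⁻¹ * t) ^ 2 - 1) fun h => by have := h.2; linarith
    simp only [hc', h, zero_mul]
  have hc'b : ∀ t, |c' t| ≤ (Icc (-(2 * ε)) (2 * ε)).indicator (fun _ => 4 * M * ε⁻¹) t := by
    intro t
    by_cases ht : 2 * ε < |t|
    · rw [hc'z t ht, abs_zero]
      exact indicator_nonneg (fun _ _ => by positivity) t
    · push Not at ht
      have ht' : t ∈ Icc (-(2 * ε)) (2 * ε) := abs_le.1 ht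
      rw [indicator_of_mem ht', hc', abs_mul, abs_mul (2 * ε⁻¹ ^ 2) t,
        abs_of_pos (by positivity : 0 < 2 * ε⁻¹ ^ 2)]
      calc |S₁ ((ε⁻¹ * t) ^ 2 - 1)| * (2 * ε⁻¹ ^ 2 * |t|) ≤ M * (2 * ε⁻¹ ^ 2 * (2 * ε)) := by
            gcongr; exact b1 _
        _ = _ := by field_simp; ring
  have hc'i : ∫ t in Icc (-R) R, |c' t| ≤ 16 * M := by
    have hi : Integrable ((Icc (-(2 * ε)) (2 * ε)).indicator (fun _ : ℝ => 4 * M * ε⁻¹)) := by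
      rw [integrable_indicator_iff measurableSet_Icc]
      exact integrableOn_const (by simp)
    calc ∫ t in Icc (-R) R, |c' t|
        ≤ ∫ t in Icc (-R) R, (Icc (-(2 * ε)) (2 * ε)).indicator (fun _ => 4 * M * ε⁻¹) t :=
          integral_mono_of_nonneg (Eventually.of_forall fun _ => abs_nonneg _) hi.integrableOn
            (Eventually.of_forall hc'b)
      _ ≤ ∫ t, (Icc (-(2 * ε)) (2 * ε)).indicator (fun _ => 4 * M * ε⁻¹) t :=
          setIntegral_le_integral hi (Eventually.of_forall fun t =>
            indicator_nonneg (fun _ _ => by positivity) t)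
      _ = 16 * M := by
          rw [integral_indicator measurableSet_Icc, setIntegral_const, Measure.real,
            Real.volume_Icc, ENNReal.toReal_ofReal (by linarith), smul_eq_mul]
          field_simp; ring
  have hχs : ContDiff ℝ 1 (fun x : E n => c (x l)) := hcs.comp (contDiff_coord l)
  have hpχ : ∀ i x, pd i (fun x : E n => c (x l)) x = if i = l then c' (x l) else 0 := by
    intro i x
    rw [pd_comp (hcd _) (differentiableAt_coord l x), pd_coord]; simp
  have hT : ∀ i, Test (Off l) (fun x => c (x l) * V i x) := by
    intro i
    refine Test.of_zero (isOpen_Off l) (hχs.contDiffOn.mul (hV i))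
      (K := Metric.closedBall 0 R ∩ {x | 1 ≤ (ε⁻¹ * x l) ^ 2})
      ((isCompact_closedBall 0 R).inter_right (isClosed_le continuous_const
        ((continuous_const.mul (continuous_coord l)).pow 2))) ?_ ?_
    · rintro x ⟨_, hx⟩ h0
      simp only [mem_ofPred_eq] at hx
      norm_num [h0] at hx
    · intro x hx
      simp only [mem_inter_iff, mem_closedBall_zero_iff, mem_ofPred_eq, not_and_or, not_le] at hx
      rcases hx with hx | hx
      · rw [hs i x hx, mul_zero]
      · simp only [hc]; rw [z0 _ (by linarith), zero_mul]
  have hpd : ∀ x ∈ Off l, ∑ i, pd i (fun x => c (x l) * V i x) x = c (x l) * g x + c' (x l) * V l x := by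
    intro x hx
    rw [hg x hx, Finset.mul_sum]
    have : ∀ i, pd i (fun x => c (x l) * V i x) x =
        c (x l) * pd i (V i) x + (if i = l then c' (x l) else 0) * V i x := by
      intro i
      rw [pd_mul (hχs.differentiable one_ne_zero x) (diffAt (isOpen_Off l) (hV i) hx), hpχ]; ring
    simp only [this, Finset.sum_add_distrib]
    simp
  have hz := integral_div_zero (isOpen_Off l) hT (g := fun x => c (x l) * g x + c' (x l) * V l x)
    (fun x hx => (hpd x hx).symm)
  rw [integral_Off] at hz
  have hcg : Integrable (fun x => c (x l) * g x) :=
    hgi.bdd_mul (c := 1) hχs.continuous.aestronglyMeasurable (Eventually.of_forall fun x => by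
      rw [Real.norm_eq_abs, abs_of_nonneg (h0 _)]; exact h1 _)
  have hsum : Integrable (fun x => ∑ i, pd i (fun x => c (x l) * V i x) x) :=
    integrable_finsetSum _ fun i _ => ((hT i).pd_cc i).integrable
  have hW : Integrable (fun x => c' (x l) * V l x) := by
    refine (hsum.sub hcg).congr ?_
    filter_upwards [ae_mem_Off l] with x hx
    simp only [Pi.sub_apply]; rw [hpd x hx]; ring
  rw [integral_add hcg hW] at hz
  have hW' : Integrable (fun x => c' (mirror l x l) * V l (mirror l x)) :=
    (measurePreserving_mirror l).integrable_comp_of_integrable hW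
  have h2 : 2 * ∫ x, c' (x l) * V l x = ∫ x, c' (x l) * (V l x - V l (mirror l x)) := by
    rw [two_mul]
    nth_rw 2 [← integral_mirror l]
    rw [← integral_add hW hW']
    congr 1; ext x
    rw [mirror_last, hc']; dsimp only
    rw [show ε⁻¹ * -x l = -(ε⁻¹ * x l) by ring, neg_sq]; ring
  obtain ⟨k1, k2⟩ := integrableOn_coord l (R := R) (hc'c.continuousOn.integrableOn_compact isCompact_Icc)
  have h3 : |∫ x, c' (x l) * (V l x - V l (mirror l x))| ≤ δ * (|2 * R| ^ (n - 1) * (16 * M)) := by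
    calc |∫ x, c' (x l) * (V l x - V l (mirror l x))|
        ≤ ∫ x, |c' (x l) * (V l x - V l (mirror l x))| := abs_integral_le_integral_abs
      _ ≤ ∫ x, (Metric.closedBall (0 : E n) R).indicator (fun x => δ * |c' (x l)|) x := by
          refine integral_mono_of_nonneg (Eventually.of_forall fun _ => abs_nonneg _)
            ((integrable_indicator_iff Metric.isClosed_closedBall.measurableSet).2
              (k1.abs.const_mul δ)) ?_
          filter_upwards [ae_mem_Off l] with x hx
          by_cases hxR : x ∈ Metric.closedBall (0 : E n) R
          · rw [indicator_of_mem hxR, abs_mul, mul_comm]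
            by_cases ht : 2 * ε < |x l|
            · simp [hc'z _ ht]
            · exact mul_le_mul_of_nonneg_right (hVd x hx (not_lt.1 ht)) (abs_nonneg _)
          · rw [mem_closedBall_zero_iff, not_le] at hxR
            rw [hs l x hxR, hs l _ (by simpa using hxR)]
            simp only [sub_self, mul_zero, abs_zero]
            exact indicator_nonneg (fun _ _ => by positivity) x
      _ = δ * ∫ x in Metric.closedBall (0 : E n) R, |c' (x l)| := by
          rw [integral_indicator Metric.isClosed_closedBall.measurableSet, integral_const_mul]
      _ ≤ _ := by gcongr; exact k2.trans (by gcongr)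
  have h4 : ∫ x, c (x l) * g x = -(1 / 2) * ∫ x, c' (x l) * (V l x - V l (mirror l x)) := by
    linarith
  change |∫ x, c (x l) * g x| ≤ _
  rw [h4, abs_mul, abs_neg, abs_of_pos (by norm_num : (0:ℝ) < 1 / 2)]
  linarith [abs_nonneg (∫ x, c' (x l) * (V l x - V l (mirror l x)))]

/-- The divergence theorem for fields with matching normal components on the two sides of the
interface `x l = 0`. -/
theorem integral_div_zero_interface {V : Fin n → E n → ℝ} {g : E n → ℝ} {R : ℝ}
    (hV : ∀ i, ContDiffOn ℝ 1 (V i) (Off l)) (hs : ∀ i x, R < ‖x‖ → V i x = 0)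
    (hg : ∀ x ∈ Off l, g x = ∑ i, pd i (V i) x) (hgi : Integrable g)
    (hVd : ∀ δ : ℝ, 0 < δ → ∃ ε : ℝ, 0 < ε ∧ ∀ x, x l ≠ 0 → |x l| < ε →
      |V l x - V l (mirror l x)| ≤ δ) :
    ∫ x, g x = 0 := by
  obtain ⟨S, S₁, S₂, M, hM, hd, hd', hc, h0, h1, z0, z1, d1, d2, b1, b2⟩ := exists_transition
  have hc1 : Continuous S₁ := continuous_iff_continuousAt.2 fun t => (hd' t).continuousAt
  have hS : ContDiff ℝ 1 S := by
    rw [contDiff_one_iff_deriv]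
    refine ⟨fun t => (hd t).differentiableAt, ?_⟩
    rwa [show deriv S = S₁ from funext fun t => (hd t).deriv]
  set K := |2 * R| ^ (n - 1) * (16 * M) with hK
  have hK0 : 0 ≤ K := by positivity
  have hlim : Tendsto (fun k : ℕ => ∫ x, S (((1 / ((k : ℝ) + 1))⁻¹ * x l) ^ 2 - 1) * g x) atTop
      (𝓝 (∫ x, g x)) := by
    refine tendsto_integral_of_dominated_convergence (fun x => |g x|) (fun k => ?_) hgi.abs
      (fun k => Eventually.of_forall fun x => ?_) ?_
    · have : Continuous fun x : E n => S (((1 / ((k : ℝ) + 1))⁻¹ * x l) ^ 2 - 1) := 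
        hS.continuous.comp (((continuous_const.mul (continuous_coord l)).pow 2).sub continuous_const)
      exact this.aestronglyMeasurable.mul hgi.1
    · rw [norm_mul, Real.norm_eq_abs, Real.norm_eq_abs, abs_of_nonneg (h0 _)]
      exact mul_le_of_le_one_left (abs_nonneg _) (h1 _)
    · filter_upwards [ae_mem_Off l] with x hx
      refine tendsto_const_nhds.congr' ?_
      obtain ⟨N, hN⟩ := exists_nat_gt (2 / |x l|)
      filter_upwards [eventually_ge_atTop N] with k hk
      have hxp : 0 < |x l| := abs_pos.2 hx
      have h2 : 2 ≤ ((k : ℝ) + 1) * |x l| := by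
        have : 2 / |x l| ≤ (k : ℝ) + 1 := by
          have : (N : ℝ) ≤ k := by exact_mod_cast hk
          linarith
        rwa [div_le_iff₀ hxp] at this
      rw [z1, one_mul]
      rw [one_div, inv_inv, ← sq_abs, abs_mul, abs_of_nonneg (by positivity : (0:ℝ) ≤ (k : ℝ) + 1)]
      nlinarith
  have hle : ∀ δ : ℝ, 0 < δ → |∫ x, g x| ≤ δ * K := by
    intro δ hδ
    obtain ⟨ε, hε, h⟩ := hVd δ hδ
    refine le_of_tendsto hlim.abs ?_
    have ht := tendsto_one_div_add_atTop_nhds_zero_nat (𝕜 := ℝ)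
    filter_upwards [ht.eventually (gt_mem_nhds (by positivity : (0:ℝ) < ε / 2))] with k hk
    exact abs_integral_cutoff_le hM hS hd h0 h1 z0 d1 b1 hc1 hV hs hg hgi hδ.le (by positivity)
      fun x hx hx' => h x hx (by linarith)
  by_contra hne
  have hp : 0 < |∫ x, g x| := abs_pos.2 hne
  have := hle (|∫ x, g x| / (2 * (K + 1))) (by positivity)
  rw [div_mul_eq_mul_div, le_div_iff₀ (by positivity)] at this
  nlinarith

end

section

variable {l : Fin n}

lemma dense_Off (l : Fin n) : Dense (Off l) := Measure.dense_of_ae (ae_mem_Off l)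

lemma hasFDerivWithinAt_side {f : E n → ℝ} {F : E n → E n →L[ℝ] ℝ}
    (hf : ContinuousOn f {0}ᶜ) (hF : ContinuousOn F {0}ᶜ) {s : Set (E n)} (hs : IsOpen s)
    (hc : Convex ℝ s) (hd : ∀ x ∈ s, HasFDerivAt f (F x) x) {x : E n} (hx : x ≠ 0)
    (hcl : closure s ⊆ {0}ᶜ) : HasFDerivWithinAt f (F x) (closure s) x := by
  refine hasFDerivWithinAt_closure_of_tendsto_fderiv
    (fun y hy => (hd y hy).differentiableAt.differentiableWithinAt) hc hs
    (fun y hy => (hf y (hcl hy)).mono (subset_closure.trans hcl)) ?_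
  have h1 : Tendsto F (𝓝[s] x) (𝓝 (F x)) :=
    ((hF x hx).mono (subset_closure.trans hcl)).tendsto
  refine h1.congr' ?_
  filter_upwards [self_mem_nhdsWithin] with y hy
  exact (hd y hy).fderiv.symm

/-- A continuous function whose partial derivatives off the interface extend continuously is
continuously differentiable. -/
theorem contDiffOn_of_Off {f : E n → ℝ} {A : Fin n → E n → ℝ} (hf : ContinuousOn f {0}ᶜ)
    (hd : ∀ x ∈ Off l, DifferentiableAt ℝ f x) (hA : ∀ i, ContinuousOn (A i) {0}ᶜ)
    (heq : ∀ x ∈ Off l, ∀ i, pd i f x = A i x) :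
    ContDiffOn ℝ 1 f {0}ᶜ ∧ ∀ x, x ≠ 0 → ∀ i, pd i f x = A i x := by
  set F : E n → E n →L[ℝ] ℝ := fun x => ∑ i, A i x • (EuclideanSpace.proj i : E n →L[ℝ] ℝ) with hFd
  have hF : ContinuousOn F {0}ᶜ :=
    continuousOn_finsetSum _ fun i _ => (hA i).smul continuousOn_const
  have hoff : ∀ x ∈ Off l, HasFDerivAt f (F x) x := by
    intro x hx
    have : fderiv ℝ f x = F x := by
      ext v
      rw [fderiv_eq_sum]
      simp [hFd, heq x hx, mul_comm]
    exact this ▸ (hd x hx).hasFDerivAt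
  have hall : ∀ x, x ≠ 0 → HasFDerivAt f (F x) x := by
    intro x hx
    set B := Metric.ball x (‖x‖ / 2) with hB
    have hxp : 0 < ‖x‖ := norm_pos_iff.2 hx
    have hcl : ∀ s ⊆ B, closure s ⊆ {0}ᶜ := by
      intro s hs y hy h0
      have : y ∈ Metric.closedBall x (‖x‖ / 2) :=
        Metric.closure_ball_subset_closedBall (closure_mono hs hy)
      rw [mem_singleton_iff.1 h0, Metric.mem_closedBall, dist_zero_left] at this
      linarith
    have hl : IsLinearMap ℝ (fun x : E n => x l) := ⟨fun _ _ => rfl, fun _ _ => rfl⟩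
    have h1 := hasFDerivWithinAt_side hf hF (s := B ∩ {y | 0 < y l})
      (Metric.isOpen_ball.inter (isOpen_lt continuous_const (continuous_coord l)))
      ((convex_ball _ _).inter (convex_halfSpace_gt hl 0)) (fun y hy => hoff y hy.2.ne') hx
      (hcl _ inter_subset_left)
    have h2 := hasFDerivWithinAt_side hf hF (s := B ∩ {y | y l < 0})
      (Metric.isOpen_ball.inter (isOpen_lt (continuous_coord l) continuous_const))
      ((convex_ball _ _).inter (convex_halfSpace_lt hl 0)) (fun y hy => hoff y hy.2.ne) hx
      (hcl _ inter_subset_left)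
    refine (h1.union h2).hasFDerivAt ?_
    rw [← closure_union, ← inter_union_distrib_left]
    have : {y : E n | 0 < y l} ∪ {y | y l < 0} = Off l := by
      ext y; simp [Off, lt_or_lt_iff_ne, ne_comm]
    rw [this]
    exact Filter.mem_of_superset (Metric.ball_mem_nhds x (by linarith))
      ((dense_Off l).open_subset_closure_inter Metric.isOpen_ball)
  refine ⟨?_, fun x hx i => ?_⟩
  · rw [show (1 : WithTop ℕ∞) = 0 + 1 by norm_num,
      contDiffOn_succ_iff_fderiv_of_isOpen isOpen_compl_singleton]
    refine ⟨fun x hx => (hall x hx).differentiableAt.differentiableWithinAt, by simp, ?_⟩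
    rw [contDiffOn_zero]
    exact hF.congr fun x hx => (hall x hx).fderiv
  · simp only [pd]
    rw [(hall x hx).fderiv]
    simp [hFd]

/-- Reflection of a function from the closed half space. -/
theorem continuousOn_reflect {a : E n → ℝ} {s : ℝ}
    (ha : ContinuousOn a ({x | 0 ≤ x l} \ {0}))
    (hs : ∀ x, x l = 0 → x ≠ 0 → a x = s * a x) :
    ContinuousOn (fun x => if 0 ≤ x l then a x else s * a (mirror l x)) {0}ᶜ := by
  have h1 : ContinuousOn (fun x => if 0 ≤ x l then a x else s * a (mirror l x))
      ({x | 0 ≤ x l} ∩ {0}ᶜ) := by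
    rw [← sdiff_eq]
    exact ha.congr fun x hx => if_pos hx.1
  have h2 : ContinuousOn (fun x => if 0 ≤ x l then a x else s * a (mirror l x))
      ({x | x l ≤ 0} ∩ {0}ᶜ) := by
    have : ContinuousOn (fun x => s * a (mirror l x)) ({x | x l ≤ 0} ∩ {0}ᶜ) := by
      refine continuousOn_const.mul (ha.comp (mirror l).continuous.continuousOn ?_)
      rintro x ⟨hx, hx0⟩
      refine ⟨?_, by simpa using hx0⟩
      simp only [mem_ofPred_eq, mirror_last] at hx ⊢
      linarith
    refine this.congr fun x hx => ?_
    by_cases h : 0 ≤ x l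
    · have h0 : x l = 0 := le_antisymm hx.1 h
      simp only [h, if_true]
      rw [mirror_eq l h0]
      exact hs x h0 hx.2
    · simp [h]
  intro x hx
  have hcl1 : IsClosed {x : E n | 0 ≤ x l} := isClosed_le continuous_const (continuous_coord l)
  have hcl2 : IsClosed {x : E n | x l ≤ 0} := isClosed_le (continuous_coord l) continuous_const
  have hn : ({0}ᶜ : Set (E n)) = ({x | 0 ≤ x l} ∩ {0}ᶜ) ∪ ({x | x l ≤ 0} ∩ {0}ᶜ) := by
    rw [← union_inter_distrib_right]
    have : {x : E n | 0 ≤ x l} ∪ {x | x l ≤ 0} = univ := by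
      ext x; simp [le_total]
    rw [this, univ_inter]
  rw [hn]
  refine ContinuousWithinAt.union ?_ ?_
  · by_cases h : 0 ≤ x l
    · exact h1 x ⟨h, hx⟩
    · have : x ∉ closure ({x | 0 ≤ x l} ∩ {0}ᶜ) := fun h' =>
        h (hcl1.closure_subset (closure_mono inter_subset_left h'))
      exact continuousWithinAt_of_notMem_closure this
  · by_cases h : x l ≤ 0
    · exact h2 x ⟨h, hx⟩
    · have : x ∉ closure ({x | x l ≤ 0} ∩ {0}ᶜ) := fun h' =>
        h (hcl2.closure_subset (closure_mono inter_subset_left h'))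
      exact continuousWithinAt_of_notMem_closure this

end

/-- Classical solutions of the steady Navier-Stokes equations. -/
structure ClassSol (Ω : Set (E n)) (U : Fin n → E n → ℝ) (P : E n → ℝ) : Prop where
  smU : ∀ j, ContDiffOn ℝ 3 (U j) Ω
  smP : ContDiffOn ℝ 2 P Ω
  ns : ∀ x ∈ Ω, ∀ j, lap (U j) x = conv U j x + pd j P x
  div : ∀ x ∈ Ω, ∑ i, pd i (U i) x = 0

section

variable {Ω : Set (E n)} {U : Fin n → E n → ℝ} {P φ : E n → ℝ} {x : E n}

lemma ClassSol.sm2 (h : ClassSol Ω U P) (hΩ : IsOpen Ω) (i j : Fin n) :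
    ContDiffOn ℝ 2 (pd i (U j)) Ω := contDiffOn_pd hΩ (h.smU j) (by norm_num)

lemma ClassSol.sm1 (h : ClassSol Ω U P) (hΩ : IsOpen Ω) (k i j : Fin n) :
    ContDiffOn ℝ 1 (pd k (pd i (U j))) Ω := contDiffOn_pd hΩ (h.sm2 hΩ i j) (by norm_num)

lemma ClassSol.smv (h : ClassSol Ω U P) (hΩ : IsOpen Ω) (i j : Fin n) :
    ContDiffOn ℝ 2 (vort U i j) Ω := (h.sm2 hΩ i j).sub (h.sm2 hΩ j i)

lemma ClassSol.smc (h : ClassSol Ω U P) (hΩ : IsOpen Ω) (j : Fin n) :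
    ContDiffOn ℝ 2 (conv U j) Ω :=
  ContDiffOn.sum fun i _ => ((h.smU i).of_le (by norm_num)).mul (h.sm2 hΩ i j)

lemma ClassSol.dU (h : ClassSol Ω U P) (hΩ : IsOpen Ω) (hx : x ∈ Ω) (j : Fin n) :
    DifferentiableAt ℝ (U j) x := diffAt hΩ ((h.smU j).of_le (by norm_num)) hx

lemma ClassSol.ddU (h : ClassSol Ω U P) (hΩ : IsOpen Ω) (hx : x ∈ Ω) (i j : Fin n) :
    DifferentiableAt ℝ (pd i (U j)) x := diffAt hΩ ((h.sm2 hΩ i j).of_le (by norm_num)) hx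

lemma ClassSol.dddU (h : ClassSol Ω U P) (hΩ : IsOpen Ω) (hx : x ∈ Ω) (k i j : Fin n) :
    DifferentiableAt ℝ (pd k (pd i (U j))) x := diffAt hΩ (h.sm1 hΩ k i j) hx

lemma ClassSol.pd_div (h : ClassSol Ω U P) (hΩ : IsOpen Ω) (hx : x ∈ Ω) (k : Fin n) :
    ∑ i, pd k (pd i (U i)) x = 0 := by
  rw [← pd_sum fun i _ => h.ddU hΩ hx i i, pd_congr_open hΩ hx (g := fun _ => 0) h.div, pd_const]

lemma ClassSol.pd_pd_div (h : ClassSol Ω U P) (hΩ : IsOpen Ω) (hx : x ∈ Ω) (m k : Fin n) :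
    ∑ i, pd m (pd k (pd i (U i))) x = 0 := by
  rw [← pd_sum fun i _ => h.dddU hΩ hx k i i,
    pd_congr_open hΩ hx (g := fun _ => 0) (fun y hy => h.pd_div hΩ hy k), pd_const]

lemma ClassSol.div_vort (h : ClassSol Ω U P) (hΩ : IsOpen Ω) (hx : x ∈ Ω) (j : Fin n) :
    ∑ i, pd i (vort U i j) x = conv U j x + pd j P x := by
  have e : ∀ i, pd i (vort U i j) x = pd i (pd i (U j)) x - pd j (pd i (U i)) x := by
    intro i
    rw [show vort U i j = fun y => pd i (U j) y - pd j (U i) y from rfl,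
      pd_sub (h.ddU hΩ hx i j) (h.ddU hΩ hx j i),
      pd_comm hΩ ((h.smU i).of_le (by norm_num)) hx i j]
  simp only [e, Finset.sum_sub_distrib, h.pd_div hΩ hx j, sub_zero]
  exact h.ns x hx j

lemma ClassSol.div_conv (h : ClassSol Ω U P) (hΩ : IsOpen Ω) (hx : x ∈ Ω) :
    ∑ j, pd j (conv U j) x = src U x := by
  have e : ∀ j, pd j (conv U j) x =
      ∑ i, (pd j (U i) x * pd i (U j) x + U i x * pd i (pd j (U j)) x) := by
    intro j
    rw [show conv U j = fun y => ∑ i, U i y * pd i (U j) y from rfl,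
      pd_sum fun i _ => (h.dU hΩ hx i).fun_mul (h.ddU hΩ hx i j)]
    refine Finset.sum_congr rfl fun i _ => ?_
    rw [pd_mul (h.dU hΩ hx i) (h.ddU hΩ hx i j),
      pd_comm hΩ ((h.smU j).of_le (by norm_num)) hx j i]
  simp only [e, Finset.sum_add_distrib]
  rw [Finset.sum_comm (f := fun j i => U i x * pd i (pd j (U j)) x)]
  simp only [← Finset.mul_sum, h.pd_div hΩ hx, mul_zero, Finset.sum_const_zero, add_zero]
  rfl

lemma ClassSol.lap_P (h : ClassSol Ω U P) (hΩ : IsOpen Ω) (hx : x ∈ Ω) :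
    lap P x = - src U x := by
  have hdP : ∀ j, DifferentiableAt ℝ (pd j P) x := fun j =>
    diffAt hΩ (contDiffOn_pd hΩ h.smP (by norm_num)) hx
  have hdc : ∀ j, DifferentiableAt ℝ (conv U j) x := fun j =>
    diffAt hΩ ((h.smc hΩ j).of_le (by norm_num)) hx
  have e : ∀ j, pd j (pd j P) x = ∑ i, pd i (pd i (pd j (U j))) x - pd j (conv U j) x := by
    intro j
    have e1 : pd j (lap (U j)) x = pd j (fun y => conv U j y + pd j P y) x :=
      pd_congr_open hΩ hx fun y hy => h.ns y hy j
    rw [pd_add (hdc j) (hdP j), show lap (U j) = fun y => ∑ i, pd i (pd i (U j)) y from rfl,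
      pd_sum fun i _ => h.dddU hΩ hx i i j] at e1
    have e2 : ∀ i, pd j (pd i (pd i (U j))) x = pd i (pd i (pd j (U j))) x := by
      intro i
      rw [pd_comm hΩ (h.sm2 hΩ i j) hx j i]
      exact pd_congr_open hΩ hx fun y hy => pd_comm hΩ ((h.smU j).of_le (by norm_num)) hy j i
    simp only [e2] at e1
    linarith
  rw [lap]
  simp only [e, Finset.sum_sub_distrib, h.div_conv hΩ hx]
  rw [Finset.sum_comm]
  simp [h.pd_pd_div hΩ hx]

lemma sum_pd_mul {A : Fin n → E n → ℝ} (hφ : DifferentiableAt ℝ φ x)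
    (hA : ∀ i, DifferentiableAt ℝ (A i) x) :
    ∑ i, pd i (fun y => A i y * φ y) x =
      ∑ i, A i x * pd i φ x + (∑ i, pd i (A i) x) * φ x := by
  rw [Finset.sum_mul, ← Finset.sum_add_distrib]
  refine Finset.sum_congr rfl fun i _ => ?_
  rw [pd_mul (hA i) hφ]; ring

/-- Classical solutions are weak solutions. -/
theorem ClassSol.weakSol (h : ClassSol Ω U P) (hΩ : IsOpen Ω) : WeakSol Ω U P := by
  have hU : ∀ j, ContDiffOn ℝ 1 (U j) Ω := fun j => (h.smU j).of_le (by norm_num)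
  have hP : ContDiffOn ℝ 1 P Ω := h.smP.of_le (by norm_num)
  have key : ∀ (A : Fin n → E n → ℝ) (a : E n → ℝ), (∀ i, ContDiffOn ℝ 1 (A i) Ω) →
      (∀ x ∈ Ω, ∑ i, pd i (A i) x = a x) → ContinuousOn a Ω → ∀ φ, Test Ω φ →
      ∫ x in Ω, ∑ i, A i x * pd i φ x = - ∫ x in Ω, a x * φ x := by
    intro A a hA ha hac φ hφ
    have hz := integral_div_zero hΩ (V := fun i y => A i y * φ y)
      (g := fun x => ∑ i, A i x * pd i φ x + a x * φ x) (fun i => hφ.mul_left hΩ (hA i)) (by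
        intro x hx
        rw [sum_pd_mul (hφ.diff x) fun i => diffAt hΩ (hA i) hx, ha x hx])
    have c1 : CC Ω (fun x => ∑ i, A i x * pd i φ x) :=
      CC.sum fun i _ => (hφ.pd_cc i).mul_left hΩ (hA i).continuousOn
    have c2 : CC Ω (fun x => a x * φ x) := hφ.cc.mul_left hΩ hac
    rw [integral_add c1.integrableOn c2.integrableOn] at hz
    linarith
  have hcc : ∀ j, ContinuousOn (fun x => conv U j x + pd j P x) Ω := fun j =>
    (continuousOn_conv hΩ hU j).add (continuousOn_pd hΩ hP)
  refine ⟨hU, hP, h.div, fun φ hφ j => ?_, fun φ hφ j => ?_, fun φ hφ => ?_⟩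
  · exact key (fun i => pd i (U j)) _ (fun i => (h.sm2 hΩ i j).of_le (by norm_num))
      (fun x hx => h.ns x hx j) (hcc j) φ hφ
  · exact key (fun i => vort U i j) _ (fun i => (h.smv hΩ i j).of_le (by norm_num))
      (fun x hx => h.div_vort hΩ hx j) (hcc j) φ hφ
  · rw [key (fun i => pd i P) _ (fun i => contDiffOn_pd hΩ h.smP (by norm_num))
      (fun x hx => h.lap_P hΩ hx) (continuousOn_src hΩ hU).neg φ hφ, ← integral_neg]
    simp

/-- Classical solutions off the interface, continuously differentiable across it, with even
pressure. -/
structure ReflSol (l : Fin n) (U : Fin n → E n → ℝ) (P : E n → ℝ) : Prop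
    extends ClassSol (Off l) U P where
  regU : ∀ j, ContDiffOn ℝ 1 (U j) {0}ᶜ
  symP : ∀ x, P (mirror l x) = P x

end

/-- Closed annuli. -/
def Ann (n : ℕ) (r R : ℝ) : Set (E n) := {x | r ≤ ‖x‖ ∧ ‖x‖ ≤ R}

lemma isCompact_Ann (r R : ℝ) : IsCompact (Ann n r R) := by
  have : Ann n r R = Metric.closedBall 0 R ∩ {x | r ≤ ‖x‖} := by
    ext x; simp [Ann, and_comm]
  rw [this]
  exact (isCompact_closedBall 0 R).inter_right (isClosed_le continuous_const continuous_norm)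

lemma Ann_subset {r R : ℝ} (hr : 0 < r) : Ann n r R ⊆ {0}ᶜ := by
  rintro x hx h0
  rw [mem_singleton_iff.1 h0] at hx
  have := hx.1
  simp at this; linarith

section

variable {l : Fin n} {U : Fin n → E n → ℝ} {P : E n → ℝ}

lemma ReflSol.pd_P_le (h : ReflSol l U P) {r : ℝ} (hr : 0 < r) (R : ℝ) :
    ∃ c, 0 ≤ c ∧ ∀ y : E n, 2 * r ≤ ‖y‖ → ‖y‖ ≤ R → 0 < y l → y l ≤ 2 * r →
      |pd l P y| ≤ c / y l := by
  have hn : 1 ≤ n := l.pos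
  obtain ⟨η, β, hm⟩ := exists_moll hn
  obtain ⟨c0, hc0, H⟩ := WeakSol.pd_P_le hm l
  have hop : IsOpen ({0}ᶜ : Set (E n)) := isOpen_compl_singleton
  have hcomp := isCompact_Ann (n := n) r (R + r)
  have hsub := Ann_subset (n := n) (R := R + r) hr
  obtain ⟨b1, h1⟩ := hcomp.exists_bound_of_continuousOn
    ((continuousOn_conv hop h.regU l).mono hsub)
  obtain ⟨b2, h2⟩ := hcomp.exists_bound_of_continuousOn ((continuousOn_src hop h.regU).mono hsub)
  have h3 : ∀ i, ∃ b, ∀ y ∈ Ann n r (R + r), ‖pd i (U l) y‖ ≤ b := fun i =>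
    hcomp.exists_bound_of_continuousOn ((continuousOn_pd hop (h.regU l)).mono hsub)
  choose b3 h3 using h3
  set B := |b1| + |b2| + ∑ i, |b3 i| with hB
  have hs0 : 0 ≤ ∑ i, |b3 i| := Finset.sum_nonneg fun i _ => abs_nonneg _
  have hB0 : 0 ≤ B := by positivity
  have g1 : ∀ y ∈ Ann n r (R + r), |conv U l y| ≤ B := fun y hy =>
    (h1 y hy).trans (by linarith [le_abs_self b1, abs_nonneg b2])
  have g2 : ∀ y ∈ Ann n r (R + r), |src U y| ≤ B := fun y hy =>
    (h2 y hy).trans (by linarith [le_abs_self b2, abs_nonneg b1])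
  have g3 : ∀ i, ∀ y ∈ Ann n r (R + r), |pd i (U l) y| ≤ B := fun i y hy =>
    (h3 i y hy).trans (by
      have := Finset.single_le_sum (f := fun i => |b3 i|) (fun i _ => abs_nonneg _)
        (Finset.mem_univ i)
      linarith [le_abs_self (b3 i), abs_nonneg b1, abs_nonneg b2])
  refine ⟨c0 * (B * (4 + 2 * r + r ^ 2)), by positivity, fun y hy1 hy2 hy0 hyr => ?_⟩
  have hball : ∀ z ∈ Metric.closedBall y (2 * (y l / 4)), z ∈ Ann n r (R + r) ∧ z ∈ Off l := by
    intro z hz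
    rw [Metric.mem_closedBall, dist_eq_norm] at hz
    have hzl : |(z - y) l| ≤ 2 * (y l / 4) := (abs_coord_le _ l).trans hz
    have e1 : ‖y‖ - ‖z‖ ≤ ‖z - y‖ := by rw [norm_sub_rev]; exact norm_sub_norm_le y z
    have e2 : ‖z‖ - ‖y‖ ≤ ‖z - y‖ := norm_sub_norm_le z y
    refine ⟨⟨by linarith, by linarith⟩, ?_⟩
    rw [PiLp.sub_apply] at hzl
    have := (abs_le.1 hzl).1
    exact (show 0 < z l by linarith).ne'
  have key := (H (h.weakSol (isOpen_Off l)) (isOpen_Off l) (x := y) (ρ := y l / 4) (f := B) (g := B)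
    (by positivity) (fun z hz => (hball z hz).2) (fun z hz => g1 z (hball z hz).1)
    (fun z hz => g2 z (hball z hz).1)).2 B (fun i z hz => g3 i z (hball z hz).1)
  refine key.trans ?_
  rw [mul_div_assoc]
  refine mul_le_mul_of_nonneg_left ?_ hc0
  rw [le_div_iff₀ hy0]
  have e : (B / (y l / 4) + B + B * (y l / 4)) * y l = B * (4 + y l + y l ^ 2 / 4) := by
    field_simp
  rw [e]
  refine mul_le_mul_of_nonneg_left ?_ hB0
  nlinarith

lemma hasDerivAt_line {f : E n → ℝ} {x : E n} {t : ℝ} {i : Fin n}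
    (hf : DifferentiableAt ℝ f (x + t • EuclideanSpace.single i 1)) :
    HasDerivAt (fun t : ℝ => f (x + t • EuclideanSpace.single i 1))
      (pd i f (x + t • EuclideanSpace.single i 1)) t := by
  have h1 : HasDerivAt (fun t : ℝ => x + t • EuclideanSpace.single i (1:ℝ))
      (EuclideanSpace.single i (1:ℝ)) t := by
    simpa using ((hasDerivAt_id t).smul_const (EuclideanSpace.single i (1:ℝ))).const_add x
  exact hf.hasFDerivAt.comp_hasDerivAt t h1

/-- Logarithmic bound for the pressure near the interface. -/
theorem ReflSol.abs_P_le (h : ReflSol l U P) {r : ℝ} (hr : 0 < r) (R : ℝ) :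
    ∃ K c, 0 ≤ K ∧ 0 ≤ c ∧ ∀ x ∈ Ann n r R, x ∈ Off l → |P x| ≤ K + c * |Real.log (x l)| := by
  obtain ⟨c, hc, H⟩ := h.pd_P_le (r := r / 4) (by positivity) (R + r)
  have hcomp : IsCompact (Ann n (r / 2) (R + r) ∩ {x | r / 4 ≤ x l}) :=
    (isCompact_Ann _ _).inter_right (isClosed_le continuous_const (continuous_coord l))
  obtain ⟨K, hK⟩ := hcomp.exists_bound_of_continuousOn (f := P)
    (h.smP.continuousOn.mono fun x hx => (show 0 < x l from by have := hx.2; simp at this; linarith).ne')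
  have hpos : ∀ x ∈ Ann n r R, 0 < x l →
      |P x| ≤ (|K| + c * |Real.log (r / 4)|) + c * |Real.log (x l)| := by
    intro x hx hxl
    have hcl : 0 ≤ c * |Real.log (r / 4)| := by positivity
    have hcx : 0 ≤ c * |Real.log (x l)| := by positivity
    by_cases hbig : r / 4 ≤ x l
    · have := hK x ⟨⟨by linarith [hx.1], by linarith [hx.2]⟩, hbig⟩
      rw [Real.norm_eq_abs] at this
      linarith [le_abs_self K]
    push Not at hbig
    set e : E n := EuclideanSpace.single l 1 with he
    have hyl : ∀ t : ℝ, (x + t • e) l = x l + t := by intro t; simp [he]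
    have hyn : ∀ t : ℝ, 0 ≤ t → t ≤ r / 4 → r / 2 ≤ ‖x + t • e‖ ∧ ‖x + t • e‖ ≤ R + r := by
      intro t h0 h1
      have ht : ‖t • e‖ ≤ r / 4 := by rw [norm_smul, Real.norm_of_nonneg h0]; simpa [he] using h1
      have a1 := norm_add_le x (t • e)
      have a2 := norm_sub_norm_le x (-(t • e))
      rw [sub_neg_eq_add, norm_neg] at a2
      exact ⟨by linarith [hx.1], by linarith [hx.2]⟩
    have hd : ∀ t : ℝ, 0 ≤ t → HasDerivAt (fun t : ℝ => P (x + t • e)) (pd l P (x + t • e)) t := by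
      intro t ht
      refine hasDerivAt_line (diffAt (isOpen_Off l) (h.smP.of_le (by norm_num)) ?_)
      exact (show 0 < (x + t • e) l by rw [hyl]; linarith).ne'
    have hlog : ∀ t : ℝ, 0 ≤ t → HasDerivAt (fun t => c * (Real.log (x l + t) - Real.log (x l)))
        (c * (x l + t)⁻¹) t := by
      intro t ht
      have h1 : HasDerivAt (fun t => x l + t) 1 t := (hasDerivAt_id t).const_add _
      have := ((h1.log (by linarith : x l + t ≠ 0)).sub_const (Real.log (x l))).const_mul c
      exact this.congr_deriv (by rw [one_div])
    have key := image_norm_le_of_norm_deriv_right_le_deriv_boundary'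
      (a := 0) (b := r / 4 - x l) (f := fun t : ℝ => P (x + t • e) - P x)
      (f' := fun t => pd l P (x + t • e))
      (B := fun t => c * (Real.log (x l + t) - Real.log (x l))) (B' := fun t => c * (x l + t)⁻¹)
      (fun t ht => ((hd t ht.1).sub_const _).continuousAt.continuousWithinAt)
      (fun t ht => ((hd t ht.1).sub_const _).hasDerivWithinAt) (by simp)
      (fun t ht => (hlog t ht.1).continuousAt.continuousWithinAt)
      (fun t ht => (hlog t ht.1).hasDerivWithinAt)
      (fun t ht => by
        have hn := hyn t ht.1 (by linarith [ht.2])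
        have := H (x + t • e) (by linarith) hn.2 (by rw [hyl]; linarith [ht.1])
          (by rw [hyl]; linarith [ht.2])
        rwa [hyl, div_eq_mul_inv] at this)
      (right_mem_Icc.2 (by linarith))
    dsimp only at key
    rw [Real.norm_eq_abs, add_sub_cancel] at key
    have hn := hyn (r / 4 - x l) (by linarith) (by linarith)
    have hk := hK (x + (r / 4 - x l) • e) ⟨hn, by simp only [mem_ofPred_eq]; rw [hyl]; linarith⟩
    rw [Real.norm_eq_abs] at hk
    have k1 : c * (Real.log (r / 4) - Real.log (x l)) ≤ c * |Real.log (r / 4)| + c * |Real.log (x l)| := by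
      rw [← mul_add]
      exact mul_le_mul_of_nonneg_left (by
        linarith [le_abs_self (Real.log (r / 4)), neg_abs_le (Real.log (x l))]) hc
    have k2 := abs_sub_abs_le_abs_sub (P x) (P (x + (r / 4 - x l) • e))
    rw [abs_sub_comm] at k2
    linarith [le_abs_self K]
  refine ⟨|K| + c * |Real.log (r / 4)|, c, by positivity, hc, fun x hx hxo => ?_⟩
  rcases lt_or_gt_of_ne (show x l ≠ 0 from hxo) with hneg | hp
  · have := hpos (mirror l x) (by simpa [Ann] using hx) (by rw [mirror_last]; linarith)
    rwa [h.symP, mirror_last, Real.log_neg_eq_log] at this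
  · exact hpos x hx hp

lemma ReflSol.aestronglyMeasurable (h : ReflSol l U P) :
    AEStronglyMeasurable P (volume : Measure (E n)) := by
  have := h.smP.continuousOn.aestronglyMeasurable (μ := volume) (isOpen_Off l).measurableSet
  rwa [Measure.restrict_eq_self_of_ae_mem (ae_mem_Off l)] at this

theorem ReflSol.integrableOn_P (h : ReflSol l U P) {r : ℝ} (hr : 0 < r) (R : ℝ) :
    IntegrableOn P (Ann n r R) := by
  obtain ⟨K, c, hK, hc, H⟩ := h.abs_P_le hr R
  have hsub : Ann n r R ⊆ Metric.closedBall 0 R := fun x hx => by simpa using hx.2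
  have hlog : IntegrableOn Real.log (Icc (-R) R) := by
    by_cases hR : -R ≤ R
    · rw [integrableOn_Icc_iff_integrableOn_Ioc, ← intervalIntegrable_iff_integrableOn_Ioc_of_le hR]
      exact intervalIntegral.intervalIntegrable_log'
    · rw [Icc_eq_empty hR]; exact integrableOn_empty
  have h1 := ((integrableOn_coord l hlog).1.mono_set hsub).abs
  have h2 : IntegrableOn (fun x => K + c * |Real.log (x l)|) (Ann n r R) :=
    (integrableOn_const (isCompact_Ann r R).measure_lt_top.ne).add (h1.const_mul c)
  refine Integrable.mono' h2 h.aestronglyMeasurable.restrict ?_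
  filter_upwards [ae_restrict_mem (isCompact_Ann r R).measurableSet,
    ae_restrict_of_ae (ae_mem_Off l)] with x hx hxo
  exact H x hx hxo

end

section

variable {l : Fin n} {U : Fin n → E n → ℝ} {P : E n → ℝ}

lemma CC.slab {Ω : Set (E n)} {f : E n → ℝ} (hf : CC Ω f) {δ : ℝ} (hδ : 0 < δ) :
    ∃ ε : ℝ, 0 < ε ∧ ∀ x, |x l| < ε → |f x - f (mirror l x)| ≤ δ := by
  have := hf.cont.uniformContinuous_of_tendsto_cocompact (x := 0) hf.compact.is_zero_at_infty
  obtain ⟨ε, hε, H⟩ := Metric.uniformContinuous_iff.1 this δ hδ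
  refine ⟨ε / 2, by positivity, fun x hx => ?_⟩
  have := H (a := x) (b := mirror l x) (by rw [dist_eq_norm, norm_sub_mirror]; linarith)
  rw [Real.dist_eq] at this
  exact this.le

lemma CC.exists_Ann {f : E n → ℝ} (hf : CC {0}ᶜ f) :
    ∃ r R, 0 < r ∧ tsupport f ⊆ Ann n r R := by
  obtain ⟨R, hR⟩ := hf.compact.isCompact.isBounded.exists_norm_le
  have hn : (tsupport f)ᶜ ∈ 𝓝 (0 : E n) :=
    (isClosed_tsupport f).isOpen_compl.mem_nhds fun h => hf.sub h rfl
  obtain ⟨r, hr, H⟩ := Metric.mem_nhds_iff.1 hn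
  refine ⟨r, R, hr, fun x hx => ⟨?_, hR x hx⟩⟩
  by_contra hlt
  exact H (show x ∈ Metric.ball 0 r by simpa using hlt) hx

lemma slab_log {K c L δ : ℝ} (hδ : 0 < δ) :
    ∃ ε : ℝ, 0 < ε ∧ ∀ t : ℝ, |t| < ε → (K + c * |Real.log t|) * (L * (2 * |t|)) ≤ δ := by
  have hc : Continuous fun t : ℝ => 2 * L * (K * |t| + c * |t * Real.log t|) :=
    continuous_const.mul ((continuous_const.mul continuous_abs).add
      (continuous_const.mul Real.continuous_mul_log.abs))
  have h0 := hc.tendsto 0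
  simp only [abs_zero, mul_zero, zero_mul, add_zero] at h0
  obtain ⟨ε, hε, H⟩ := Metric.eventually_nhds_iff.1 (h0.eventually_le_const hδ)
  refine ⟨ε, hε, fun t ht => ?_⟩
  have := H (y := t) (by rwa [Real.dist_eq, sub_zero])
  rw [abs_mul] at this
  linarith

lemma ReflSol.slab_P (h : ReflSol l U P) {f : E n → ℝ} (hf : Test {0}ᶜ f) {δ : ℝ} (hδ : 0 < δ) :
    ∃ ε : ℝ, 0 < ε ∧ ∀ x, x l ≠ 0 → |x l| < ε →
      |P x * f x - P (mirror l x) * f (mirror l x)| ≤ δ := by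
  obtain ⟨r, R, hr, hA⟩ := hf.cc.exists_Ann
  obtain ⟨K, c, hK, hc, H⟩ := h.abs_P_le hr R
  obtain ⟨L, hL⟩ := hf.smooth.lipschitzWith_of_hasCompactSupport hf.compact one_ne_zero
  obtain ⟨ε, hε, He⟩ := slab_log (K := K) (c := c) (L := L) hδ
  refine ⟨ε, hε, fun x hx hxε => ?_⟩
  rw [h.symP, ← mul_sub, abs_mul]
  by_cases hxA : x ∈ Ann n r R
  · refine le_trans ?_ (He _ hxε)
    have h2 := hL.dist_le_mul x (mirror l x)
    rw [Real.dist_eq, dist_eq_norm, norm_sub_mirror] at h2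
    exact mul_le_mul (H x hxA hx) h2 (abs_nonneg _) (by positivity)
  · have hm : mirror l x ∉ Ann n r R := by simpa [Ann] using hxA
    rw [image_eq_zero_of_notMem_tsupport fun h => hxA (hA h),
      image_eq_zero_of_notMem_tsupport fun h => hm (hA h)]
    simpa using hδ.le

lemma sum_vort_hess {U : Fin n → E n → ℝ} {ψ : E n → ℝ} (hψ : ContDiff ℝ 2 ψ)
    (x : E n) : ∑ i, ∑ j, vort U i j x * pd i (pd j ψ) x = 0 := by
  have h1 : ∑ i, ∑ j, vort U i j x * pd i (pd j ψ) x = - ∑ i, ∑ j, vort U i j x * pd i (pd j ψ) x := by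
    conv_lhs => rw [Finset.sum_comm]
    rw [← Finset.sum_neg_distrib]
    refine Finset.sum_congr rfl fun i _ => ?_
    rw [← Finset.sum_neg_distrib]
    refine Finset.sum_congr rfl fun j _ => ?_
    rw [pd_comm isOpen_univ hψ.contDiffOn (mem_univ x) j i]
    simp only [vort]; ring
  linarith

lemma ClassSol.pd_flux {Ω : Set (E n)} (h : ClassSol Ω U P) (hΩ : IsOpen Ω) {ψ : E n → ℝ}
    (hψ : ContDiff ℝ 2 ψ) {x : E n} (hx : x ∈ Ω) :
    P x * lap ψ x + src U x * ψ x = ∑ i, pd i (fun y => P y * pd i ψ y +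
      (conv U i y * ψ y - ∑ j, vort U i j y * pd j ψ y)) x := by
  have hd1 : DifferentiableAt ℝ ψ x := hψ.differentiable two_ne_zero x
  have hd2 : ∀ i, DifferentiableAt ℝ (pd i ψ) x := fun i =>
    (contDiff_pd (m := 1) hψ (by norm_num)).differentiable one_ne_zero x
  have hP : DifferentiableAt ℝ P x := diffAt hΩ (h.smP.of_le (by norm_num)) hx
  have hv : ∀ i j, DifferentiableAt ℝ (vort U i j) x := fun i j =>
    diffAt hΩ ((h.smv hΩ i j).of_le (by norm_num)) hx
  have hc : ∀ j, DifferentiableAt ℝ (conv U j) x := fun j =>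
    diffAt hΩ ((h.smc hΩ j).of_le (by norm_num)) hx
  have e : ∀ i, pd i (fun y => P y * pd i ψ y +
      (conv U i y * ψ y - ∑ j, vort U i j y * pd j ψ y)) x =
      (pd i P x * pd i ψ x + P x * pd i (pd i ψ) x) +
      (pd i (conv U i) x * ψ x + conv U i x * pd i ψ x -
        (∑ j, pd i (vort U i j) x * pd j ψ x + ∑ j, vort U i j x * pd i (pd j ψ) x)) := by
    intro i
    rw [pd_add (hP.fun_mul (hd2 i)) (((hc i).fun_mul hd1).fun_sub
        (DifferentiableAt.fun_sum fun j _ => (hv i j).fun_mul (hd2 j))),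
      pd_sub ((hc i).fun_mul hd1) (DifferentiableAt.fun_sum fun j _ => (hv i j).fun_mul (hd2 j)),
      pd_mul hP (hd2 i), pd_mul (hc i) hd1, pd_sum fun j _ => (hv i j).fun_mul (hd2 j),
      ← Finset.sum_add_distrib]
    congr 2
    refine Finset.sum_congr rfl fun j _ => ?_
    rw [pd_mul (hv i j) (hd2 j)]
  simp only [e, Finset.sum_add_distrib, Finset.sum_sub_distrib]
  rw [sum_vort_hess hψ, Finset.sum_comm (f := fun i j => pd i (vort U i j) x * pd j ψ x)]
  simp only [← Finset.sum_mul, h.div_vort hΩ hx, h.div_conv hΩ hx, add_mul, Finset.sum_add_distrib,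
    ← Finset.mul_sum]
  rw [show ∑ i, pd i (pd i ψ) x = lap ψ x from rfl]
  ring

/-- The pressure is a very weak solution of its Poisson equation across the interface. -/
theorem ReflSol.vweakP (h : ReflSol l U P) : VWeak {0}ᶜ P (fun x => - src U x) := by
  intro ψ hψ hcs hsub
  have hop : IsOpen ({0}ᶜ : Set (E n)) := isOpen_compl_singleton
  have hO := isOpen_Off l
  have hT : Test {0}ᶜ ψ := ⟨hψ.of_le (by norm_num), hcs, hsub⟩
  have hTp : ∀ i, Test {0}ᶜ (pd i ψ) := fun i => ⟨contDiff_pd hψ (by norm_num),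
    (hT.pd_cc i).compact, (hT.pd_cc i).sub⟩
  have hlap := cc_lap hψ hcs hsub
  have hsrc : CC {0}ᶜ (fun x => src U x * ψ x) := hT.cc.mul_left hop (continuousOn_src hop h.regU)
  obtain ⟨r, R, hr, hA⟩ := hT.cc.exists_Ann
  have hz : ∀ x, x ∉ Ann n r R → ψ x = 0 ∧ (∀ i, pd i ψ x = 0) ∧ lap ψ x = 0 := by
    intro x hx
    have h2 : ∀ i, pd i ψ x = 0 := fun i =>
      image_eq_zero_of_notMem_tsupport fun h => hx (hA (tsupport_pd ψ h))
    refine ⟨image_eq_zero_of_notMem_tsupport fun h => hx (hA h), h2, ?_⟩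
    exact Finset.sum_eq_zero fun i _ => image_eq_zero_of_notMem_tsupport fun h =>
      hx (hA (tsupport_pd ψ (tsupport_pd _ h)))
  obtain ⟨B, hB⟩ := hlap.cont.norm.bounded_above_of_compact_support hlap.compact.norm
  have hPi : Integrable (fun x => P x * lap ψ x) := by
    have h1 : IntegrableOn (fun x => P x * lap ψ x) (Ann n r R) :=
      Integrable.mul_bdd (c := B) (h.integrableOn_P hr R) hlap.cont.aestronglyMeasurable
        (Eventually.of_forall fun x => by simpa using hB x)
    exact (integrableOn_iff_integrable_of_support_subset fun x hx => by
      by_contra hxA; exact hx (by simp only [(hz x hxA).2.2, mul_zero])).1 h1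
  have hW : CC {0}ᶜ (fun y => conv U l y * ψ y - ∑ j, vort U l j y * pd j ψ y) :=
    (hT.cc.mul_left hop (continuousOn_conv hop h.regU l)).sub'
      (CC.sum fun j _ => (hTp j).cc.mul_left hop (continuousOn_vort hop h.regU l j))
  have key := integral_div_zero_interface (l := l) (R := R)
    (V := fun i y => P y * pd i ψ y + (conv U i y * ψ y - ∑ j, vort U i j y * pd j ψ y))
    (g := fun x => P x * lap ψ x + src U x * ψ x)
    (fun i => ((h.smP.of_le (by norm_num)).mul (hTp i).smooth.contDiffOn).add
      ((((h.smc hO i).of_le (by norm_num)).mul hT.smooth.contDiffOn).sub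
        (ContDiffOn.sum fun j _ => ((h.smv hO i j).of_le (by norm_num)).mul
          (hTp j).smooth.contDiffOn)))
    (fun i x hx => by
      have := hz x fun hxA => by linarith [hxA.2]
      simp [this.1, this.2.1])
    (fun x hx => h.pd_flux hO hψ hx) (hPi.add hsrc.integrable)
    (fun δ hδ => by
      obtain ⟨ε₁, h1, H1⟩ := h.slab_P (hTp l) (half_pos hδ)
      obtain ⟨ε₂, h2, H2⟩ := hW.slab (l := l) (half_pos hδ)
      refine ⟨min ε₁ ε₂, lt_min h1 h2, fun x hx hxε => ?_⟩
      have a1 := H1 x hx (hxε.trans_le (min_le_left _ _))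
      have a2 := H2 x (hxε.trans_le (min_le_right _ _))
      rw [add_sub_add_comm]
      exact (abs_add_le _ _).trans (by linarith))
  rw [integral_add hPi hsrc.integrable] at key
  have e1 : ∫ x in ({0}ᶜ : Set (E n)), P x * lap ψ x = ∫ x, P x * lap ψ x :=
    setIntegral_eq_integral_of_forall_compl_eq_zero fun x hx => by rw [hlap.eq_zero hx, mul_zero]
  simp only [neg_mul]
  rw [e1, integral_neg, hsrc.setIntegral]
  linarith

end

lemma closedBall_subset_Ann {x x₀ : E n} {ρ : ℝ} (hρ : ρ = ‖x₀‖ / 4) (hx : x ∈ Metric.ball x₀ ρ) :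
    Metric.closedBall x ρ ⊆ Ann n (‖x₀‖ / 2) (2 * ‖x₀‖) := by
  intro z hz
  rw [Metric.mem_ball, dist_eq_norm] at hx
  rw [Metric.mem_closedBall, dist_eq_norm] at hz
  have h0 : ‖z - x₀‖ ≤ ‖x₀‖ / 2 := by
    have := norm_add_le (z - x) (x - x₀)
    rw [sub_add_sub_cancel] at this
    linarith
  have e1 : ‖x₀‖ - ‖z‖ ≤ ‖z - x₀‖ := by rw [norm_sub_rev]; exact norm_sub_norm_le x₀ z
  have e2 : ‖z‖ - ‖x₀‖ ≤ ‖z - x₀‖ := norm_sub_norm_le z x₀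
  exact ⟨by linarith, by linarith [norm_nonneg x₀]⟩

lemma continuousAt_Av {m : ℕ} {κ f : E n → ℝ} (hκ : Continuous κ) (hs : ∀ z, 1 ≤ ‖z‖ → κ z = 0)
    {x₀ : E n} {ρ t : ℝ} (hρ : ρ = ‖x₀‖ / 4)
    (hf : IntegrableOn f (Ann n (‖x₀‖ / 2) (2 * ‖x₀‖))) (ht : 0 < t) (htρ : t < ρ) :
    ContinuousAt (fun x => Av m κ f x t) x₀ := by
  set A := Ann n (‖x₀‖ / 2) (2 * ‖x₀‖) with hA
  have hAm : MeasurableSet A := (isCompact_Ann _ _).measurableSet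
  set k : E n → ℝ := fun z => t⁻¹ ^ m * κ (t⁻¹ • z) with hk
  have hkc : Continuous k := continuous_const.mul (hκ.comp (continuous_const_smul _))
  have hkz : ∀ z, t ≤ ‖z‖ → k z = 0 := by
    intro z hz
    have : κ (t⁻¹ • z) = 0 := hs _ (by
      rw [norm_smul, norm_inv, Real.norm_of_nonneg ht.le, inv_mul_eq_div, le_div_iff₀ ht, one_mul]
      exact hz)
    simp only [hk, this, mul_zero]
  have hks : HasCompactSupport k := HasCompactSupport.intro (isCompact_closedBall 0 t) fun z hz => by
    rw [mem_closedBall_zero_iff, not_le] at hz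
    exact hkz z hz.le
  have hI : Integrable (A.indicator f) := (integrable_indicator_iff hAm).2 hf
  have hc := (hks.continuous_convolution_right (ContinuousLinearMap.mul ℝ ℝ)
    hI.locallyIntegrable hkc).continuousAt (x := x₀)
  refine hc.congr ?_
  filter_upwards [Metric.ball_mem_nhds x₀ (ht.trans htρ)] with x hx
  rw [Av, MeasureTheory.convolution_def]
  refine integral_congr_ae (Eventually.of_forall fun y => ?_)
  simp only [ContinuousLinearMap.mul_apply']
  by_cases hy : y ∈ A
  · rw [indicator_of_mem hy]
  · rw [indicator_of_notMem hy, zero_mul]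
    have hyx : ρ < ‖x - y‖ := by
      by_contra hle
      push Not at hle
      exact hy (closedBall_subset_Ann hρ hx (by
        rw [Metric.mem_closedBall, dist_eq_norm, norm_sub_rev]; exact hle))
    have := hkz (x - y) (by linarith)
    simp only [hk] at this
    rw [this, mul_zero]

/-- Averages of very weak solutions converge locally uniformly. -/
theorem ScalePair.exists_lim {e : ℕ} (he : e ≤ 1) {κ l f g : E n → ℝ}
    (h : ScalePair (n + e) κ l) (hw : VWeak {0}ᶜ f g) (hg : ContinuousOn g {0}ᶜ)
    (hf : ∀ r R, 0 < r → IntegrableOn f (Ann n r R)) :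
    ∃ D : E n → ℝ, ContinuousOn D {0}ᶜ ∧
      ∀ x, x ≠ 0 → Tendsto (Av (n + e) κ f x) (𝓝[>] 0) (𝓝 (D x)) := by
  obtain ⟨c, hc, H⟩ := h.diff_le he
  have key : ∀ x₀ : E n, x₀ ≠ 0 → ∃ B, 0 ≤ B ∧ ∀ x ∈ Metric.ball x₀ (‖x₀‖ / 4), ∀ s t : ℝ,
      0 < s → s ≤ t → t < ‖x₀‖ / 4 → t ≤ 1 → |Av (n + e) κ f x t - Av (n + e) κ f x s| ≤ B * t := by
    intro x₀ hx₀
    have hx0 : 0 < ‖x₀‖ := norm_pos_iff.2 hx₀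
    have hA := Ann_subset (n := n) (R := 2 * ‖x₀‖) (half_pos hx0)
    obtain ⟨G, hG⟩ := (isCompact_Ann _ _).exists_bound_of_continuousOn (hg.mono hA)
    refine ⟨c * |G|, by positivity, fun x hx s t hs hst htρ ht1 => ?_⟩
    have hb := closedBall_subset_Ann rfl hx
    refine (H hw (hb.trans hA) ((hf _ _ (half_pos hx0)).mono_set hb) (G := |G|)
      (fun y hy => (hG y (hb hy)).trans (le_abs_self G)) hs hst htρ).trans ?_
    have ht0 : 0 < t := hs.trans_le hst
    have : t ^ (1 - e) ≤ 1 := pow_le_one₀ ht0.le ht1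
    calc c * |G| * t ^ (1 - e) * (t - s) ≤ c * |G| * 1 * t := by gcongr; linarith
      _ = _ := by ring
  have hex : ∀ x : E n, x ≠ 0 → ∃ d, Tendsto (Av (n + e) κ f x) (𝓝[>] 0) (𝓝 d) := by
    intro x hx
    obtain ⟨B, hB, hb⟩ := key x hx
    have hx0 : 0 < ‖x‖ := norm_pos_iff.2 hx
    refine cauchy_map_iff_exists_tendsto.1 (Metric.cauchy_iff.2 ⟨inferInstance, fun ε hε => ?_⟩)
    set τ := min (min (‖x‖ / 8) 1) (ε / (2 * (B + 1))) with hτ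
    have hτ0 : 0 < τ := by positivity
    have hτ1 : τ ≤ ‖x‖ / 8 := (min_le_left _ _).trans (min_le_left _ _)
    have hτ2 : τ ≤ 1 := (min_le_left _ _).trans (min_le_right _ _)
    have hτ3 : B * τ < ε := by
      have h1 : τ ≤ ε / (2 * (B + 1)) := min_le_right _ _
      rw [le_div_iff₀ (by positivity)] at h1
      nlinarith
    have hle : ∀ s t, 0 < s → s ≤ t → t < τ →
        dist (Av (n + e) κ f x t) (Av (n + e) κ f x s) < ε := by
      intro s t h1 h2 h3
      rw [Real.dist_eq]
      refine (hb x (Metric.mem_ball_self (by positivity)) s t h1 h2 (by linarith)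
        (by linarith)).trans_lt ?_
      nlinarith
    refine ⟨_, image_mem_map (Ioo_mem_nhdsGT hτ0), ?_⟩
    rintro _ ⟨s, hs, rfl⟩ _ ⟨t, ht, rfl⟩
    rcases le_total s t with hst | hst
    · rw [dist_comm]; exact hle s t hs.1 hst ht.2
    · exact hle t s ht.1 hst hs.2
  choose! D hD using hex
  refine ⟨D, fun x₀ hx₀ => ContinuousAt.continuousWithinAt ?_, hD⟩
  obtain ⟨B, hB, hb⟩ := key x₀ hx₀
  have hx0 : 0 < ‖x₀‖ := norm_pos_iff.2 hx₀
  refine continuousAt_of_locally_uniform_approx_of_continuousAt fun V hV => ?_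
  obtain ⟨ε, hε, hεV⟩ := Metric.mem_uniformity_dist.1 hV
  set τ := min (min (‖x₀‖ / 8) 1) (ε / (2 * (B + 1))) with hτ
  have hτ0 : 0 < τ := by positivity
  have hτ1 : τ ≤ ‖x₀‖ / 8 := (min_le_left _ _).trans (min_le_left _ _)
  have hτ2 : τ ≤ 1 := (min_le_left _ _).trans (min_le_right _ _)
  have hτ3 : B * τ < ε := by
    have h1 : τ ≤ ε / (2 * (B + 1)) := min_le_right _ _
    rw [le_div_iff₀ (by positivity)] at h1
    nlinarith
  refine ⟨Metric.ball x₀ (‖x₀‖ / 4), Metric.ball_mem_nhds _ (by positivity),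
    fun x => Av (n + e) κ f x τ, continuousAt_Av h.smooth.continuous h.supp rfl
      (hf _ _ (half_pos hx0)) hτ0 (by linarith), fun x hx => hεV ?_⟩
  have hxne : x ≠ 0 := by
    rintro rfl
    rw [Metric.mem_ball, dist_zero_left] at hx
    linarith
  rw [dist_comm, Real.dist_eq]
  refine lt_of_le_of_lt ?_ hτ3
  refine le_of_tendsto ((tendsto_const_nhds.sub (hD x hxne)).abs) ?_
  filter_upwards [Ioo_mem_nhdsGT hτ0] with s hs
  exact hb x hx s τ hs.1 hs.2.le (by linarith) hτ2

section

variable {l : Fin n} {U : Fin n → E n → ℝ} {P : E n → ℝ}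

/-- The pressure extends across the interface as a continuously differentiable function. -/
theorem ReflSol.exists_ext (h : ReflSol l U P) :
    ∃ Q : E n → ℝ, ContDiffOn ℝ 1 Q {0}ᶜ ∧ ∀ x ∈ Off l, Q x = P x := by
  obtain ⟨η, β, hm⟩ := exists_moll (n := n) l.pos
  have hop : IsOpen ({0}ᶜ : Set (E n)) := isOpen_compl_singleton
  have hO := isOpen_Off l
  have hg : ContinuousOn (fun x => - src U x) {0}ᶜ := (continuousOn_src hop h.regU).neg
  have hP1 : ContDiffOn ℝ 1 P (Off l) := h.smP.of_le (by norm_num)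
  obtain ⟨Q, hQ, hQt⟩ := ScalePair.exists_lim (e := 0) (by norm_num) hm.pair h.vweakP hg
    (fun r R hr => h.integrableOn_P hr R)
  have hk := fun k => ScalePair.exists_lim (e := 1) le_rfl (hm.pair' k) h.vweakP hg
    (fun r R hr => h.integrableOn_P hr R)
  choose D hD hDt using hk
  have hQP : ∀ x ∈ Off l, Q x = P x := fun x hx =>
    tendsto_nhds_unique (hQt x (Off_subset l hx)) (Av_tendsto hm hO hP1.continuousOn hx)
  have hDP : ∀ x ∈ Off l, ∀ k, pd k P x = D k x := by
    intro x hx k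
    refine tendsto_nhds_unique (Av_tendsto hm hO (continuousOn_pd hO hP1) hx) ?_
    refine (hDt k x (Off_subset l hx)).congr' ?_
    obtain ⟨r, hr, h2⟩ := Metric.isOpen_iff.1 hO x hx
    filter_upwards [Ioo_mem_nhdsGT hr] with s hs
    exact Av_pd hm hO hP1 hs.1 ((Metric.closedBall_subset_ball hs.2).trans h2) k
  refine ⟨Q, (contDiffOn_of_Off (l := l) hQ (fun x hx => ?_) hD fun x hx k => ?_).1, hQP⟩
  · exact (diffAt hO hP1 hx).congr_of_eventuallyEq
      (Filter.eventuallyEq_of_mem (hO.mem_nhds hx) hQP)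
  · rw [pd_congr_open hO hx hQP]; exact hDP x hx k

end

section

variable {l : Fin n} {U : Fin n → E n → ℝ} {P : E n → ℝ}

lemma integral_flux_interface {A : Fin n → E n → ℝ} {a φ : E n → ℝ}
    (hA : ∀ i, ContinuousOn (A i) {0}ᶜ) (hA1 : ∀ i, ContDiffOn ℝ 1 (A i) (Off l))
    (ha : ∀ x ∈ Off l, ∑ i, pd i (A i) x = a x) (hac : ContinuousOn a {0}ᶜ) (hφ : Test {0}ᶜ φ) :
    ∫ x in ({0}ᶜ : Set (E n)), ∑ i, A i x * pd i φ x =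
      - ∫ x in ({0}ᶜ : Set (E n)), a x * φ x := by
  have hop : IsOpen ({0}ᶜ : Set (E n)) := isOpen_compl_singleton
  have c1 : CC {0}ᶜ (fun x => ∑ i, A i x * pd i φ x) :=
    CC.sum fun i _ => (hφ.pd_cc i).mul_left hop (hA i)
  have c2 : CC {0}ᶜ (fun x => a x * φ x) := hφ.cc.mul_left hop hac
  have c3 : CC {0}ᶜ (fun x => A l x * φ x) := hφ.cc.mul_left hop (hA l)
  obtain ⟨r, R, hr, hR⟩ := hφ.cc.exists_Ann
  have hz := integral_div_zero_interface (l := l) (R := R) (V := fun i y => A i y * φ y)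
    (g := fun x => ∑ i, A i x * pd i φ x + a x * φ x)
    (fun i => (hA1 i).mul hφ.smooth.contDiffOn)
    (fun i x hx => by
      rw [image_eq_zero_of_notMem_tsupport (f := φ) fun h => by linarith [(hR h).2], mul_zero])
    (fun x hx => by
      rw [sum_pd_mul (hφ.diff x) fun i => diffAt (isOpen_Off l) (hA1 i) hx, ha x hx])
    (c1.integrable.add c2.integrable)
    (fun δ hδ => by
      obtain ⟨ε, hε, H⟩ := c3.slab (l := l) hδ
      exact ⟨ε, hε, fun x _ hx => H x hx⟩)
  rw [integral_add c1.integrable c2.integrable] at hz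
  rw [c1.setIntegral, c2.setIntegral]
  linarith

theorem ReflSol.exists_sol (h : ReflSol l U P) {C : ℝ} (hC : 0 < C)
    (hb : ∀ j x, x ≠ 0 → |U j x| ≤ C / ‖x‖) : ∃ Q, Sol C U Q := by
  obtain ⟨Q, hQ, hQP⟩ := h.exists_ext
  have hop : IsOpen ({0}ᶜ : Set (E n)) := isOpen_compl_singleton
  have hO := isOpen_Off l
  have hpd : ∀ x ∈ Off l, ∀ k, pd k Q x = pd k P x := fun x hx k => pd_congr_open hO hx hQP
  have hcc : ∀ j, ContinuousOn (fun x => conv U j x + pd j Q x) {0}ᶜ := fun j =>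
    (continuousOn_conv hop h.regU j).add (continuousOn_pd hop hQ)
  refine ⟨Q, ⟨⟨h.regU, hQ, fun x hx => ?_, fun φ hφ j => ?_, fun φ hφ j => ?_, fun φ hφ => ?_⟩,
    hC, hb⟩⟩
  · have hcont : ContinuousOn (fun x => ∑ i, pd i (U i) x) {0}ᶜ :=
      continuousOn_finsetSum _ fun i _ => continuousOn_pd hop (h.regU i)
    have hcl : x ∈ closure (Off l) := dense_Off l x
    have hne : (𝓝[Off l] x).NeBot := mem_closure_iff_nhdsWithin_neBot.1 hcl
    refine tendsto_nhds_unique ((hcont x hx).mono (Off_subset l)).tendsto ?_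
    refine tendsto_const_nhds.congr' ?_
    filter_upwards [self_mem_nhdsWithin] with y hy
    exact (h.div y hy).symm
  · exact integral_flux_interface (l := l) (A := fun i => pd i (U j))
      (fun i => continuousOn_pd hop (h.regU j)) (fun i => (h.sm2 hO i j).of_le (by norm_num))
      (fun x hx => by rw [hpd x hx]; exact h.ns x hx j) (hcc j) hφ
  · exact integral_flux_interface (l := l) (A := fun i => vort U i j)
      (fun i => continuousOn_vort hop h.regU i j) (fun i => (h.smv hO i j).of_le (by norm_num))
      (fun x hx => by rw [hpd x hx]; exact h.div_vort hO hx j) (hcc j) hφ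
  · rw [integral_flux_interface (l := l) (A := fun i => pd i Q) (a := fun x => - src U x)
      (fun i => continuousOn_pd hop hQ)
      (fun i => (contDiffOn_pd hO h.smP (by norm_num)).congr fun x hx => hpd x hx i)
      (fun x hx => ?_) (continuousOn_src hop h.regU).neg hφ, ← integral_neg]
    · simp
    · rw [← h.lap_P hO hx]
      exact Finset.sum_congr rfl fun i _ => pd_congr_open hO hx fun y hy => hpd y hy i

theorem ReflSol.eq_zero (hn : 4 ≤ n) (h : ReflSol l U P) {C : ℝ} (hC : 0 < C)
    (hb : ∀ j x, x ∈ Off l → |U j x| ≤ C / ‖x‖) (j : Fin n) {x : E n} (hx : x ≠ 0) :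
    U j x = 0 := by
  obtain ⟨Q, hQ⟩ := h.exists_sol hC fun j x hx => by
    have hne : (𝓝[Off l] x).NeBot := mem_closure_iff_nhdsWithin_neBot.1 (dense_Off l x)
    have h1 : Tendsto (fun y => |U j y|) (𝓝[Off l] x) (𝓝 |U j x|) :=
      (((h.regU j).continuousOn x hx).mono (Off_subset l)).tendsto.abs
    have h2 : Tendsto (fun y : E n => C / ‖y‖) (𝓝[Off l] x) (𝓝 (C / ‖x‖)) :=
      (tendsto_const_nhds.div continuous_norm.continuousAt.tendsto
        (norm_ne_zero_iff.2 hx)).mono_left nhdsWithin_le_nhds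
    exact le_of_tendsto_of_tendsto h1 h2 (by
      filter_upwards [self_mem_nhdsWithin] with y hy using hb j y hy)
  exact hQ.eq_zero hn j hx

end

/-- Reflection of a function on the upper half space, with sign `s`. -/
noncomputable def reflect (l : Fin n) (s : ℝ) (a : E n → ℝ) (x : E n) : ℝ :=
  if 0 ≤ x l then a x else s * a (mirror l x)

section

variable {l : Fin n} {s : ℝ} {a : E n → ℝ} {x : E n}

lemma reflect_of_pos (hx : 0 < x l) : reflect l s a x = a x := if_pos hx.le

lemma reflect_of_neg (hx : x l < 0) : reflect l s a x = s * a (mirror l x) := if_neg hx.not_ge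

lemma isOpen_pos (l : Fin n) : IsOpen {x : E n | 0 < x l} :=
  isOpen_lt continuous_const (continuous_coord l)

lemma isOpen_neg (l : Fin n) : IsOpen {x : E n | x l < 0} :=
  isOpen_lt (continuous_coord l) continuous_const

lemma mirror_pos (hx : x l < 0) : 0 < mirror l x l := by rw [mirror_last]; linarith

lemma pd_reflect_pos (hx : 0 < x l) (i : Fin n) : pd i (reflect l s a) x = pd i a x :=
  pd_congr_open (isOpen_pos l) hx fun _ hy => reflect_of_pos hy

lemma pd_reflect_neg (ha : ∀ x, 0 < x l → DifferentiableAt ℝ a x) (hx : x l < 0) (i : Fin n) :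
    pd i (reflect l s a) x = s * sg l i * pd i a (mirror l x) := by
  have hd : DifferentiableAt ℝ (fun y => a (mirror l y)) x :=
    (ha _ (mirror_pos hx)).comp x (mirror l).differentiableAt
  rw [pd_congr_open (isOpen_neg l) hx (g := fun y => s * a (mirror l y)) fun _ hy =>
    reflect_of_neg hy, pd_const_mul s hd, pd_mirror, mul_assoc]

lemma pd_reflect (ha : ∀ x, 0 < x l → DifferentiableAt ℝ a x) (hx : x ∈ Off l) (i : Fin n) :
    pd i (reflect l s a) x = reflect l (s * sg l i) (pd i a) x := by
  rcases lt_or_gt_of_ne (show x l ≠ 0 from hx) with h | h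
  · rw [reflect_of_neg h, pd_reflect_neg ha h]
  · rw [reflect_of_pos h, pd_reflect_pos h]

lemma contDiffOn_reflect {k : WithTop ℕ∞} (ha : ContDiffOn ℝ k a {x | 0 < x l}) :
    ContDiffOn ℝ k (reflect l s a) (Off l) := by
  intro x hx
  refine ContDiffAt.contDiffWithinAt ?_
  rcases lt_or_gt_of_ne (show x l ≠ 0 from hx) with h | h
  · have h1 : ContDiffAt ℝ k (fun y => s * a (mirror l y)) x :=
      contDiffAt_const.mul ((ha.contDiffAt ((isOpen_pos l).mem_nhds (mirror_pos h))).comp x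
        (mirror l).contDiff.contDiffAt)
    exact h1.congr_of_eventuallyEq
      (Filter.eventuallyEq_of_mem ((isOpen_neg l).mem_nhds h) fun _ hy => reflect_of_neg hy)
  · exact (ha.contDiffAt ((isOpen_pos l).mem_nhds h)).congr_of_eventuallyEq
      (Filter.eventuallyEq_of_mem ((isOpen_pos l).mem_nhds h) fun _ hy => reflect_of_pos hy)

lemma lap_reflect (ha : ContDiffOn ℝ 2 a {x | 0 < x l}) (hx : x ∈ Off l) :
    lap (reflect l s a) x = reflect l s (lap a) x := by
  have hd : ∀ x, 0 < x l → DifferentiableAt ℝ a x := fun x hx =>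
    diffAt (isOpen_pos l) (ha.of_le (by norm_num)) hx
  have hd2 : ∀ i x, 0 < x l → DifferentiableAt ℝ (pd i a) x := fun i x hx =>
    diffAt (isOpen_pos l) (contDiffOn_pd (isOpen_pos l) ha (by norm_num)) hx
  have e : ∀ i, pd i (pd i (reflect l s a)) x = reflect l s (pd i (pd i a)) x := by
    intro i
    rw [pd_congr_open (isOpen_Off l) hx fun y hy => pd_reflect hd hy i, pd_reflect (hd2 i) hx,
      mul_assoc, sg_mul_self, mul_one]
  simp only [lap, e]
  unfold reflect
  split_ifs
  · rfl
  · exact (Finset.mul_sum _ _ _).symm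

lemma reflect_one_mirror (x : E n) : reflect l 1 a (mirror l x) = reflect l 1 a x := by
  rcases lt_trichotomy (x l) 0 with h | h | h
  · rw [reflect_of_pos (mirror_pos h), reflect_of_neg h, one_mul]
  · rw [mirror_eq l h]
  · rw [reflect_of_neg (by rw [mirror_last]; linarith), reflect_of_pos h, mirror_mirror, one_mul]

/-- Reflection preserves the steady Navier-Stokes equations. -/
lemma ClassSol.reflect {w : Fin n → E n → ℝ} {p : E n → ℝ} (h : ClassSol {x | 0 < x l} w p) :
    ClassSol (Off l) (fun j => reflect l (sg l j) (w j)) (reflect l 1 p) := by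
  have ho := isOpen_pos l
  have hd : ∀ j x, 0 < x l → DifferentiableAt ℝ (w j) x := fun j x hx => h.dU ho hx j
  have hp : ∀ x, 0 < x l → DifferentiableAt ℝ p x := fun x hx =>
    diffAt ho (h.smP.of_le (by norm_num)) hx
  refine ⟨fun j => contDiffOn_reflect (h.smU j), contDiffOn_reflect h.smP, fun x hx j => ?_,
    fun x hx => ?_⟩
  · rw [lap_reflect ((h.smU j).of_le (by norm_num)) hx, conv, pd_reflect hp hx]
    simp only [pd_reflect (hd j) hx]
    rcases lt_or_gt_of_ne (show x l ≠ 0 from hx) with hl | hl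
    · simp only [reflect_of_neg hl]
      rw [h.ns _ (mirror_pos hl) j, conv, one_mul, mul_add, Finset.mul_sum]
      congr 1
      refine Finset.sum_congr rfl fun i _ => ?_
      linear_combination (- sg l j * w i (mirror l x) * pd i (w j) (mirror l x)) * sg_mul_self l i
    · simp only [reflect_of_pos hl]
      exact h.ns x hl j
  · have e : ∀ i, pd i (SteadyNS.reflect l (sg l i) (w i)) x = SteadyNS.reflect l 1 (pd i (w i)) x := by
      intro i
      rw [pd_reflect (hd i) hx, sg_mul_self]
    simp only [e]
    rcases lt_or_gt_of_ne (show x l ≠ 0 from hx) with hl | hl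
    · simp only [reflect_of_neg hl, one_mul]
      exact h.div _ (mirror_pos hl)
    · simp only [reflect_of_pos hl]
      exact h.div x hl

lemma uniqueDiffOn_halfSpace (l : Fin n) : UniqueDiffOn ℝ {x : E n | 0 ≤ x l} := by
  refine uniqueDiffOn_convex ?_ ⟨EuclideanSpace.single l 1, ?_⟩
  · exact convex_halfSpace_ge (f := fun x : E n => x l) ⟨fun _ _ => rfl, fun _ _ => rfl⟩ 0
  · have h : {x : E n | 0 < x l} ⊆ {x | 0 ≤ x l} := fun x hx => (show 0 < x l from hx).le
    exact interior_maximal h (isOpen_pos l)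
      (show 0 < (EuclideanSpace.single l (1:ℝ) : E n) l by simp)

lemma halfSpace_sdiff (l : Fin n) :
    {x : E n | 0 ≤ x l} \ {0} = {x : E n | 0 ≤ x l} ∩ {0}ᶜ := sdiff_eq

lemma fderivWithin_halfSpace_sdiff {f : E n → ℝ} (hx : x ≠ 0) :
    fderivWithin ℝ f ({x | 0 ≤ x l} \ {0}) x = fderivWithin ℝ f {x | 0 ≤ x l} x := by
  rw [halfSpace_sdiff, fderivWithin_inter (isOpen_compl_singleton.mem_nhds hx)]

/-- Tangential derivatives of a function vanishing on the boundary vanish there. -/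
lemma fderivWithin_tangential {f : E n → ℝ} (hf : ContDiffOn ℝ 1 f ({x | 0 ≤ x l} \ {0}))
    (h0 : ∀ x, x l = 0 → x ≠ 0 → f x = 0) (hxl : x l = 0) (hx : x ≠ 0) {i : Fin n} (hi : i ≠ l) :
    fderivWithin ℝ f ({x | 0 ≤ x l} \ {0}) x (EuclideanSpace.single i 1) = 0 := by
  have hd : HasFDerivWithinAt f (fderivWithin ℝ f ({x | 0 ≤ x l} \ {0}) x) ({x | 0 ≤ x l} \ {0}) x :=
    (hf.differentiableOn one_ne_zero x ⟨hxl.ge, hx⟩).hasFDerivWithinAt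
  have hc : HasDerivAt (fun t : ℝ => x + t • EuclideanSpace.single i (1:ℝ))
      (EuclideanSpace.single i (1:ℝ)) 0 := by
    simpa using ((hasDerivAt_id (0:ℝ)).smul_const (EuclideanSpace.single i (1:ℝ))).const_add x
  have hl : ∀ t : ℝ, (x + t • EuclideanSpace.single i (1:ℝ)) l = 0 := by
    intro t; simp [hxl, hi.symm]
  have hne : ∀ᶠ t : ℝ in 𝓝 0, x + t • EuclideanSpace.single i (1:ℝ) ≠ 0 :=
    hc.continuousAt.eventually_ne (by simpa using hx)
  have hx0 : x + (0:ℝ) • EuclideanSpace.single i (1:ℝ) = x := by simp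
  rw [← hx0] at hd
  have hmem : ∀ᶠ t : ℝ in 𝓝 0,
      x + t • EuclideanSpace.single i (1:ℝ) ∈ {x : E n | 0 ≤ x l} \ {0} :=
    hne.mono fun t ht => ⟨(hl t).ge, ht⟩
  have h1 := hd.comp_hasDerivAt (0:ℝ) hc hmem
  have h2 : HasDerivAt (f ∘ fun t : ℝ => x + t • EuclideanSpace.single i (1:ℝ)) 0 0 :=
    (hasDerivAt_const (0:ℝ) (0:ℝ)).congr_of_eventuallyEq
      (hne.mono fun t ht => h0 _ (hl t) ht)
  have h3 := h1.unique h2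
  rwa [hx0] at h3

/-- Under the slip conditions the reflected velocity is continuously differentiable. -/
lemma contDiffOn_reflect_slip {w : Fin n → E n → ℝ}
    (hw : ∀ j, ContDiffOn ℝ 1 (w j) ({x | 0 ≤ x l} \ {0}))
    (h1 : ∀ x, x l = 0 → x ≠ 0 → w l x = 0)
    (h2 : ∀ x, x l = 0 → x ≠ 0 → ∀ i, i ≠ l →
      fderivWithin ℝ (w i) {x | 0 ≤ x l} x (EuclideanSpace.single l 1) = 0) (j : Fin n) :
    ContDiffOn ℝ 1 (reflect l (sg l j) (w j)) {0}ᶜ := by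
  have hud : UniqueDiffOn ℝ ({x : E n | 0 ≤ x l} \ {0}) := by
    rw [halfSpace_sdiff]
    exact (uniqueDiffOn_halfSpace l).inter isOpen_compl_singleton
  have hnh : ∀ x : E n, 0 < x l → {x : E n | 0 ≤ x l} \ {0} ∈ 𝓝 x := fun x hx =>
    Filter.mem_of_superset ((isOpen_pos l).mem_nhds hx) fun y hy =>
      ⟨(show 0 < y l from hy).le, by rintro rfl; simp at hy⟩
  have hd : ∀ x, 0 < x l → DifferentiableAt ℝ (w j) x := fun x hx =>
    ((hw j).differentiableOn one_ne_zero).differentiableAt (hnh x hx)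
  refine (contDiffOn_of_Off (l := l) (A := fun i => reflect l (sg l j * sg l i)
    (fun x => fderivWithin ℝ (w j) ({x | 0 ≤ x l} \ {0}) x (EuclideanSpace.single i 1)))
    (continuousOn_reflect (hw j).continuousOn fun x hx hx0 => ?_) (fun x hx => ?_) (fun i => ?_)
    (fun x hx i => ?_)).1
  · by_cases hj : j = l
    · subst hj; rw [h1 x hx hx0, mul_zero]
    · rw [sg_of_ne hj, one_mul]
  · rcases lt_or_gt_of_ne (show x l ≠ 0 from hx) with h | h
    · have h1 : DifferentiableAt ℝ (fun y => sg l j * w j (mirror l y)) x :=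
        ((hd _ (mirror_pos h)).comp x (mirror l).differentiableAt).const_mul _
      exact h1.congr_of_eventuallyEq
        (Filter.eventuallyEq_of_mem ((isOpen_neg l).mem_nhds h) fun _ hy => reflect_of_neg hy)
    · exact (hd x h).congr_of_eventuallyEq
        (Filter.eventuallyEq_of_mem ((isOpen_pos l).mem_nhds h) fun _ hy => reflect_of_pos hy)
  · refine continuousOn_reflect
      (((hw j).continuousOn_fderivWithin hud le_rfl).clm_apply continuousOn_const)
      fun x hx hx0 => ?_
    by_cases hj : j = l
    · by_cases hi : i = l
      · rw [hi, hj, sg_mul_self, one_mul]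
      · subst hj
        rw [fderivWithin_tangential (hw j) h1 hx hx0 hi, mul_zero]
    · by_cases hi : i = l
      · subst hi
        rw [fderivWithin_halfSpace_sdiff hx0, h2 x hx hx0 j hj, mul_zero]
      · rw [sg_of_ne hj, sg_of_ne hi, one_mul, one_mul]
  · have e : ∀ y, 0 < y l → pd i (w j) y =
        fderivWithin ℝ (w j) ({x | 0 ≤ x l} \ {0}) y (EuclideanSpace.single i 1) := fun y hy => by
      rw [fderivWithin_of_mem_nhds (hnh y hy)]; rfl
    refine (pd_reflect (s := sg l j) hd hx i).trans ?_
    rcases lt_or_gt_of_ne (show x l ≠ 0 from hx) with h | h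
    · rw [reflect_of_neg h, reflect_of_neg h, e _ (mirror_pos h)]
    · rw [reflect_of_pos h, reflect_of_pos h, e _ h]

end

end SteadyNS

/-- **Rigidity of steady Navier-Stokes solutions in the half space ℝⁿ₊ \ {0}, n ≥ 4,
with Navier slip boundary conditions.**  If `(u, p)` is a smooth solution of the steady
Navier-Stokes equations on `Ω = ℝⁿ₊ \ {0}`, `u` extends (with its first derivatives)
continuously up to `∂ℝⁿ₊ \ {0}` where it satisfies the Navier slip conditions
`uₙ = 0`, `∂ₙ uᵢ = 0` for `i ≠ n`, and `|u(x)| ≤ C/|x|` on `Ω`, then `u ≡ 0` on `Ω`. -/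
theorem rigidity_steady_NS_half_space_Navier_slip {n : ℕ} (hn : 4 ≤ n)
    (last : Fin n) (hlast : (last : ℕ) = n - 1)
    (u : EuclideanSpace ℝ (Fin n) → EuclideanSpace ℝ (Fin n))
    (p : EuclideanSpace ℝ (Fin n) → ℝ)
    -- smoothness in the open half space minus the origin
    (hu : ContDiffOn ℝ (⊤ : ℕ∞) u {x : EuclideanSpace ℝ (Fin n) | 0 < x last ∧ x ≠ 0})
    (hp : ContDiffOn ℝ (⊤ : ℕ∞) p {x : EuclideanSpace ℝ (Fin n) | 0 < x last ∧ x ≠ 0})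
    -- `u` extends, together with its first derivatives, continuously up to the boundary
    (hu1 : ContDiffOn ℝ 1 u ({x : EuclideanSpace ℝ (Fin n) | 0 ≤ x last} \ {0}))
    -- steady Navier-Stokes equations on Ω
    (hNS : ∀ x : EuclideanSpace ℝ (Fin n), 0 < x last → x ≠ 0 → ∀ j : Fin n,
      -(∑ i : Fin n, fderiv ℝ (fun y => fderiv ℝ (fun z => u z j) y
            (EuclideanSpace.single i 1)) x (EuclideanSpace.single i 1)) +
        (∑ i : Fin n, u x i * fderiv ℝ (fun z => u z j) x (EuclideanSpace.single i 1)) +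
        fderiv ℝ p x (EuclideanSpace.single j 1) = 0)
    (hdiv : ∀ x : EuclideanSpace ℝ (Fin n), 0 < x last → x ≠ 0 →
      ∑ i : Fin n, fderiv ℝ (fun z => u z i) x (EuclideanSpace.single i 1) = 0)
    -- Navier slip boundary conditions on ∂ℝⁿ₊ \ {0} : uₙ = 0 and ∂ₙ uᵢ = 0 for i ≠ n
    (hslip₁ : ∀ x : EuclideanSpace ℝ (Fin n), x last = 0 → x ≠ 0 → u x last = 0)
    (hslip₂ : ∀ x : EuclideanSpace ℝ (Fin n), x last = 0 → x ≠ 0 → ∀ i : Fin n, i ≠ last →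
      fderivWithin ℝ (fun z => u z i) {y : EuclideanSpace ℝ (Fin n) | 0 ≤ y last} x
        (EuclideanSpace.single last 1) = 0)
    (C : ℝ) (hC : 0 < C)
    (hbound : ∀ x : EuclideanSpace ℝ (Fin n), 0 < x last → x ≠ 0 → ‖u x‖ ≤ C / ‖x‖) :
    ∀ x : EuclideanSpace ℝ (Fin n), 0 < x last → x ≠ 0 → u x = 0 := by
  have hne : ∀ x : EuclideanSpace ℝ (Fin n), 0 < x last → x ≠ 0 := by
    rintro x hx rfl
    simp at hx
  have hset : {x : EuclideanSpace ℝ (Fin n) | 0 < x last ∧ x ≠ 0} =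
      {x : EuclideanSpace ℝ (Fin n) | 0 < x last} :=
    Set.ext fun x => ⟨fun h => h.1, fun h => ⟨h, hne x h⟩⟩
  rw [hset] at hu hp
  have hcomp : ∀ j, ContDiffOn ℝ (⊤ : ℕ∞) (fun z => u z j)
      {x : EuclideanSpace ℝ (Fin n) | 0 < x last} := contDiffOn_euclidean.1 hu
  have hcomp1 : ∀ j, ContDiffOn ℝ 1 (fun z => u z j)
      ({x : EuclideanSpace ℝ (Fin n) | 0 ≤ x last} \ {0}) := contDiffOn_euclidean.1 hu1
  have hcl : SteadyNS.ClassSol {x : EuclideanSpace ℝ (Fin n) | 0 < x last} (fun j z => u z j) p :=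
    ⟨fun j => contDiffOn_infty.1 (hcomp j) 3, contDiffOn_infty.1 hp 2, fun x hx j => by
      have h := hNS x hx (hne x hx) j
      have e : ∀ a b c : ℝ, -a + b + c = 0 → a = b + c := fun a b c h => by linarith
      exact e _ _ _ h, fun x hx => hdiv x hx (hne x hx)⟩
  have hrefl : SteadyNS.ReflSol last
      (fun j => SteadyNS.reflect last (SteadyNS.sg last j) (fun z => u z j))
      (SteadyNS.reflect last 1 p) :=
    ⟨hcl.reflect, SteadyNS.contDiffOn_reflect_slip hcomp1 hslip₁ hslip₂,
      SteadyNS.reflect_one_mirror⟩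
  have hb : ∀ j x, 0 < x last → |u x j| ≤ C / ‖x‖ := fun j x hx =>
    (SteadyNS.abs_coord_le _ j).trans (hbound x hx (hne x hx))
  have hbr : ∀ j x, x ∈ SteadyNS.Off last →
      |SteadyNS.reflect last (SteadyNS.sg last j) (fun z => u z j) x| ≤ C / ‖x‖ := by
    intro j x hx
    rcases lt_or_gt_of_ne (show x last ≠ 0 from hx) with h | h
    · rw [SteadyNS.reflect_of_neg h, abs_mul, SteadyNS.abs_sg, one_mul]
      simpa using hb j _ (SteadyNS.mirror_pos h)
    · rw [SteadyNS.reflect_of_pos h]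
      exact hb j x h
  intro x hx hx0
  ext j
  have h := hrefl.eq_zero hn hC hbr j hx0
  rwa [SteadyNS.reflect_of_pos hx] at h
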